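/- arXiv:math/0311219 — 2 statements merged into one kernel-verified Lean document; each statement's English description precedes it below -/
import Mathlib

section
/- Let ψ : ℝ^n∖{0} → ℝ^n∖{0} be a smooth bijection with smooth inverse ψ^{-1}, with both ψ and ψ^{-1} positively homogeneous of degree 1, and assume |det Dψ(ξ)| ≥ C₀ > 0 for all ξ ≠ 0. Let m ∈ ℝ with |m| ≤ [n/2]_−, where [n/2]_− denotes the greatest integer strictly less than n/2. Then the operators T_ψ u := F^{-1}[(Fu)∘ψ] and T_ψ^{-1} u := F^{-1}[(Fu)∘ψ^{-1}], defined for Schwartz u, are bounded on the weighted space L²_m(ℝ^n): there is C with ‖⟨x⟩^m T_ψ u‖_{L²} ≤ C ‖⟨x⟩^m u‖_{L²} and ‖⟨x⟩^m T_ψ^{-1} u‖_{L²} ≤ C ‖⟨x⟩^m u‖_{L²} for all Schwartz u. -/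
open MeasureTheory Complex SchwartzMap
open scoped BigOperators ENNReal Real RealInnerProductSpace

noncomputable section

/-- The Fourier transform `F u(ξ) = ∫ e^{-i x·ξ} u(x) dx` (for integrable `u`). -/
def FTint {n : ℕ} (u : EuclideanSpace ℝ (Fin n) → ℂ) (ξ : EuclideanSpace ℝ (Fin n)) : ℂ :=
  ∫ x, Complex.exp (-(Complex.I * (⟪x, ξ⟫ : ℝ))) * u x

/-- The inverse Fourier transform
`F⁻¹ v(x) = (2π)^{-n} ∫ e^{i x·ξ} v(ξ) dξ` (for integrable `v`). -/
def FTinvInt {n : ℕ} (v : EuclideanSpace ℝ (Fin n) → ℂ) (x : EuclideanSpace ℝ (Fin n)) : ℂ :=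
  (((2 * Real.pi) ^ n : ℝ) : ℂ)⁻¹ * ∫ ξ, Complex.exp (Complex.I * (⟪x, ξ⟫ : ℝ)) * v ξ

/-- The Japanese bracket `⟨x⟩ = (1+|x|²)^{1/2}`. -/
def jap {n : ℕ} (x : EuclideanSpace ℝ (Fin n)) : ℝ := Real.sqrt (1 + ‖x‖ ^ 2)

/-- The Jacobian matrix `Dψ(ξ)` of a map `ψ : ℝ^n → ℝ^n`. -/
def jacMat {n : ℕ} (ψ : EuclideanSpace ℝ (Fin n) → EuclideanSpace ℝ (Fin n))
    (ξ : EuclideanSpace ℝ (Fin n)) : Matrix (Fin n) (Fin n) ℝ :=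
  Matrix.of fun i j => fderiv ℝ ψ ξ (EuclideanSpace.single j 1) i

namespace TPsi

open Filter Topology Set
open scoped ContDiff

abbrev EE (n : ℕ) := EuclideanSpace ℝ (Fin n)

variable {n : ℕ}

/-- the standard basis vector -/
abbrev bv (i : Fin n) : EE n := EuclideanSpace.single i (1 : ℝ)

/-- partial derivative -/
def pd {F : Type*} [NormedAddCommGroup F] [NormedSpace ℝ F] (i : Fin n) (f : EE n → F) : EE n → F :=
  fun x => fderiv ℝ f x (bv i)

/-- homogeneous Sobolev norms -/
def NN : ℕ → (EE n → ℂ) → ℝ≥0∞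
  | 0, f => eLpNorm f 2 volume
  | k + 1, f => ∑ i, NN k (pd i f)

/-- test functions vanishing near zero -/
structure TF (f : EE n → ℂ) : Prop where
  smooth : ContDiff ℝ ∞ f
  cpt : HasCompactSupport f
  zero : f =ᶠ[𝓝 0] 0

lemma contDiff_pd {F : Type*} [NormedAddCommGroup F] [NormedSpace ℝ F]
    {f : EE n → F} (hf : ContDiff ℝ ∞ f) (i : Fin n) : ContDiff ℝ ∞ (pd i f) := by
  unfold pd
  have : ContDiff ℝ ∞ (fderiv ℝ f) := hf.fderiv_right (by simp)
  fun_prop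

lemma TF.pd {f : EE n → ℂ} (hf : TF f) (i : Fin n) : TF (pd i f) where
  smooth := contDiff_pd hf.smooth i
  cpt := hf.cpt.fderiv_apply ℝ _
  zero := by
    have h := hf.zero.fderiv (𝕜 := ℝ)
    filter_upwards [h] with x hx
    simp [TPsi.pd, hx]

lemma pd_add {f g : EE n → ℂ} (hf : ContDiff ℝ ∞ f) (hg : ContDiff ℝ ∞ g) (i : Fin n) :
    pd i (fun x => f x + g x) = fun x => pd i f x + pd i g x := by
  funext x
  unfold pd
  rw [fderiv_fun_add (hf.differentiable (by simp) x) (hg.differentiable (by simp) x)]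
  simp

lemma NN_add (k : ℕ) {f g : EE n → ℂ} (hf : ContDiff ℝ ∞ f) (hg : ContDiff ℝ ∞ g) :
    NN k (fun x => f x + g x) ≤ NN k f + NN k g := by
  induction k generalizing f g with
  | zero =>
    exact eLpNorm_add_le hf.continuous.aestronglyMeasurable hg.continuous.aestronglyMeasurable
      (by norm_num)
  | succ k ih =>
    simp only [NN]
    rw [← Finset.sum_add_distrib]
    gcongr with i
    rw [pd_add hf hg]
    exact ih (contDiff_pd hf i) (contDiff_pd hg i)

lemma pd_const_mul (c : ℂ) {f : EE n → ℂ} (hf : ContDiff ℝ ∞ f) (i : Fin n) :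
    pd i (fun x => c * f x) = fun x => c * pd i f x := by
  funext x
  unfold pd
  rw [fderiv_const_mul (hf.differentiable (by simp) x)]
  simp

lemma NN_const_mul (k : ℕ) (c : ℂ) {f : EE n → ℂ} (hf : ContDiff ℝ ∞ f) :
    NN k (fun x => c * f x) = ‖c‖ₑ * NN k f := by
  induction k generalizing f with
  | zero =>
    exact eLpNorm_const_smul c f 2 volume
  | succ k ih =>
    simp only [NN]
    rw [Finset.mul_sum]
    congr 1; funext i
    rw [pd_const_mul c hf, ih (contDiff_pd hf i)]

lemma NN_zero (k : ℕ) : NN k (fun _ : EE n => (0 : ℂ)) = 0 := by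
  have := NN_const_mul (n := n) k 0 (f := fun _ => 0) contDiff_const
  simpa using this

lemma NN_sum (k : ℕ) {ι : Type*} (s : Finset ι) (f : ι → EE n → ℂ)
    (hf : ∀ i ∈ s, ContDiff ℝ ∞ (f i)) :
    NN k (fun x => ∑ i ∈ s, f i x) ≤ ∑ i ∈ s, NN k (f i) := by
  classical
  induction s using Finset.induction_on with
  | empty => simp [NN_zero]
  | insert a s ha ih =>
    simp only [Finset.sum_insert ha]
    refine (NN_add k (hf a (by simp)) ?_).trans ?_
    · exact ContDiff.sum fun i hi => hf i (by simp [hi])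
    · gcongr
      exact ih fun i hi => hf i (by simp [hi])

/-- smooth homogeneous functions of degree `-r` -/
structure HF (r : ℕ) (a : EE n → ℝ) : Prop where
  smooth : ContDiffOn ℝ ∞ a {0}ᶜ
  hom : ∀ lam : ℝ, 0 < lam → ∀ ξ, ξ ≠ 0 → a (lam • ξ) = (lam ^ r)⁻¹ * a ξ

lemma isOpen_c : IsOpen ({0}ᶜ : Set (EE n)) := isOpen_compl_singleton

lemma fderiv_hom {F : Type*} [NormedAddCommGroup F] [NormedSpace ℝ F]
    {a : EE n → F} (ha : ContDiffOn ℝ ∞ a {0}ᶜ) {lam c : ℝ} (hl : 0 < lam)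
    (h : ∀ ξ, ξ ≠ 0 → a (lam • ξ) = c • a ξ) {ξ : EE n} (hξ : ξ ≠ 0) :
    fderiv ℝ a (lam • ξ) = (lam⁻¹ * c) • fderiv ℝ a ξ := by
  have hd : ∀ η : EE n, η ≠ 0 → DifferentiableAt ℝ a η := fun η hη =>
    ((ha.contDiffAt (isOpen_c.mem_nhds hη)).differentiableAt (by simp))
  have h1 : HasFDerivAt (fun ξ => a (lam • ξ))
      ((fderiv ℝ a (lam • ξ)).comp (lam • ContinuousLinearMap.id ℝ (EE n))) ξ := by
    refine HasFDerivAt.comp ξ (hd _ (smul_ne_zero hl.ne' hξ)).hasFDerivAt ?_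
    exact (hasFDerivAt_id ξ).const_smul lam
  have h2 : HasFDerivAt (fun ξ => a (lam • ξ)) (c • fderiv ℝ a ξ) ξ := by
    refine ((hd ξ hξ).hasFDerivAt.const_smul c).congr_of_eventuallyEq ?_
    filter_upwards [isOpen_c.mem_nhds hξ] with η hη using h η hη
  have h3 := h1.unique h2
  ext v
  have := congrArg (fun L => L v) h3
  simp only [ContinuousLinearMap.comp_apply, smul_apply,
    ContinuousLinearMap.id_apply, map_smul] at this
  rw [smul_apply, mul_smul, ← this, smul_smul, inv_mul_cancel₀ hl.ne',
    one_smul]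

lemma HF.bound {r : ℕ} {a : EE n → ℝ} (ha : HF r a) :
    ∃ C : ℝ, 0 ≤ C ∧ ∀ ξ, ξ ≠ 0 → |a ξ| ≤ C * (‖ξ‖ ^ r)⁻¹ := by
  have hc : ContinuousOn a (Metric.sphere (0 : EE n) 1) :=
    ha.smooth.continuousOn.mono fun x hx => by
      intro h; simp at h; simp [h] at hx
  obtain ⟨C, hC⟩ := (isCompact_sphere (0 : EE n) 1).exists_bound_of_continuousOn hc
  refine ⟨max C 0, le_max_right _ _, fun ξ hξ => ?_⟩
  have hp : 0 < ‖ξ‖ := norm_pos_iff.2 hξ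
  have h1 : (‖ξ‖⁻¹ • ξ) ≠ 0 := smul_ne_zero (by positivity) hξ
  have h2 : a ξ = (‖ξ‖ ^ r)⁻¹ * a (‖ξ‖⁻¹ • ξ) := by
    rw [← ha.hom ‖ξ‖ hp _ h1, smul_smul, mul_inv_cancel₀ hp.ne', one_smul]
  rw [h2, abs_mul, abs_of_nonneg (by positivity), mul_comm]
  gcongr
  refine le_trans ?_ (le_max_left _ _)
  apply hC
  simp [norm_smul, inv_mul_cancel₀ hp.ne']

lemma HF.contDiffAt {r : ℕ} {a : EE n → ℝ} (ha : HF r a) {ξ : EE n} (hξ : ξ ≠ 0) :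
    ContDiffAt ℝ ∞ a ξ := ha.smooth.contDiffAt (isOpen_c.mem_nhds hξ)

lemma contDiffOn_pd {F : Type*} [NormedAddCommGroup F] [NormedSpace ℝ F]
    {a : EE n → F} (ha : ContDiffOn ℝ ∞ a {0}ᶜ) (i : Fin n) : ContDiffOn ℝ ∞ (pd i a) {0}ᶜ := by
  have h := ha.fderiv_of_isOpen isOpen_c (m := ∞) (by simp)
  exact h.clm_apply contDiffOn_const

lemma HF.pd {r : ℕ} {a : EE n → ℝ} (ha : HF r a) (i : Fin n) : HF (r + 1) (pd i a) where
  smooth := contDiffOn_pd ha.smooth i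
  hom := fun lam hl ξ hξ => by
    unfold TPsi.pd
    rw [fderiv_hom ha.smooth hl (fun ξ hξ => ha.hom lam hl ξ hξ) hξ]
    simp [pow_succ]

lemma HF.mul {r s : ℕ} {a b : EE n → ℝ} (ha : HF r a) (hb : HF s b) :
    HF (r + s) (fun ξ => a ξ * b ξ) where
  smooth := ha.smooth.mul hb.smooth
  hom := fun lam hl ξ hξ => by
    rw [ha.hom lam hl ξ hξ, hb.hom lam hl ξ hξ, pow_add, mul_inv]; ring

/-- homogeneous diffeomorphisms -/
structure HD (φ φi : EE n → EE n) : Prop where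
  smooth : ContDiffOn ℝ ∞ φ {0}ᶜ
  smooth' : ContDiffOn ℝ ∞ φi {0}ᶜ
  ne : ∀ ξ, ξ ≠ 0 → φ ξ ≠ 0
  ne' : ∀ ξ, ξ ≠ 0 → φi ξ ≠ 0
  left : ∀ ξ, ξ ≠ 0 → φi (φ ξ) = ξ
  right : ∀ ξ, ξ ≠ 0 → φ (φi ξ) = ξ
  hom : ∀ lam : ℝ, 0 < lam → ∀ ξ, ξ ≠ 0 → φ (lam • ξ) = lam • φ ξ
  hom' : ∀ lam : ℝ, 0 < lam → ∀ ξ, ξ ≠ 0 → φi (lam • ξ) = lam • φi ξ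
  z : φ 0 = 0
  z' : φi 0 = 0

lemma HD.symm {φ φi : EE n → EE n} (h : HD φ φi) : HD φi φ :=
  ⟨h.smooth', h.smooth, h.ne', h.ne, h.right, h.left, h.hom', h.hom, h.z', h.z⟩

lemma HD.contDiffAt {φ φi : EE n → EE n} (h : HD φ φi) {ξ : EE n} (hξ : ξ ≠ 0) :
    ContDiffAt ℝ ∞ φ ξ := h.smooth.contDiffAt (isOpen_c.mem_nhds hξ)

lemma HD.bound {φ φi : EE n → EE n} (h : HD φ φi) :
    ∃ C : ℝ, 0 < C ∧ ∀ ξ, ‖φ ξ‖ ≤ C * ‖ξ‖ := by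
  have hc : ContinuousOn φ (Metric.sphere (0 : EE n) 1) :=
    h.smooth.continuousOn.mono fun x hx => by
      intro h; simp at h; simp [h] at hx
  obtain ⟨C, hC⟩ := (isCompact_sphere (0 : EE n) 1).exists_bound_of_continuousOn hc
  refine ⟨max C 1, by positivity, fun ξ => ?_⟩
  by_cases hξ : ξ = 0
  · simp [hξ, h.z]
  have hp : 0 < ‖ξ‖ := norm_pos_iff.2 hξ
  have h1 : (‖ξ‖⁻¹ • ξ) ≠ 0 := smul_ne_zero (by positivity) hξ
  have h2 : φ ξ = ‖ξ‖ • φ (‖ξ‖⁻¹ • ξ) := by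
    rw [← h.hom ‖ξ‖ hp _ h1, smul_smul, mul_inv_cancel₀ hp.ne', one_smul]
  rw [h2, norm_smul, norm_norm, mul_comm]
  gcongr
  refine le_trans ?_ (le_max_left _ _)
  apply hC
  simp [norm_smul, inv_mul_cancel₀ hp.ne']

lemma HD.bound_below {φ φi : EE n → EE n} (h : HD φ φi) :
    ∃ C : ℝ, 0 < C ∧ ∀ ξ, ‖ξ‖ ≤ C * ‖φ ξ‖ := by
  obtain ⟨C, h0, hC⟩ := h.symm.bound
  refine ⟨C, h0, fun ξ => ?_⟩
  by_cases hξ : ξ = 0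
  · simp [hξ, h.z]
  · simpa [h.left ξ hξ] using hC (φ ξ)

lemma HD.continuous {φ φi : EE n → EE n} (h : HD φ φi) : Continuous φ := by
  rw [continuous_iff_continuousAt]
  intro ξ
  by_cases hξ : ξ = 0
  · subst hξ
    obtain ⟨C, h0, hC⟩ := h.bound
    have : Tendsto (fun ξ : EE n => C * ‖ξ‖) (𝓝 0) (𝓝 0) := by
      have : Continuous (fun ξ : EE n => C * ‖ξ‖) := by fun_prop
      simpa using this.tendsto 0
    unfold ContinuousAt
    rw [h.z]
    exact squeeze_zero_norm hC this
  · exact (h.contDiffAt hξ).continuousAt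

lemma HD.tendsto0 {φ φi : EE n → EE n} (h : HD φ φi) : Tendsto φ (𝓝 0) (𝓝 0) := by
  simpa [h.z] using h.continuous.tendsto 0

/-- the components of the Jacobian are homogeneous of degree zero -/
lemma HD.hf {φ φi : EE n → EE n} (h : HD φ φi) (i j : Fin n) : HF 0 (fun ξ => pd i φ ξ j) where
  smooth := by
    have := contDiffOn_pd h.smooth i
    exact (contDiffOn_euclidean.1 this) j
  hom := fun lam hl ξ hξ => by
    unfold pd
    rw [fderiv_hom h.smooth hl (fun ξ hξ => h.hom lam hl ξ hξ) hξ]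
    simp [inv_mul_cancel₀ hl.ne']

lemma TF.comp {r : ℕ} {a : EE n → ℝ} (ha : HF r a) {φ φi : EE n → EE n} (h : HD φ φi)
    {f : EE n → ℂ} (hf : TF f) : TF (fun ξ => (a ξ : ℂ) * f (φ ξ)) := by
  have hz : (fun ξ => (a ξ : ℂ) * f (φ ξ)) =ᶠ[𝓝 0] 0 := by
    filter_upwards [h.tendsto0.eventually hf.zero] with ξ hξ
    simp [hξ]
  refine ⟨?_, ?_, hz⟩
  · rw [contDiff_iff_contDiffAt]
    intro ξ
    by_cases hξ : ξ = 0
    · subst hξ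
      exact contDiffAt_const.congr_of_eventuallyEq hz
    · exact (Complex.ofRealCLM.contDiff.contDiffAt.comp ξ (ha.contDiffAt hξ)).mul
        (hf.smooth.contDiffAt.comp ξ (h.contDiffAt hξ))
  · obtain ⟨R, hR⟩ := hf.cpt.isCompact.isBounded.subset_closedBall 0
    obtain ⟨C, h0, hC⟩ := h.bound_below
    refine HasCompactSupport.of_support_subset_isCompact
      (isCompact_closedBall (0 : EE n) (C * R)) fun ξ hξ => ?_
    have h1 : f (φ ξ) ≠ 0 := right_ne_zero_of_mul hξ
    have h2 := hR (subset_tsupport f h1)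
    simp at h2 ⊢
    exact (hC ξ).trans (by gcongr)

lemma apply_sum (L : EE n →L[ℝ] ℂ) (v : EE n) : L v = ∑ j, (v j : ℂ) * L (bv j) := by
  conv_lhs => rw [← (EuclideanSpace.basisFun (Fin n) ℝ).sum_repr v]
  simp [map_sum, bv]

/-- the chain rule -/
lemma pd_comp {r : ℕ} {a : EE n → ℝ} (ha : HF r a) {φ φi : EE n → EE n} (h : HD φ φi)
    {f : EE n → ℂ} (hf : TF f) (i : Fin n) :
    pd i (fun ξ => (a ξ : ℂ) * f (φ ξ)) = fun ξ => ((pd i a ξ : ℝ) : ℂ) * f (φ ξ) +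
      ∑ j, ((a ξ * pd i φ ξ j : ℝ) : ℂ) * pd j f (φ ξ) := by
  funext ξ
  by_cases hξ : ξ = 0
  · subst hξ
    have h1 := ((hf.comp ha h).pd i).zero.self_of_nhds
    have h2 := hf.zero.self_of_nhds
    have h3 : ∀ j, pd j f 0 = 0 := fun j => ((hf.pd j).zero.self_of_nhds)
    rw [h1]
    simp [h.z, h2, h3]
  · have h1 : HasFDerivAt (fun ξ => (a ξ : ℂ)) (Complex.ofRealCLM.comp (fderiv ℝ a ξ)) ξ :=
      Complex.ofRealCLM.hasFDerivAt.comp ξ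
        ((ha.contDiffAt hξ).differentiableAt (by simp)).hasFDerivAt
    have h2 : HasFDerivAt (fun ξ => f (φ ξ)) ((fderiv ℝ f (φ ξ)).comp (fderiv ℝ φ ξ)) ξ :=
      (hf.smooth.differentiable (by simp) (φ ξ)).hasFDerivAt.comp ξ
        ((h.contDiffAt hξ).differentiableAt (by simp)).hasFDerivAt
    have h3 := h1.fun_mul h2
    unfold pd
    rw [h3.fderiv]
    simp only [add_apply, smul_apply,
      ContinuousLinearMap.comp_apply, Complex.ofRealCLM_apply, smul_eq_mul]
    rw [apply_sum (fderiv ℝ f (φ ξ)) ((fderiv ℝ φ ξ) (bv i)), Finset.mul_sum]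
    rw [add_comm, mul_comm (f (φ ξ))]
    congr 1
    refine Finset.sum_congr rfl fun j _ => ?_
    push_cast
    ring

lemma e2 {F : Type*} [NormedAddCommGroup F] (f : EE n → F) :
    eLpNorm f 2 volume ^ 2 = ∫⁻ x, ‖f x‖ₑ ^ 2 := by
  rw [eLpNorm_eq_lintegral_rpow_enorm_toReal (by norm_num) (by norm_num)]
  simp only [ENNReal.toReal_ofNat, ENNReal.rpow_ofNat]
  rw [← ENNReal.rpow_natCast, ← ENNReal.rpow_mul]
  norm_num

lemma le_of_sq_le {a b : ℝ≥0∞} (h : a ^ 2 ≤ b ^ 2) : a ≤ b :=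
  (ENNReal.pow_le_pow_left_iff (by norm_num)).1 h

lemma e2_int {F : Type*} [NormedAddCommGroup F] (f : EE n → F)
    (hf : Integrable (fun x => ‖f x‖ ^ 2)) :
    eLpNorm f 2 volume ^ 2 = ENNReal.ofReal (∫ x, ‖f x‖ ^ 2) := by
  rw [e2, ofReal_integral_eq_lintegral_ofReal hf (Eventually.of_forall fun x => by positivity)]
  congr 1; funext x
  rw [ENNReal.ofReal_pow (norm_nonneg _), ofReal_norm]

lemma HF.euler {r : ℕ} {a : EE n → ℝ} (ha : HF r a) {ξ : EE n} (hξ : ξ ≠ 0) :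
    fderiv ℝ a ξ ξ = - r * a ξ := by
  have h1 : HasDerivAt (fun t : ℝ => a (t • ξ)) (fderiv ℝ a ξ ξ) 1 := by
    have h2 : HasDerivAt (fun t : ℝ => t • ξ) ξ 1 := by
      simpa using (hasDerivAt_id (1 : ℝ)).smul_const ξ
    have h3 : HasFDerivAt a (fderiv ℝ a ξ) ((1 : ℝ) • ξ) := by
      rw [one_smul]; exact ((ha.contDiffAt hξ).differentiableAt (by simp)).hasFDerivAt
    exact h3.comp_hasDerivAt 1 h2
  have h4 : HasDerivAt (fun t : ℝ => (t ^ r)⁻¹ * a ξ) (- r * a ξ) 1 := by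
    have := ((hasDerivAt_pow r (1 : ℝ)).inv (by simp)).mul_const (a ξ)
    simpa using this
  refine h1.unique (h4.congr_of_eventuallyEq ?_)
  filter_upwards [lt_mem_nhds (zero_lt_one (α := ℝ))] with t ht using ha.hom t ht ξ hξ

lemma hf_norm (r : ℕ) : HF r (fun ξ : EE n => (‖ξ‖ ^ r)⁻¹) where
  smooth := by
    intro ξ hξ
    have hξ' : ξ ≠ 0 := hξ
    have h1 : ContDiffAt ℝ ∞ (fun ξ : EE n => ‖ξ‖) ξ := contDiffAt_norm ℝ hξ'
    exact ((h1.pow r).inv (by have := norm_pos_iff.2 hξ'; positivity)).contDiffWithinAt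
  hom := fun lam hl ξ hξ => by
    rw [norm_smul, mul_pow, mul_inv, Real.norm_of_nonneg hl.le]

lemma hd_id : HD (fun ξ : EE n => ξ) (fun ξ => ξ) := by
  constructor <;> first | exact contDiffOn_id | simp

lemma euler_int {p : EE n → ℝ} (hp : ContDiff ℝ ∞ p) (hc : HasCompactSupport p) :
    ∫ ξ, fderiv ℝ p ξ ξ = - n * ∫ ξ, p ξ := by
  have hpd : ∀ i, Continuous (pd i p) := fun i => (contDiff_pd hp i).continuous
  have hpc : ∀ i, HasCompactSupport (pd i p) := fun i => hc.fderiv_apply ℝ _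
  have key : ∀ i : Fin n, ∫ ξ : EE n, ξ i * pd i p ξ = - ∫ ξ, p ξ := by
    intro i
    have hl : ∀ ξ : EE n, HasFDerivAt (fun ξ : EE n => ξ i)
        (EuclideanSpace.proj (𝕜 := ℝ) i : EE n →L[ℝ] ℝ) ξ := fun ξ =>
      (EuclideanSpace.proj (𝕜 := ℝ) i : EE n →L[ℝ] ℝ).hasFDerivAt
    have hci : Continuous (fun ξ : EE n => ξ i) := by fun_prop
    have e : ∀ ξ, fderiv ℝ (fun ξ : EE n => ξ i) ξ (bv i) = 1 := fun ξ => by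
      rw [(hl ξ).fderiv]; simp [bv]
    have := integral_mul_fderiv_eq_neg_fderiv_mul_of_integrable (μ := (volume : Measure (EE n)))
      (f := fun ξ : EE n => ξ i) (g := p) (v := bv i) ?_ ?_ ?_ ?_ ?_
    · simpa [e, pd] using this
    · simp only [e, one_mul]
      exact hp.continuous.integrable_of_hasCompactSupport hc
    · exact (hci.mul (hpd i)).integrable_of_hasCompactSupport (hpc i).mul_left
    · exact (hci.mul hp.continuous).integrable_of_hasCompactSupport hc.mul_left
    · exact fun x _ => (hl x).differentiableAt
    · exact fun x _ => hp.differentiable (by simp) x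
  have h1 : ∀ ξ : EE n, fderiv ℝ p ξ ξ = ∑ i, ξ i * pd i p ξ := by
    intro ξ
    have hx : ∀ L : EE n →L[ℝ] ℝ, L ξ = ∑ i, ξ i * L (bv i) := by
      intro L
      conv_lhs => rw [← (EuclideanSpace.basisFun (Fin n) ℝ).sum_repr ξ]
      simp [map_sum, bv]
    exact hx _
  simp_rw [h1]
  rw [integral_finsetSum]
  · simp [key]
  · intro i _
    have hci : Continuous (fun ξ : EE n => ξ i) := by fun_prop
    exact (hci.mul (hpd i)).integrable_of_hasCompactSupport (hpc i).mul_left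

lemma hcs_sq {F : Type*} [NormedAddCommGroup F] {H : EE n → F} (h : HasCompactSupport H) :
    HasCompactSupport (fun ξ => ‖H ξ‖ ^ 2) := by
  refine HasCompactSupport.intro (K := tsupport H) h fun ξ hξ => ?_
  simp [image_eq_zero_of_notMem_tsupport hξ]

lemma int_sq {F : Type*} [NormedAddCommGroup F] {H : EE n → F} (hc : Continuous H)
    (h : HasCompactSupport H) : Integrable (fun ξ => ‖H ξ‖ ^ 2) :=
  (hc.norm.pow 2).integrable_of_hasCompactSupport (hcs_sq h)

set_option maxHeartbeats 1000000 in
lemma hardy_step (s : ℕ) (hs : 2 * (s + 1) < n) {f : EE n → ℂ} (hf : TF f) :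
    eLpNorm (fun ξ => (((‖ξ‖ ^ (s + 1))⁻¹ : ℝ) : ℂ) * f ξ) 2 volume ≤
      2 * ∑ i, eLpNorm (fun ξ => (((‖ξ‖ ^ s)⁻¹ : ℝ) : ℂ) * pd i f ξ) 2 volume := by
  set w : EE n → ℝ := fun ξ => (‖ξ‖ ^ (s + 1))⁻¹ with hw
  set g : EE n → ℂ := fun ξ => (w ξ : ℂ) * f ξ with hg
  have hwF : HF (s + 1) w := hf_norm (s + 1)
  have hgT : TF g := hf.comp hwF hd_id
  set G : Fin n → EE n → ℂ := fun i ξ => (((‖ξ‖ ^ s)⁻¹ : ℝ) : ℂ) * pd i f ξ with hG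
  have hGT : ∀ i, TF (G i) := fun i => (hf.pd i).comp (hf_norm s) hd_id
  set H : EE n → ℝ := fun ξ => ∑ i, ‖G i ξ‖ with hH
  have hHc : Continuous H := continuous_finsetSum _ fun i _ => (hGT i).smooth.continuous.norm
  have hHs : HasCompactSupport H := by
    refine HasCompactSupport.intro (K := tsupport f) hf.cpt fun ξ hξ => ?_
    have : ∀ i, pd i f ξ = 0 := fun i => by
      have h0 : fderiv ℝ f ξ = 0 := by
        by_contra hne
        exact hξ (support_fderiv_subset ℝ hne)
      simp [pd, h0]
    simp [hH, hG, this]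
  set p : EE n → ℝ := fun ξ => ‖g ξ‖ ^ 2 with hp
  have hpS : ContDiff ℝ ∞ p := hgT.smooth.norm_sq ℝ
  have hpC : HasCompactSupport p := hcs_sq hgT.cpt
  have hpI : Integrable p := hpS.continuous.integrable_of_hasCompactSupport hpC
  have hHI : Integrable (fun ξ => H ξ ^ 2) := by
    simpa using int_sq hHc hHs
  -- pointwise inequality
  have key : ∀ ξ, fderiv ℝ p ξ ξ ≥ -2 * (s + 1) * p ξ - (1 / 2 * p ξ + 2 * H ξ ^ 2) := by
    intro ξ
    by_cases hξ : ξ = 0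
    · subst hξ
      have : g 0 = 0 := hgT.zero.self_of_nhds
      simp only [map_zero, hp, this]
      norm_num
      positivity
    have hdg : HasFDerivAt g (fderiv ℝ g ξ) ξ :=
      (hgT.smooth.differentiable (by simp) ξ).hasFDerivAt
    have h1 : fderiv ℝ p ξ ξ = 2 * ⟪g ξ, fderiv ℝ g ξ ξ⟫ := by
      rw [hdg.norm_sq.fderiv]
      simp
      try ring
    have h2 : fderiv ℝ g ξ ξ = ((-(s + 1) : ℝ) : ℂ) * g ξ + (w ξ : ℂ) * fderiv ℝ f ξ ξ := by
      have a1 : HasFDerivAt (fun ξ => (w ξ : ℂ)) (Complex.ofRealCLM.comp (fderiv ℝ w ξ)) ξ :=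
        Complex.ofRealCLM.hasFDerivAt.comp ξ
          ((hwF.contDiffAt hξ).differentiableAt (by simp)).hasFDerivAt
      have a2 := a1.fun_mul (hf.smooth.differentiable (by simp) ξ).hasFDerivAt
      rw [hg, a2.fderiv]
      simp only [add_apply, smul_apply,
        ContinuousLinearMap.comp_apply, Complex.ofRealCLM_apply, smul_eq_mul, hwF.euler hξ]
      push_cast
      ring
    have h3 : ‖(w ξ : ℂ) * fderiv ℝ f ξ ξ‖ ≤ H ξ := by
      rw [apply_sum, Finset.mul_sum]
      refine (norm_sum_le _ _).trans ?_
      simp only [hH]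
      gcongr with i
      simp only [hG, norm_mul, Complex.norm_real]
      rw [← mul_assoc]
      change _ ≤ _ * ‖fderiv ℝ f ξ (bv i)‖
      gcongr
      have hp : 0 < ‖ξ‖ := norm_pos_iff.2 hξ
      have : ‖ξ i‖ ≤ ‖ξ‖ := PiLp.norm_apply_le ξ i
      calc ‖w ξ‖ * ‖ξ i‖ ≤ ‖w ξ‖ * ‖ξ‖ := by gcongr
        _ = _ := by
          simp only [hw, norm_inv, norm_pow, norm_norm]
          field_simp
          ring
    have h4 : ⟪g ξ, fderiv ℝ g ξ ξ⟫ = -(s + 1) * ‖g ξ‖ ^ 2 + ⟪g ξ, (w ξ : ℂ) * fderiv ℝ f ξ ξ⟫ := by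
      rw [h2, inner_add_right]
      congr 1
      rw [← Complex.real_smul, inner_smul_right, real_inner_self_eq_norm_sq]
    have h5 := abs_real_inner_le_norm (g ξ) ((w ξ : ℂ) * fderiv ℝ f ξ ξ)
    have h6 : ‖g ξ‖ * ‖(w ξ : ℂ) * fderiv ℝ f ξ ξ‖ ≤ ‖g ξ‖ * H ξ := by gcongr
    have h7 := (abs_le.1 h5).1
    rw [h1, h4]
    simp only [hp]
    nlinarith [sq_nonneg (‖g ξ‖ - 2 * H ξ)]
  have hfd : Integrable (fun ξ => fderiv ℝ p ξ ξ) := by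
    have h1 : Continuous (fun ξ => fderiv ℝ p ξ ξ) :=
      (hpS.continuous_fderiv (by simp)).clm_apply continuous_id
    refine h1.integrable_of_hasCompactSupport ((hpC.fderiv ℝ).mono' ?_)
    intro ξ hξ
    apply subset_tsupport
    intro h0
    apply hξ
    simp [h0]
  have h8 := euler_int hpS hpC
  have h9 : ∫ ξ, (-2 * (s + 1) * p ξ - (1 / 2 * p ξ + 2 * H ξ ^ 2)) ≤ ∫ ξ, fderiv ℝ p ξ ξ :=
    integral_mono ((hpI.const_mul _).sub ((hpI.const_mul _).add (hHI.const_mul _))) hfd key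
  have hI2 : Integrable (fun ξ => 1 / 2 * p ξ + 2 * H ξ ^ 2) :=
    (hpI.const_mul _).add (hHI.const_mul _)
  rw [integral_sub (hpI.const_mul _) hI2, integral_add (hpI.const_mul _) (hHI.const_mul _), integral_const_mul, integral_const_mul,
    integral_const_mul, h8] at h9
  have hp0 : 0 ≤ ∫ ξ, p ξ := integral_nonneg fun ξ => by positivity
  have hn : (2 * (s + 1) + 1 : ℝ) ≤ n := by exact_mod_cast hs
  have h10 : ∫ ξ, p ξ ≤ 4 * ∫ ξ, H ξ ^ 2 := by nlinarith
  have h11 : eLpNorm g 2 volume ≤ 2 * eLpNorm H 2 volume := by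
    apply le_of_sq_le
    rw [mul_pow, e2_int g hpI, e2_int H (by simpa using hHI)]
    have : (2 : ℝ≥0∞) ^ 2 = ENNReal.ofReal 4 := by norm_num
    rw [this, ← ENNReal.ofReal_mul (by norm_num)]
    apply ENNReal.ofReal_le_ofReal
    simpa using h10
  refine h11.trans ?_
  gcongr
  have : H = ∑ i, fun ξ => ‖G i ξ‖ := by funext ξ; simp [hH]
  rw [this]
  refine (eLpNorm_sum_le (fun i _ => (hGT i).smooth.continuous.norm.aestronglyMeasurable)
    (by norm_num)).trans ?_
  gcongr with i
  rw [eLpNorm_norm]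

lemma hardy (r : ℕ) (hr : 2 * r < n) : ∃ C : NNReal, ∀ f : EE n → ℂ, TF f →
    eLpNorm (fun ξ => (((‖ξ‖ ^ r)⁻¹ : ℝ) : ℂ) * f ξ) 2 volume ≤ C * NN r f := by
  induction r with
  | zero => exact ⟨1, fun f _ => by simp [NN]⟩
  | succ s ih =>
    obtain ⟨C, hC⟩ := ih (by omega)
    refine ⟨2 * C, fun f hf => (hardy_step s hr hf).trans ?_⟩
    simp only [NN]
    have e : ((2 * C : NNReal) : ℝ≥0∞) * ∑ i, NN s (pd i f) = 2 * ∑ i, C * NN s (pd i f) := by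
      push_cast
      rw [mul_assoc, ← Finset.mul_sum]
    rw [e]
    have : ∑ i, eLpNorm (fun ξ => (((‖ξ‖ ^ s)⁻¹ : ℝ) : ℂ) * pd i f ξ) 2 volume ≤
      ∑ i, C * NN s (pd i f) := Finset.sum_le_sum fun i _ => ?_
    · exact mul_le_mul' le_rfl this
    exact hC _ (hf.pd i)

lemma HD.fderiv_comp {φ φi : EE n → EE n} (h : HD φ φi) {ξ : EE n} (hξ : ξ ≠ 0) :
    (fderiv ℝ φi (φ ξ)).comp (fderiv ℝ φ ξ) = ContinuousLinearMap.id ℝ (EE n) := by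
  have h1 : HasFDerivAt (fun ξ => φi (φ ξ)) ((fderiv ℝ φi (φ ξ)).comp (fderiv ℝ φ ξ)) ξ :=
    ((h.symm.contDiffAt (h.ne ξ hξ)).differentiableAt (by simp)).hasFDerivAt.comp ξ
      ((h.contDiffAt hξ).differentiableAt (by simp)).hasFDerivAt
  refine h1.unique ((hasFDerivAt_id ξ).congr_of_eventuallyEq ?_)
  filter_upwards [isOpen_c.mem_nhds hξ] with η hη using h.left η hη

lemma HD.det_ne {φ φi : EE n → EE n} (h : HD φ φi) {ξ : EE n} (hξ : ξ ≠ 0) :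
    (fderiv ℝ φ ξ).det ≠ 0 := by
  have h1 := congrArg (fun L : EE n →L[ℝ] EE n => L.det) (h.fderiv_comp hξ)
  have h2 : (fderiv ℝ φi (φ ξ)).det * (fderiv ℝ φ ξ).det = 1 := by
    have h3 : ((fderiv ℝ φi (φ ξ)).comp (fderiv ℝ φ ξ)).det =
      (fderiv ℝ φi (φ ξ)).det * (fderiv ℝ φ ξ).det := LinearMap.det_comp _ _
    have h4 : (ContinuousLinearMap.id ℝ (EE n)).det = 1 := LinearMap.det_id
    rw [← h3, ← h4]; exact h1
  exact right_ne_zero_of_mul (h2 ▸ one_ne_zero)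

lemma det_eq (L : EE n →L[ℝ] EE n) :
    L.det = Matrix.det (Matrix.of fun i j => L (bv j) i) := by
  have : L.det = LinearMap.det (L : EE n →ₗ[ℝ] EE n) := rfl
  rw [this, ← LinearMap.det_toMatrix (EuclideanSpace.basisFun (Fin n) ℝ).toBasis]
  congr 1

/-- the absolute Jacobian determinant is homogeneous of degree zero -/
lemma HD.hf_det {φ φi : EE n → EE n} (h : HD φ φi) : HF 0 (fun ξ => |(fderiv ℝ φ ξ).det|) where
  smooth := by
    have h1 : ContDiffOn ℝ ∞ (fun ξ => (fderiv ℝ φ ξ).det) {0}ᶜ := by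
      simp_rw [det_eq, Matrix.det_apply]
      refine ContDiffOn.sum fun σ _ => ContDiffOn.const_smul _ (contDiffOn_prod fun i _ => ?_)
      exact (h.hf i (σ i)).smooth
    intro ξ hξ
    exact (contDiffAt_abs (h.det_ne hξ)).comp_contDiffWithinAt ξ (h1 ξ hξ)
  hom := fun lam hl ξ hξ => by
    rw [fderiv_hom h.smooth hl (fun ξ hξ => h.hom lam hl ξ hξ) hξ]
    simp [inv_mul_cancel₀ hl.ne']

lemma restrict_c (hn : 0 < n) : (volume : Measure (EE n)).restrict {0}ᶜ = volume := by
  have : Nonempty (Fin n) := ⟨⟨0, hn⟩⟩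
  refine Measure.restrict_eq_self_of_ae_mem ?_
  exact (measure_eq_zero_iff_ae_notMem.1 (measure_singleton (0 : EE n)))

lemma HD.image {φ φi : EE n → EE n} (h : HD φ φi) : φ '' {0}ᶜ = {0}ᶜ := by
  ext ξ
  constructor
  · rintro ⟨η, hη, rfl⟩; exact h.ne η hη
  · intro hξ; exact ⟨φi ξ, h.ne' ξ hξ, h.right ξ hξ⟩

lemma HD.injOn {φ φi : EE n → EE n} (h : HD φ φi) : InjOn φ {0}ᶜ := by
  intro x hx y hy hxy
  rw [← h.left x hx, hxy, h.left y hy]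

lemma HD.cov {φ φi : EE n → EE n} (h : HD φ φi) (hn : 0 < n) (F : EE n → ℝ≥0∞) :
    ∫⁻ ξ, F (φ ξ) = ∫⁻ ξ, ENNReal.ofReal |(fderiv ℝ φi ξ).det| * F ξ := by
  have := lintegral_image_eq_lintegral_abs_det_fderiv_mul (volume : Measure (EE n))
    (measurableSet_singleton (0 : EE n)).compl (f := φi) (f' := fderiv ℝ φi)
    (fun x hx => ((h.symm.contDiffAt hx).differentiableAt (by simp)).hasFDerivAt.hasFDerivWithinAt)
    h.symm.injOn (fun ξ => F (φ ξ))
  rw [h.symm.image, restrict_c hn] at this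
  rw [this]
  refine lintegral_congr_ae ?_
  rw [← restrict_c hn]
  filter_upwards [ae_restrict_mem (measurableSet_singleton (0 : EE n)).compl] with ξ hξ
  rw [h.right ξ hξ]

lemma HD.eLpNorm_comp {φ φi : EE n → EE n} (h : HD φ φi) (hn : 0 < n) :
    ∃ C : NNReal, ∀ F : EE n → ℂ,
      eLpNorm (fun ξ => F (φ ξ)) 2 volume ≤ C * eLpNorm F 2 volume := by
  obtain ⟨C, h0, hC⟩ := h.symm.hf_det.bound
  refine ⟨(Real.sqrt C).toNNReal, fun F => le_of_sq_le ?_⟩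
  rw [mul_pow, e2, e2, h.cov hn (fun ξ => ‖F ξ‖ₑ ^ 2)]
  have : ((Real.sqrt C).toNNReal : ℝ≥0∞) ^ 2 = ENNReal.ofReal C := by
    change ENNReal.ofReal _ ^ 2 = _
    rw [← ENNReal.ofReal_pow (Real.sqrt_nonneg _), Real.sq_sqrt h0]
  rw [this, ← lintegral_const_mul' _ _ ENNReal.ofReal_ne_top]
  refine lintegral_mono_ae ?_
  rw [← restrict_c hn]
  filter_upwards [ae_restrict_mem (measurableSet_singleton (0 : EE n)).compl] with ξ hξ
  gcongr
  simpa using hC ξ hξ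

/-- the main estimate on test functions -/
lemma main_NN {φ φi : EE n → EE n} (h : HD φ φi) (k r : ℕ) (hkr : 2 * (k + r) < n)
    {a : EE n → ℝ} (ha : HF r a) :
    ∃ C : NNReal, ∀ f : EE n → ℂ, TF f →
      NN k (fun ξ => (a ξ : ℂ) * f (φ ξ)) ≤ C * NN (k + r) f := by
  induction k generalizing r a with
  | zero =>
    obtain ⟨C1, hC1⟩ := hardy (n := n) r (by omega)
    obtain ⟨C2, hC2⟩ := h.eLpNorm_comp (by omega)
    obtain ⟨C3, hC30, hC3⟩ := ha.bound
    obtain ⟨C4, hC40, hC4⟩ := h.bound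
    refine ⟨(C3 * C4 ^ r).toNNReal * (C2 * C1), fun f hf => ?_⟩
    simp only [NN, zero_add]
    set g : EE n → ℂ := fun ξ => (((‖ξ‖ ^ r)⁻¹ : ℝ) : ℂ) * f ξ with hg
    have h1 : eLpNorm (fun ξ => (a ξ : ℂ) * f (φ ξ)) 2 volume ≤
        ENNReal.ofReal (C3 * C4 ^ r) * eLpNorm (fun ξ => g (φ ξ)) 2 volume := by
      refine eLpNorm_le_mul_eLpNorm_of_ae_le_mul (Eventually.of_forall fun ξ => ?_) 2
      by_cases hξ : ξ = 0
      · subst hξ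
        have : f 0 = 0 := hf.zero.self_of_nhds
        simp [h.z, this]
        positivity
      · simp only [hg, norm_mul, Complex.norm_real, Real.norm_eq_abs]
        rw [← mul_assoc]
        gcongr
        have hp : 0 < ‖ξ‖ := norm_pos_iff.2 hξ
        have hp' : 0 < ‖φ ξ‖ := norm_pos_iff.2 (h.ne ξ hξ)
        rw [abs_of_nonneg (a := (‖φ ξ‖ ^ r)⁻¹) (by positivity)]
        refine (hC3 ξ hξ).trans ?_
        rw [mul_assoc]
        gcongr
        rw [inv_le_iff_one_le_mul₀ (by positivity), mul_comm, ← mul_assoc, ← mul_pow, mul_comm ‖ξ‖,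
          ← div_eq_mul_inv, one_le_div (by positivity)]
        exact pow_le_pow_left₀ hp'.le (hC4 ξ) r
    calc _ ≤ _ := h1
      _ ≤ ENNReal.ofReal (C3 * C4 ^ r) * (C2 * (C1 * NN r f)) := by
        gcongr
        exact (hC2 g).trans (by gcongr; exact hC1 f hf)
      _ = _ := by
        push_cast
        rw [ENNReal.ofReal]; ring
  | succ k ih =>
    have hA : ∀ i : Fin n, ∃ C : NNReal, ∀ f : EE n → ℂ, TF f →
        NN k (fun ξ => ((pd i a ξ : ℝ) : ℂ) * f (φ ξ)) ≤ C * NN (k + (r + 1)) f := fun i =>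
      ih (r + 1) (by omega) (ha.pd i)
    have hB : ∀ i j : Fin n, ∃ C : NNReal, ∀ f : EE n → ℂ, TF f →
        NN k (fun ξ => ((a ξ * pd i φ ξ j : ℝ) : ℂ) * f (φ ξ)) ≤ C * NN (k + r) f := fun i j =>
      ih (r + 0) (by omega) (ha.mul (h.hf i j))
    choose CA hCA using hA
    choose CB hCB using hB
    refine ⟨∑ i, (CA i + ∑ j, CB i j), fun f hf => ?_⟩
    have e : k + 1 + r = k + r + 1 := by omega
    rw [e]
    conv_lhs => unfold NN
    push_cast
    rw [Finset.sum_mul]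
    gcongr with i
    rw [pd_comp ha h hf i]
    refine (NN_add k (hf.comp (ha.pd i) h).smooth (ContDiff.sum fun j _ =>
      ((hf.pd j).comp (ha.mul (h.hf i j)) h).smooth)).trans ?_
    rw [add_mul]
    gcongr
    · exact hCA i f hf
    · refine (NN_sum k _ _ fun j _ => ((hf.pd j).comp (ha.mul (h.hf i j)) h).smooth).trans ?_
      rw [Finset.sum_mul]
      gcongr with j
      refine (hCB i j _ (hf.pd j)).trans ?_
      gcongr
      simp only [NN]
      exact Finset.single_le_sum (f := fun i => NN (k + r) (pd i f)) (fun _ _ => zero_le) (Finset.mem_univ j)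

open scoped FourierTransform LineDeriv

/-- Fourier transform on Schwartz functions -/
abbrev FS (u : 𝓢(EE n, ℂ)) : 𝓢(EE n, ℂ) := 𝓕 u

/-- inverse Fourier transform on Schwartz functions -/
abbrev FSi (u : 𝓢(EE n, ℂ)) : 𝓢(EE n, ℂ) := 𝓕⁻ u

/-- being a Schwartz function -/
def IsS (f : EE n → ℂ) : Prop := ∃ g : 𝓢(EE n, ℂ), ⇑g = f

lemma IsS.pd {f : EE n → ℂ} (hf : IsS f) (i : Fin n) : IsS (pd i f) := by
  obtain ⟨g, rfl⟩ := hf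
  exact ⟨∂_{bv i} g, rfl⟩

lemma IsS.smooth {f : EE n → ℂ} (hf : IsS f) : ContDiff ℝ ∞ f := by
  obtain ⟨g, rfl⟩ := hf
  exact g.smooth _

lemma IsS.memLp {f : EE n → ℂ} (hf : IsS f) : MemLp f 2 volume := by
  obtain ⟨g, rfl⟩ := hf
  exact g.memLp 2 volume

lemma exists_v (u : 𝓢(EE n, ℂ)) (i : Fin n) :
    ∃ v : 𝓢(EE n, ℂ), ⇑(FS v) = pd i ⇑(FS u) ∧ ∀ x, v x = -(2 * π * I) * (x i) * u x := by
  refine ⟨-(2 * π * I) • smulLeftCLM ℂ (inner ℝ · (bv i)) u, ?_, ?_⟩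
  · have h := SchwartzMap.lineDerivOp_fourier_eq u (bv i)
    unfold FS
    rw [← h]; rfl
  · intro x
    have h : (fun y : EE n => inner ℝ y (bv i)).HasTemperateGrowth :=
      ((innerSL ℝ).flip (bv i)).hasTemperateGrowth
    simp only [smul_apply]
    rw [smulLeftCLM_apply_apply h]
    simp [EuclideanSpace.inner_single_right]
    ring

lemma eLpNorm_fourier (u : 𝓢(EE n, ℂ)) :
    eLpNorm (⇑(FS u)) 2 volume = eLpNorm (⇑u) 2 volume := by
  have h := norm_fourier_toL2_eq u
  rw [SchwartzMap.norm_toLp, SchwartzMap.norm_toLp] at h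
  exact (ENNReal.toReal_eq_toReal_iff' ((FS u).memLp 2 volume).2.ne (u.memLp 2 volume).2.ne).1 h

lemma norm_le_sum (x : EE n) : ‖x‖ ≤ ∑ i, |x i| := by
  calc ‖x‖ = ‖∑ i, (x i) • bv i‖ := by
        congr 1
        ext j
        simp [Pi.single_apply]
    _ ≤ ∑ i, ‖(x i) • bv i‖ := norm_sum_le _ _
    _ = _ := by simp [norm_smul]

lemma cont_w (k : ℕ) (u : 𝓢(EE n, ℂ)) : Continuous fun x : EE n => ((‖x‖ ^ k : ℝ) : ℂ) * u x := by
  have := u.continuous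
  fun_prop

lemma lower (k : ℕ) (u : 𝓢(EE n, ℂ)) :
    eLpNorm (fun x => ((‖x‖ ^ k : ℝ) : ℂ) * u x) 2 volume ≤ NN k ⇑(FS u) := by
  induction k generalizing u with
  | zero => simp [NN, eLpNorm_fourier]
  | succ k ih =>
    choose v hv hv' using exists_v u
    calc _ ≤ eLpNorm (∑ i, fun x => ((‖((‖x‖ ^ k : ℝ) : ℂ) * v i x‖ : ℝ))) 2 volume := by
          refine eLpNorm_mono_real fun x => ?_
          rw [Finset.sum_apply]
          simp only [norm_mul, hv', norm_neg]
          simp only [norm_mul, Complex.norm_real, norm_pow, abs_norm, Complex.norm_I, pow_succ,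
            Complex.norm_ofNat, Real.norm_eq_abs, abs_of_pos Real.pi_pos, mul_one]
          calc ‖x‖ ^ k * ‖x‖ * ‖u x‖ ≤ ‖x‖ ^ k * (∑ i, |x i|) * ‖u x‖ := by
                gcongr; exact norm_le_sum x
            _ = ∑ i, ‖x‖ ^ k * (1 * |x i| * ‖u x‖) := by
                rw [Finset.mul_sum, Finset.sum_mul]; simp only [one_mul, mul_assoc]
            _ ≤ _ := by
                refine Finset.sum_le_sum fun i _ => ?_
                gcongr
                nlinarith [Real.two_le_pi]
      _ ≤ ∑ i, eLpNorm (fun x => ((‖((‖x‖ ^ k : ℝ) : ℂ) * v i x‖ : ℝ))) 2 volume := by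
          refine eLpNorm_sum_le (fun i _ => ?_) (by norm_num)
          exact (cont_w k (v i)).norm.aestronglyMeasurable
      _ ≤ _ := by
          simp only [NN]
          refine Finset.sum_le_sum fun i _ => ?_
          rw [eLpNorm_norm, ← hv]
          exact ih _

lemma upper (k : ℕ) : ∃ C : NNReal, ∀ u : 𝓢(EE n, ℂ),
    NN k ⇑(FS u) ≤ C * eLpNorm (fun x => ((‖x‖ ^ k : ℝ) : ℂ) * u x) 2 volume := by
  induction k with
  | zero => exact ⟨1, fun u => by simp [NN, eLpNorm_fourier]⟩
  | succ k ih =>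
    obtain ⟨C, hC⟩ := ih
    refine ⟨n * (C * (2 * π).toNNReal), fun u => ?_⟩
    choose v hv hv' using exists_v u
    simp only [NN]
    calc _ ≤ ∑ i : Fin n, (C * (2 * π).toNNReal : ℝ≥0∞) *
          eLpNorm (fun x => ((‖x‖ ^ (k+1) : ℝ) : ℂ) * u x) 2 volume := by
          refine Finset.sum_le_sum fun i _ => ?_
          rw [← hv, mul_assoc]
          refine (hC _).trans (mul_le_mul' le_rfl ?_)
          refine eLpNorm_le_mul_eLpNorm_of_ae_le_mul (Eventually.of_forall fun x => ?_) 2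
          simp only [norm_mul, hv', norm_neg]
          simp only [norm_mul, Complex.norm_real, norm_pow, abs_norm, Complex.norm_I, pow_succ,
            Complex.norm_ofNat, Real.norm_eq_abs, abs_of_pos Real.pi_pos, mul_one]
          have h1 : |x i| ≤ ‖x‖ := by simpa using PiLp.norm_apply_le x i
          have h2 := Real.pi_pos
          calc ‖x‖ ^ k * (2 * π * |x i| * ‖u x‖) ≤ ‖x‖ ^ k * (2 * π * ‖x‖ * ‖u x‖) := by gcongr
            _ = _ := by ring
      _ = _ := by
          simp [mul_assoc]

/-- weighted norm -/
def WN (s : ℝ) (f : EE n → ℂ) : ℝ≥0∞ :=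
  eLpNorm (fun x => ((jap x ^ s : ℝ) : ℂ) * f x) 2 volume

lemma one_le_jap (x : EE n) : 1 ≤ jap x := by
  unfold jap
  exact Real.one_le_sqrt.2 (by nlinarith [sq_nonneg ‖x‖])

lemma jap_pos (x : EE n) : 0 < jap x := lt_of_lt_of_le one_pos (one_le_jap x)

lemma norm_le_jap (x : EE n) : ‖x‖ ≤ jap x := by
  unfold jap
  exact Real.le_sqrt_of_sq_le (by linarith)

lemma jap_le (x : EE n) : jap x ≤ 1 + ‖x‖ := by
  unfold jap
  exact Real.sqrt_le_iff.2 ⟨by positivity, by nlinarith [norm_nonneg x]⟩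

lemma jap_contDiff : ContDiff ℝ ∞ (jap : EE n → ℝ) := by
  unfold jap
  refine ContDiff.sqrt ?_ (fun x => by positivity)
  exact contDiff_const.add (contDiff_norm_sq ℝ)

lemma japs_contDiff (s : ℝ) : ContDiff ℝ ∞ (fun x : EE n => jap x ^ s) :=
  jap_contDiff.rpow_const_of_ne fun x => (jap_pos x).ne'

lemma japs_cont (s : ℝ) : Continuous (fun x : EE n => jap x ^ s) := (japs_contDiff s).continuous

lemma wn_upper (k : ℕ) (u : 𝓢(EE n, ℂ)) :
    WN k ⇑u ≤ ENNReal.ofReal (2 ^ k) * (NN 0 ⇑(FS u) + NN k ⇑(FS u)) := by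
  have h1 : WN k ⇑u ≤ ENNReal.ofReal (2 ^ k) * eLpNorm ((fun x => ‖u x‖) +
      (fun x => ‖((‖x‖ ^ k : ℝ) : ℂ) * u x‖)) 2 volume := by
    refine eLpNorm_le_mul_eLpNorm_of_ae_le_mul (Eventually.of_forall fun x => ?_) 2
    simp only [norm_mul, Complex.norm_real, Real.norm_eq_abs, Pi.add_apply, Real.rpow_natCast]
    rw [abs_of_nonneg (by have := jap_pos x; positivity), abs_of_nonneg (by positivity),
      abs_of_nonneg (by positivity)]
    have : jap x ^ k ≤ 2 ^ k * (1 + ‖x‖ ^ k) := by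
      calc jap x ^ k ≤ (1 + ‖x‖) ^ k := by gcongr; exact (jap_pos x).le; exact jap_le x
        _ ≤ 2 ^ (k - 1) * (1 ^ k + ‖x‖ ^ k) := add_pow_le (by norm_num) (norm_nonneg _) k
        _ ≤ _ := by
          rw [one_pow]; gcongr; norm_num; omega
    calc jap x ^ k * ‖u x‖ ≤ (2 ^ k * (1 + ‖x‖ ^ k)) * ‖u x‖ := by gcongr
      _ = _ := by ring
  refine h1.trans (mul_le_mul' le_rfl ?_)
  refine (eLpNorm_add_le u.continuous.norm.aestronglyMeasurable
    (cont_w k u).norm.aestronglyMeasurable (by norm_num)).trans ?_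
  rw [eLpNorm_norm, eLpNorm_norm]
  refine add_le_add ?_ (lower k u)
  simp [NN, eLpNorm_fourier]

lemma wn_lower (k : ℕ) : ∃ C : NNReal, ∀ u : 𝓢(EE n, ℂ),
    NN 0 ⇑(FS u) + NN k ⇑(FS u) ≤ C * WN k ⇑u := by
  obtain ⟨C, hC⟩ := upper (n := n) k
  refine ⟨1 + C, fun u => ?_⟩
  have hj : ∀ x : EE n, 1 ≤ |jap x ^ k| ∧ ‖x‖ ^ k ≤ |jap x ^ k| := fun x => by
    rw [abs_of_nonneg (by have := jap_pos x; positivity)]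
    exact ⟨one_le_pow₀ (one_le_jap x), by gcongr; exact norm_le_jap x⟩
  rw [ENNReal.coe_add, add_mul]
  refine add_le_add ?_ ((hC u).trans (mul_le_mul' le_rfl ?_))
  · simp only [NN, eLpNorm_fourier, ENNReal.coe_one, one_mul]
    refine eLpNorm_mono fun x => ?_
    simp only [norm_mul, Complex.norm_real, Real.norm_eq_abs, Real.rpow_natCast]
    exact le_mul_of_one_le_left (norm_nonneg _) (hj x).1
  · refine eLpNorm_mono fun x => ?_
    simp only [norm_mul, Complex.norm_real, Real.norm_eq_abs, Real.rpow_natCast]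
    refine mul_le_mul_of_nonneg_right ?_ (norm_nonneg _)
    rw [abs_of_nonneg (by positivity)]
    exact (hj x).2

/-- test functions as Schwartz functions -/
def TF.toS {f : EE n → ℂ} (hf : TF f) : 𝓢(EE n, ℂ) := hf.cpt.toSchwartzMap hf.smooth

lemma TF.toS_coe {f : EE n → ℂ} (hf : TF f) : ⇑hf.toS = f := rfl

lemma FS_FSi (u : 𝓢(EE n, ℂ)) : FS (FSi u) = u := by simp [FS, FSi]
lemma FSi_FS (u : 𝓢(EE n, ℂ)) : FSi (FS u) = u := by simp [FS, FSi]

lemma tf_bound {φ φi : EE n → EE n} (h : HD φ φi) {a : EE n → ℝ} (ha : HF 0 a) (k : ℕ)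
    (hk : 2 * k < n) : ∃ C : NNReal, ∀ f, ∀ hf : TF f,
      WN k ⇑(FSi (hf.comp ha h).toS) ≤ C * WN k ⇑(FSi hf.toS) := by
  obtain ⟨C0, h0⟩ := main_NN h 0 0 (by omega) ha
  obtain ⟨C1, h1⟩ := main_NN h k 0 (by omega) ha
  obtain ⟨C2, h2⟩ := wn_lower (n := n) k
  refine ⟨(2 ^ k : ℝ).toNNReal * ((C0 + C1) * C2), fun f hf => ?_⟩
  have h3 := wn_upper k (FSi (hf.comp ha h).toS)
  have h4 := h2 (FSi hf.toS)
  rw [FS_FSi, TF.toS_coe] at h3 h4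
  refine h3.trans ?_
  rw [ENNReal.coe_mul, ENNReal.coe_mul, mul_assoc, mul_assoc]
  refine mul_le_mul' le_rfl ?_
  refine le_trans ?_ (mul_le_mul' le_rfl h4)
  refine (add_le_add (h0 f hf) (h1 f hf)).trans ?_
  rw [ENNReal.coe_add, mul_add, add_zero, add_zero]
  gcongr <;> simp

/-! density -/

lemma pd_scale {χ f : EE n → ℂ} (hχ : ContDiff ℝ ∞ χ) (hf : ContDiff ℝ ∞ f) (c : ℝ) (i : Fin n) :
    pd i (fun ξ => χ (c • ξ) * f ξ) =
      fun ξ => (c : ℂ) * (pd i χ (c • ξ) * f ξ) + χ (c • ξ) * pd i f ξ := by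
  funext ξ
  have h1 : HasFDerivAt (fun ξ : EE n => χ (c • ξ)) _ ξ :=
    HasFDerivAt.comp (f := fun ξ : EE n => c • ξ) ξ
      ((hχ.differentiable (by simp) (c • ξ)).hasFDerivAt)
      ((hasFDerivAt_id (𝕜 := ℝ) ξ).const_smul c)
  have h2 := (hf.differentiable (by simp) ξ).hasFDerivAt
  have h3 := (h1.fun_mul h2).fderiv
  simp only [pd, h3]
  simp
  ring

lemma smooth_scale {χ : EE n → ℂ} (hχ : ContDiff ℝ ∞ χ) (c : ℝ) :
    ContDiff ℝ ∞ (fun ξ => χ (c • ξ)) := hχ.comp (contDiff_const_smul c)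

lemma enorm_real_le {t : ℝ} (h0 : 0 < t) (h1 : t ≤ 1) : ‖(t : ℂ)‖ₑ ≤ 1 := by
  rw [← ofReal_norm]; simp [abs_of_pos h0, h1]

lemma far_A (k : ℕ) {χ : EE n → ℂ} (hχ : ContDiff ℝ ∞ χ) (hc : HasCompactSupport χ)
    {f : EE n → ℂ} (hf : IsS f) :
    ∃ C : NNReal, ∀ t : ℝ, 0 < t → t ≤ 1 → NN k (fun ξ => χ (t • ξ) * f ξ) ≤ C := by
  induction k generalizing χ f with
  | zero =>
    obtain ⟨M, hM⟩ := hc.exists_bound_of_continuous hχ.continuous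
    refine ⟨(ENNReal.ofReal M * eLpNorm f 2 volume).toNNReal, fun t _ _ => ?_⟩
    rw [ENNReal.coe_toNNReal (ENNReal.mul_ne_top (by simp) hf.memLp.2.ne)]
    refine eLpNorm_le_mul_eLpNorm_of_ae_le_mul (Eventually.of_forall fun x => ?_) 2
    rw [norm_mul]
    gcongr
    exact hM _
  | succ k ih =>
    choose C1 h1 using fun i => ih (contDiff_pd hχ i) (hc.fderiv_apply ℝ (bv i)) hf
    choose C2 h2 using fun i => ih hχ hc (hf.pd i)
    refine ⟨∑ i, (C1 i + C2 i), fun t h0 ht => ?_⟩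
    simp only [NN]
    push_cast
    refine Finset.sum_le_sum fun i _ => ?_
    have := hf.smooth
    have := (hf.pd i).smooth
    have := smooth_scale hχ t
    have := smooth_scale (contDiff_pd hχ i) t
    rw [pd_scale hχ hf.smooth]
    refine (NN_add k (by fun_prop) (by fun_prop)).trans (add_le_add ?_ (h2 i t h0 ht))
    rw [NN_const_mul k _ (by fun_prop)]
    refine le_trans (mul_le_mul' (enorm_real_le h0 ht) (h1 i t h0 ht)) (by simp)

lemma norm_mul_IsS {f : EE n → ℂ} (hf : IsS f) :
    eLpNorm (fun x => ((‖x‖ : ℝ) : ℂ) * f x) 2 volume ≠ ⊤ := by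
  obtain ⟨g, rfl⟩ := hf
  have h := lower 1 g
  simp only [pow_one] at h
  refine ne_top_of_le_ne_top ?_ h
  simp only [NN]
  refine (ENNReal.sum_lt_top.2 fun i _ => ?_).ne
  have : IsS (pd i ⇑(FS g)) := IsS.pd ⟨_, rfl⟩ i
  exact this.memLp.2

lemma far_B (k : ℕ) {χ : EE n → ℂ} (hχ : ContDiff ℝ ∞ χ) (hc : HasCompactSupport χ)
    (h1 : χ 0 = 1) {f : EE n → ℂ} (hf : IsS f) :
    ∃ C : NNReal, ∀ t : ℝ, 0 < t → t ≤ 1 →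
      NN k (fun ξ => (1 - χ (t • ξ)) * f ξ) ≤ C * ENNReal.ofReal t := by
  induction k generalizing f with
  | zero =>
    obtain ⟨L, hL⟩ := hχ.lipschitzWith_of_hasCompactSupport hc (by simp)
    refine ⟨(L * eLpNorm (fun x => ((‖x‖ : ℝ) : ℂ) * f x) 2 volume).toNNReal, fun t h0 _ => ?_⟩
    rw [ENNReal.coe_toNNReal (ENNReal.mul_ne_top (by simp) (norm_mul_IsS hf))]
    have : (L * eLpNorm (fun x => ((‖x‖ : ℝ) : ℂ) * f x) 2 volume) * ENNReal.ofReal t =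
      ENNReal.ofReal (t * L) * eLpNorm (fun x => ((‖x‖ : ℝ) : ℂ) * f x) 2 volume := by
      rw [ENNReal.ofReal_mul h0.le]
      simp; ring
    rw [this]
    refine eLpNorm_le_mul_eLpNorm_of_ae_le_mul (Eventually.of_forall fun x => ?_) 2
    rw [norm_mul, norm_mul, ← mul_assoc]
    gcongr
    have := hL.dist_le_mul 0 (t • x)
    rw [dist_eq_norm, dist_eq_norm, h1, zero_sub, norm_neg, norm_smul, Real.norm_eq_abs,
      abs_of_pos h0] at this
    simp
    linarith
  | succ k ih =>
    choose C1 h1 using fun i => far_A k (contDiff_pd hχ i) (hc.fderiv_apply ℝ (bv i)) hf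
    choose C2 h2 using fun i => ih (hf.pd i)
    refine ⟨∑ i, (C1 i + C2 i), fun t h0 ht => ?_⟩
    simp only [NN]
    push_cast
    rw [Finset.sum_mul]
    refine Finset.sum_le_sum fun i _ => ?_
    have := hf.smooth
    have := (hf.pd i).smooth
    have h6 := smooth_scale hχ t
    have := smooth_scale (contDiff_pd hχ i) t
    have h3 : pd i (fun ξ => (1 - χ (t • ξ)) * f ξ) = fun ξ => ((-t : ℝ) : ℂ) * (pd i χ (t • ξ) * f ξ) +
        (1 - χ (t • ξ)) * pd i f ξ := by
      have h4 : (fun ξ => (1 - χ (t • ξ)) * f ξ) = fun ξ => f ξ + (-1) * (χ (t • ξ) * f ξ) := by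
        funext ξ; ring
      rw [h4, pd_add hf.smooth (by fun_prop), pd_const_mul _ (by fun_prop), pd_scale hχ hf.smooth]
      funext ξ; push_cast; ring
    rw [h3, add_mul]
    refine (NN_add k (by fun_prop) (by fun_prop)).trans (add_le_add ?_ (h2 i t h0 ht))
    rw [NN_const_mul k _ (by fun_prop), mul_comm]
    refine mul_le_mul' (h1 i t h0 ht) ?_
    rw [← ofReal_norm]; simp [abs_of_pos h0]

lemma near (hn : 0 < n) (k : ℕ) {χ g : EE n → ℂ} (hχ : ContDiff ℝ ∞ χ) (hc : HasCompactSupport χ)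
    (hg : ContDiff ℝ ∞ g) (hgc : HasCompactSupport g) :
    ∃ C : NNReal, ∀ t : ℝ, 0 < t → t ≤ 1 → NN k (fun ξ => χ ((t ^ 2)⁻¹ • ξ) * g ξ) ≤
      C * ENNReal.ofReal (t ^ n * ((t ^ 2)⁻¹) ^ k) := by
  induction k generalizing χ g with
  | zero =>
    obtain ⟨M, hM⟩ := hc.exists_bound_of_continuous hχ.continuous
    obtain ⟨M', hM'⟩ := hgc.exists_bound_of_continuous hg.continuous
    obtain ⟨R, hR0, hR⟩ := hc.isCompact.isBounded.subset_closedBall_lt 0 (0 : EE n)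
    have hM0 : 0 ≤ M := (norm_nonneg _).trans (hM 0)
    have hM0' : 0 ≤ M' := (norm_nonneg _).trans (hM' 0)
    set V : ℝ≥0∞ := volume (Metric.ball (0 : EE n) 1)
    have hV : V ≠ ⊤ := measure_ball_lt_top.ne
    refine ⟨(ENNReal.ofReal (M * M') * (ENNReal.ofReal (R ^ n) * V) ^ (1 / 2 : ℝ)).toNNReal,
      fun t h0 ht => ?_⟩
    rw [ENNReal.coe_toNNReal (by
      refine ENNReal.mul_ne_top (by simp) (ENNReal.rpow_ne_top_of_nonneg (by norm_num)
        (ENNReal.mul_ne_top (by simp) hV)))]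
    simp only [NN, pow_zero, mul_one]
    have h1 : eLpNorm (fun ξ => χ ((t ^ 2)⁻¹ • ξ) * g ξ) 2 volume ≤
        eLpNorm ((Metric.closedBall (0 : EE n) (t ^ 2 * R)).indicator
          (fun _ => (M * M' : ℝ))) 2 volume := by
      refine eLpNorm_mono_real fun x => ?_
      by_cases hx : x ∈ Metric.closedBall (0 : EE n) (t ^ 2 * R)
      · rw [indicator_of_mem hx, norm_mul]
        exact mul_le_mul (hM _) (hM' _) (norm_nonneg _) hM0
      · rw [indicator_of_notMem hx]
        have : χ ((t ^ 2)⁻¹ • x) = 0 := by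
          by_contra h
          have h2 := hR (subset_tsupport _ h)
          apply hx
          simp only [mem_closedBall_zero_iff, norm_smul, norm_inv, norm_pow, Real.norm_eq_abs,
            abs_of_pos h0] at h2 ⊢
          rwa [inv_mul_le_iff₀ (by positivity)] at h2
        simp [this]
    refine h1.trans ?_
    rw [eLpNorm_indicator_const measurableSet_closedBall (by norm_num) (by norm_num)]
    rw [Measure.addHaar_closedBall _ _ (by positivity)]
    rw [Real.enorm_eq_ofReal (by positivity), mul_assoc]
    refine mul_le_mul' le_rfl (le_of_eq ?_)
    have e : ENNReal.ofReal ((t ^ 2 * R) ^ (Module.finrank ℝ (EE n))) * V =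
      ENNReal.ofReal (t ^ n) ^ (2 : ℝ) * (ENNReal.ofReal (R ^ n) * V) := by
      rw [ENNReal.ofReal_rpow_of_nonneg (by positivity) (by norm_num), ← mul_assoc,
        ← ENNReal.ofReal_mul (by positivity)]
      congr 2
      simp [EE, finrank_euclideanSpace]
      ring
    rw [e, ENNReal.mul_rpow_of_nonneg _ _ (by norm_num), ← ENNReal.rpow_mul]
    norm_num
    rw [mul_comm]
  | succ k ih =>
    choose C1 h1 using fun i => ih (contDiff_pd hχ i) (hc.fderiv_apply ℝ (bv i)) hg hgc
    choose C2 h2 using fun i => ih hχ hc (contDiff_pd hg i) (hgc.fderiv_apply ℝ (bv i))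
    refine ⟨∑ i, (C1 i + C2 i), fun t h0 ht => ?_⟩
    simp only [NN]
    push_cast
    rw [Finset.sum_mul]
    refine Finset.sum_le_sum fun i _ => ?_
    have := (contDiff_pd hg i)
    have := smooth_scale hχ (t ^ 2)⁻¹
    have := smooth_scale (contDiff_pd hχ i) (t ^ 2)⁻¹
    have hT : 1 ≤ (t ^ 2)⁻¹ := (one_le_inv₀ (by positivity)).2 (pow_le_one₀ h0.le ht)
    rw [pd_scale hχ hg, add_mul]
    refine (NN_add k (by fun_prop) (by fun_prop)).trans (add_le_add ?_ ((h2 i t h0 ht).trans ?_))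
    · rw [NN_const_mul k _ (by fun_prop)]
      refine (mul_le_mul' le_rfl (h1 i t h0 ht)).trans (le_of_eq ?_)
      rw [← ofReal_norm, Complex.norm_real, Real.norm_eq_abs, abs_of_pos (by positivity),
        mul_left_comm, ← ENNReal.ofReal_mul (by positivity)]
      congr 2
      ring
    · gcongr
      omega

set_option maxHeartbeats 1000000 in
lemma TF_dense (k : ℕ) (hk : 2 * k < n) (u : 𝓢(EE n, ℂ)) {δ : ℝ} (hδ : 0 < δ) :
    ∃ g, ∃ hg : TF g, WN k ⇑(u - FSi hg.toS : 𝓢(EE n, ℂ)) ≤ ENNReal.ofReal δ := by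
  have hn : 0 < n := by omega
  let B : ContDiffBump (0 : EE n) := ⟨1, 2, by norm_num, by norm_num⟩
  let χ : EE n → ℂ := fun x => ((B x : ℝ) : ℂ)
  have hχ : ContDiff ℝ ∞ χ := Complex.ofRealCLM.contDiff.comp B.contDiff
  have hc : HasCompactSupport χ := B.hasCompactSupport.comp_left (g := ((↑) : ℝ → ℂ)) (by simp)
  have hone : χ =ᶠ[𝓝 0] 1 := by
    filter_upwards [B.eventuallyEq_one] with x hx
    simp [χ, hx]
  have h1 : χ 0 = 1 := hone.self_of_nhds
  have hf : IsS ⇑(FS u) := ⟨_, rfl⟩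
  -- for j = 0, k
  obtain ⟨A0, hA0⟩ := far_B 0 hχ hc h1 hf
  obtain ⟨Ak, hAk⟩ := far_B k hχ hc h1 hf
  set c : ℝ := 2 ^ k with hcdef
  have hc0 : 0 < c := by positivity
  obtain ⟨t, ht0, ht1, ht⟩ : ∃ t : ℝ, 0 < t ∧ t ≤ 1 ∧ c * ((A0 + Ak : ℝ) * t) ≤ δ / 2 := by
    refine ⟨min 1 (δ / 2 / (c * (A0 + Ak + 1))), by positivity, min_le_left _ _, ?_⟩
    calc _ ≤ c * ((A0 + Ak + 1 : ℝ) * (δ / 2 / (c * (A0 + Ak + 1)))) := by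
          refine mul_le_mul_of_nonneg_left (mul_le_mul (by simp) (min_le_right _ _)
            (by positivity) (by positivity)) hc0.le
      _ = δ / 2 := by field_simp
  set g0 : EE n → ℂ := fun ξ => χ (t • ξ) * FS u ξ with hg0
  have hg0s : ContDiff ℝ ∞ g0 := (smooth_scale hχ t).mul hf.smooth
  have hg0c : HasCompactSupport g0 := (hc.comp_smul ht0.ne').mul_right
  obtain ⟨B0, hB0⟩ := near hn 0 hχ hc hg0s hg0c
  obtain ⟨Bk, hBk⟩ := near hn k hχ hc hg0s hg0c
  obtain ⟨s, hs0, hs1, hs⟩ : ∃ t : ℝ, 0 < t ∧ t ≤ 1 ∧ c * ((B0 + Bk : ℝ) * t) ≤ δ / 2 := by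
    refine ⟨min 1 (δ / 2 / (c * (B0 + Bk + 1))), by positivity, min_le_left _ _, ?_⟩
    calc _ ≤ c * ((B0 + Bk + 1 : ℝ) * (δ / 2 / (c * (B0 + Bk + 1)))) := by
          refine mul_le_mul_of_nonneg_left (mul_le_mul (by simp) (min_le_right _ _)
            (by positivity) (by positivity)) hc0.le
      _ = δ / 2 := by field_simp
  have hsk : ∀ j, 2 * j < n → s ^ n * ((s ^ 2)⁻¹) ^ j ≤ s := fun j hj => by
    obtain ⟨d, rfl⟩ : ∃ d, n = 2 * j + 1 + d := ⟨n - (2 * j + 1), by omega⟩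
    have : s ^ (2 * j + 1 + d) * ((s ^ 2)⁻¹) ^ j = s * s ^ d := by
      rw [pow_add, pow_add, pow_mul, inv_pow]
      field_simp
    rw [this]
    exact mul_le_of_le_one_right hs0.le (pow_le_one₀ hs0.le hs1)
  set g : EE n → ℂ := fun ξ => g0 ξ + (-1) * (χ ((s ^ 2)⁻¹ • ξ) * g0 ξ) with hgdef
  have h7 : ContDiff ℝ ∞ (fun ξ => χ ((s ^ 2)⁻¹ • ξ) * g0 ξ) := (smooth_scale hχ _).mul hg0s
  have hg : TF g := by
    refine ⟨by fun_prop, ?_, ?_⟩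
    · exact hg0c.add (HasCompactSupport.mul_left (HasCompactSupport.mul_left hg0c))
    · have : Tendsto (fun ξ : EE n => (s ^ 2)⁻¹ • ξ) (𝓝 0) (𝓝 0) := by
        have h8 : Continuous (fun ξ : EE n => (s ^ 2)⁻¹ • ξ) := by fun_prop
        simpa using h8.tendsto 0
      filter_upwards [this.eventually hone] with x hx
      simp [g, hx]
  refine ⟨g, hg, ?_⟩
  refine (wn_upper k _).trans ?_
  have e : ⇑(FS (u - FSi hg.toS)) = fun ξ => (1 - χ (t • ξ)) * FS u ξ + χ ((s ^ 2)⁻¹ • ξ) * g0 ξ := by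
    have : FS (u - FSi hg.toS) = FS u - hg.toS := by
      have h10 : FS (u - FSi hg.toS) = FS u - FS (FSi hg.toS) :=
        map_sub (FourierTransform.fourierCLM ℂ 𝓢(EE n, ℂ)) _ _
      rw [h10, FS_FSi]
    rw [this]
    funext ξ
    simp only [sub_apply, TF.toS_coe, g, g0]
    ring
  have hs7 := smooth_scale hχ t
  have hs8 := hf.smooth
  have h9 : ContDiff ℝ ∞ (fun ξ => (1 - χ (t • ξ)) * FS u ξ) := by fun_prop
  have est : ∀ j (A B : NNReal), 2 * j < n →
      NN j (fun ξ => (1 - χ (t • ξ)) * FS u ξ) ≤ A * ENNReal.ofReal t →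
      NN j (fun ξ => χ ((s ^ 2)⁻¹ • ξ) * g0 ξ) ≤ B * ENNReal.ofReal (s ^ n * ((s ^ 2)⁻¹) ^ j) →
      NN j ⇑(FS (u - FSi hg.toS)) ≤ ENNReal.ofReal (A * t + B * s) := by
    intro j A B hj hA hB
    rw [e]
    refine (NN_add j h9 h7).trans ?_
    rw [ENNReal.ofReal_add (by positivity) (by positivity), ENNReal.ofReal_mul (by positivity),
      ENNReal.ofReal_mul (by positivity), ENNReal.ofReal_coe_nnreal, ENNReal.ofReal_coe_nnreal]
    refine add_le_add hA (hB.trans (mul_le_mul' le_rfl (ENNReal.ofReal_le_ofReal (hsk j hj))))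
  have e0 := est 0 A0 B0 (by omega) (hA0 t ht0 ht1) (hB0 s hs0 hs1)
  have ek := est k Ak Bk hk (hAk t ht0 ht1) (hBk s hs0 hs1)
  refine (mul_le_mul' le_rfl (add_le_add e0 ek)).trans ?_
  rw [← ENNReal.ofReal_add (by positivity) (by positivity), ← ENNReal.ofReal_mul (by positivity)]
  refine ENNReal.ofReal_le_ofReal ?_
  rw [← hcdef]
  nlinarith
open scoped FourierTransform LineDeriv

/-- the Hilbert space -/
abbrev L2 (n : ℕ) := Lp ℂ 2 (volume : Measure (EE n))

lemma HD.qmp {φ φi : EE n → EE n} (h : HD φ φi) (hn : 0 < n) :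
    Measure.QuasiMeasurePreserving φ (volume : Measure (EE n)) volume := by
  refine ⟨h.continuous.measurable, Measure.AbsolutelyContinuous.mk fun s hs h0 => ?_⟩
  rw [Measure.map_apply h.continuous.measurable hs]
  have h1 := h.cov hn (s.indicator 1)
  have h2 : (fun ξ => s.indicator (1 : EE n → ℝ≥0∞) (φ ξ)) = (φ ⁻¹' s).indicator 1 := by
    funext ξ; rfl
  rw [h2, lintegral_indicator_one (h.continuous.measurable hs)] at h1
  rw [h1]
  have h3 : ∀ᵐ ξ : EE n, ξ ∉ s := measure_eq_zero_iff_ae_notMem.1 h0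
  rw [lintegral_congr_ae (g := fun _ => 0)]
  · simp
  · filter_upwards [h3] with ξ hξ
    simp [hξ]

lemma ae_ne (hn : 0 < n) : ∀ᵐ ξ : EE n, ξ ≠ 0 := by
  have : Nonempty (Fin n) := ⟨⟨0, hn⟩⟩
  exact (measure_eq_zero_iff_ae_notMem.1 (measure_singleton (0 : EE n)))

lemma HF.aesm {r : ℕ} {a : EE n → ℝ} (ha : HF r a) (hn : 0 < n) :
    AEStronglyMeasurable (fun ξ => (a ξ : ℂ)) (volume : Measure (EE n)) := by
  rw [← restrict_c hn]
  refine ContinuousOn.aestronglyMeasurable ?_ (measurableSet_singleton 0).compl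
  exact Complex.continuous_ofReal.comp_continuousOn ha.smooth.continuousOn

lemma S_bound {φ φi : EE n → EE n} (h : HD φ φi) {a : EE n → ℝ} (ha : HF 0 a) (hn : 0 < n) :
    ∃ C : NNReal, ∀ f : EE n → ℂ, eLpNorm (fun ξ => (a ξ : ℂ) * f (φ ξ)) 2 volume ≤
      C * eLpNorm f 2 volume := by
  obtain ⟨M, hM0, hM⟩ := ha.bound
  obtain ⟨C, hC⟩ := h.eLpNorm_comp hn
  refine ⟨M.toNNReal * C, fun f => ?_⟩
  have : eLpNorm (fun ξ => (a ξ : ℂ) * f (φ ξ)) 2 volume ≤ ENNReal.ofReal M *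
      eLpNorm (fun ξ => f (φ ξ)) 2 volume := by
    refine eLpNorm_le_mul_eLpNorm_of_ae_le_mul ?_ 2
    filter_upwards [ae_ne hn] with ξ hξ
    rw [norm_mul]
    gcongr
    simpa using hM ξ hξ
  refine this.trans ?_
  rw [ENNReal.coe_mul, mul_assoc]
  exact mul_le_mul' le_rfl (hC f)

lemma S_aesm {φ φi : EE n → EE n} (h : HD φ φi) {a : EE n → ℝ} (ha : HF 0 a) (hn : 0 < n)
    {f : EE n → ℂ} (hf : AEStronglyMeasurable f volume) :
    AEStronglyMeasurable (fun ξ => (a ξ : ℂ) * f (φ ξ)) volume :=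
  (ha.aesm hn).mul (hf.comp_quasiMeasurePreserving (h.qmp hn))

lemma S_memLp {φ φi : EE n → EE n} (h : HD φ φi) {a : EE n → ℝ} (ha : HF 0 a) (hn : 0 < n)
    {f : EE n → ℂ} (hf : MemLp f 2 volume) :
    MemLp (fun ξ => (a ξ : ℂ) * f (φ ξ)) 2 volume := by
  refine ⟨S_aesm h ha hn hf.1, ?_⟩
  obtain ⟨C, hC⟩ := S_bound h ha hn
  exact (hC f).trans_lt (ENNReal.mul_lt_top (by simp) hf.2)

/-- the operator of composition and multiplication -/
def Sop {φ φi : EE n → EE n} (h : HD φ φi) {a : EE n → ℝ} (ha : HF 0 a) (hn : 0 < n) :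
    L2 n →L[ℂ] L2 n :=
  LinearMap.mkContinuousOfExistsBound
    { toFun := fun f => (S_memLp h ha hn (Lp.memLp f)).toLp _
      map_add' := fun f g => by
        rw [← MemLp.toLp_add]
        refine MemLp.toLp_congr _ _ ?_
        have := (h.qmp hn).ae_eq_comp (Lp.coeFn_add f g)
        filter_upwards [this] with ξ hξ
        simp only [Function.comp, Pi.add_apply] at hξ ⊢
        rw [hξ]; ring
      map_smul' := fun c f => by
        rw [RingHom.id_apply, ← MemLp.toLp_const_smul]
        refine MemLp.toLp_congr _ _ ?_
        have := (h.qmp hn).ae_eq_comp (Lp.coeFn_smul c f)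
        filter_upwards [this] with ξ hξ
        simp only [Function.comp, Pi.smul_apply, smul_eq_mul] at hξ ⊢
        rw [hξ]; ring }
    (by
      obtain ⟨C, hC⟩ := S_bound h ha hn
      refine ⟨C, fun f => ?_⟩
      simp only [LinearMap.coe_mk, AddHom.coe_mk]
      rw [Lp.norm_toLp, Lp.norm_def]
      have := ENNReal.toReal_mono (ENNReal.mul_ne_top (by simp) (Lp.memLp f).2.ne) (hC f)
      simpa using this)

lemma Sop_coe {φ φi : EE n → EE n} (h : HD φ φi) {a : EE n → ℝ} (ha : HF 0 a) (hn : 0 < n)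
    (f : L2 n) : Sop h ha hn f =ᵐ[volume] fun ξ => (a ξ : ℂ) * f (φ ξ) :=
  MemLp.coeFn_toLp (S_memLp h ha hn (Lp.memLp f))

/-- the operator on the physical side -/
def Top {φ φi : EE n → EE n} (h : HD φ φi) {a : EE n → ℝ} (ha : HF 0 a) (hn : 0 < n) :
    L2 n →L[ℂ] L2 n :=
  ((Lp.fourierTransformₗᵢ (EE n) ℂ).symm.toContinuousLinearEquiv : L2 n →L[ℂ] L2 n).comp
    ((Sop h ha hn).comp ((Lp.fourierTransformₗᵢ (EE n) ℂ).toContinuousLinearEquiv : L2 n →L[ℂ] L2 n))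

lemma Top_apply {φ φi : EE n → EE n} (h : HD φ φi) {a : EE n → ℝ} (ha : HF 0 a) (hn : 0 < n)
    (f : L2 n) : Top h ha hn f = 𝓕⁻ (Sop h ha hn (𝓕 f)) := rfl

lemma Top_toLp {φ φi : EE n → EE n} (h : HD φ φi) {a : EE n → ℝ} (ha : HF 0 a) (hn : 0 < n)
    {f : EE n → ℂ} (hf : TF f) :
    Top h ha hn ((FSi hf.toS).toLp 2) = (FSi (hf.comp ha h).toS).toLp 2 := by
  rw [Top_apply, SchwartzMap.toLp_fourier_eq, ← SchwartzMap.toLp_fourierInv_eq]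
  congr 1
  have : 𝓕 (FSi hf.toS) = hf.toS := FS_FSi _
  rw [this]
  refine Lp.ext ?_
  refine (Sop_coe h ha hn _).trans ?_
  refine EventuallyEq.trans ?_ (SchwartzMap.coeFn_toLp _ 2 volume).symm
  have := (h.qmp hn).ae_eq_comp (SchwartzMap.coeFn_toLp hf.toS 2 volume)
  filter_upwards [this] with ξ hξ
  simp only [Function.comp] at hξ
  rw [hξ]; rfl

lemma cont_japC (s : ℝ) : Continuous (fun x : EE n => ((jap x ^ s : ℝ) : ℂ)) :=
  Complex.continuous_ofReal.comp (japs_cont s)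

lemma WN_add (s : ℝ) {f g : EE n → ℂ} (hf : AEStronglyMeasurable f volume)
    (hg : AEStronglyMeasurable g volume) : WN s (fun x => f x + g x) ≤ WN s f + WN s g := by
  unfold WN
  have : (fun x => ((jap x ^ s : ℝ) : ℂ) * (f x + g x)) =
    (fun x => ((jap x ^ s : ℝ) : ℂ) * f x) + fun x => ((jap x ^ s : ℝ) : ℂ) * g x := by
    funext x; simp [mul_add]
  rw [this]
  exact eLpNorm_add_le ((cont_japC s).aestronglyMeasurable.mul hf)
    ((cont_japC s).aestronglyMeasurable.mul hg) (by norm_num)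

lemma WN_congr (s : ℝ) {f g : EE n → ℂ} (h : f =ᵐ[volume] g) : WN s f = WN s g := by
  refine eLpNorm_congr_ae ?_
  filter_upwards [h] with x hx
  rw [hx]

lemma eLpNorm_le_WN {s : ℝ} (hs : 0 ≤ s) (f : EE n → ℂ) : eLpNorm f 2 volume ≤ WN s f := by
  refine eLpNorm_mono fun x => ?_
  rw [norm_mul, Complex.norm_real, Real.norm_eq_abs]
  refine le_mul_of_one_le_left (norm_nonneg _) ?_
  exact (Real.one_le_rpow (one_le_jap x) hs).trans (le_abs_self _)

lemma S_dense (s : ℝ) {f : EE n → ℂ} (hf : AEStronglyMeasurable f volume) (h : WN s f ≠ ⊤)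
    {δ : ℝ} (hδ : 0 < δ) : ∃ u : 𝓢(EE n, ℂ), WN s (fun x => f x - u x) ≤ ENNReal.ofReal δ := by
  have hm : MemLp (fun x => ((jap x ^ s : ℝ) : ℂ) * f x) 2 volume :=
    ⟨(cont_japC s).aestronglyMeasurable.mul hf, h.lt_top⟩
  obtain ⟨g, hg1, hg2, hg3⟩ := hm.exist_eLpNorm_sub_le (by norm_num) (by norm_num) hδ
  have h1 : ContDiff ℝ ∞ fun x : EE n => ((jap x ^ (-s) : ℝ) : ℂ) * g x :=
    (Complex.ofRealCLM.contDiff.comp (japs_contDiff (-s))).mul hg2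
  refine ⟨HasCompactSupport.toSchwartzMap (f := fun x : EE n => ((jap x ^ (-s) : ℝ) : ℂ) * g x)
    hg1.mul_left h1, ?_⟩
  refine le_of_eq_of_le ?_ hg3
  unfold WN
  congr 1
  funext x
  change ((jap x ^ s : ℝ) : ℂ) * (f x - ((jap x ^ (-s) : ℝ) : ℂ) * g x) = _
  have : ((jap x ^ s : ℝ) : ℂ) * ((jap x ^ (-s) : ℝ) : ℂ) = 1 := by
    rw [← Complex.ofReal_mul, ← Real.rpow_add (jap_pos x)]; simp
  simp only [Pi.sub_apply]
  rw [mul_sub, ← mul_assoc, this, one_mul]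

lemma TF_dense' (k : ℕ) (hk : 2 * k < n) {f : EE n → ℂ} (hf : AEStronglyMeasurable f volume)
    (h : WN k f ≠ ⊤) {δ : ℝ} (hδ : 0 < δ) :
    ∃ g, ∃ hg : TF g, WN k (fun x => f x - FSi hg.toS x) ≤ ENNReal.ofReal δ := by
  obtain ⟨u, hu⟩ := S_dense k hf h (half_pos hδ)
  obtain ⟨g, hg, h2⟩ := TF_dense k hk u (half_pos hδ)
  refine ⟨g, hg, ?_⟩
  have := WN_add k (hf.sub u.continuous.aestronglyMeasurable)
    (u - FSi hg.toS : 𝓢(EE n, ℂ)).continuous.aestronglyMeasurable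
  refine le_trans (le_of_eq_of_le ?_ this) ((add_le_add hu h2).trans ?_)
  · congr 1; funext x; simp
  · rw [← ENNReal.ofReal_add (by positivity) (by positivity)]; simp

set_option maxHeartbeats 2000000 in
lemma wb_int {φ φi : EE n → EE n} (h : HD φ φi) {a : EE n → ℝ} (ha : HF 0 a) (hn : 0 < n)
    (k : ℕ) (hk : 2 * k < n) : ∃ C : NNReal, ∀ f : L2 n,
      WN k ⇑(Top h ha hn f) ≤ C * WN k ⇑f := by
  obtain ⟨C, hC⟩ := tf_bound h ha k hk
  refine ⟨C + 1, fun f => ?_⟩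
  by_cases hf : WN k ⇑f = ⊤
  · rw [hf, ENNReal.mul_top (by simp)]; exact le_top
  refine le_trans ?_ (mul_le_mul' (ENNReal.coe_le_coe.2 (le_add_of_nonneg_right zero_le_one)) le_rfl)
  have hm := (Lp.memLp f).1
  choose g hg hgb using fun j : ℕ => TF_dense' k hk hm hf (δ := 1 / ((j : ℝ) + 1)) (by positivity)
  have hδ : Tendsto (fun j : ℕ => ENNReal.ofReal (1 / ((j : ℝ) + 1))) atTop (𝓝 0) := by
    have := ENNReal.tendsto_ofReal (tendsto_one_div_add_atTop_nhds_zero_nat (𝕜 := ℝ))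
    simpa using this
  have hlim : Tendsto (fun j => (FSi (hg j).toS).toLp 2) atTop (𝓝 f) := by
    rw [Lp.tendsto_Lp_iff_tendsto_eLpNorm']
    refine tendsto_of_tendsto_of_tendsto_of_le_of_le tendsto_const_nhds hδ (fun _ => zero_le)
      fun j => ?_
    refine le_trans ?_ (hgb j)
    refine le_trans (le_of_eq ?_) (eLpNorm_le_WN (s := k) (by positivity) _)
    rw [eLpNorm_sub_comm]
    refine eLpNorm_congr_ae ?_
    filter_upwards [SchwartzMap.coeFn_toLp (FSi (hg j).toS) 2 volume] with x hx
    simp [hx]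
  have hlim2 := (((Top h ha hn).continuous.tendsto f).comp hlim)
  have e2 := (tendstoInMeasure_of_tendsto_Lp hlim2).exists_seq_tendsto_ae
  obtain ⟨ns, hns, hae⟩ := e2
  have e3 := Lp.eLpNorm_lim_le_liminf_eLpNorm (p := 2) (μ := (volume : Measure (EE n)))
    (f := fun i x => ((jap x ^ (k : ℝ) : ℝ) : ℂ) *
      (Top h ha hn ((FSi (hg (ns i)).toS).toLp 2)) x)
    (fun i => (cont_japC k).aestronglyMeasurable.mul (Lp.memLp _).1)
    (fun x => ((jap x ^ (k : ℝ) : ℝ) : ℂ) * (Top h ha hn f) x)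
    (by filter_upwards [hae] with x hx; exact hx.const_mul _)
  refine e3.trans ?_
  have e4 : ∀ i, eLpNorm (fun x => ((jap x ^ (k : ℝ) : ℝ) : ℂ) *
      (Top h ha hn ((FSi (hg (ns i)).toS).toLp 2)) x) 2 volume ≤
      C * (WN k ⇑f + ENNReal.ofReal (1 / ((ns i : ℝ) + 1))) := by
    intro i
    rw [Top_toLp]
    have : WN k ⇑((FSi ((hg (ns i)).comp ha h).toS).toLp 2) =
      WN k ⇑(FSi ((hg (ns i)).comp ha h).toS) := WN_congr _ (SchwartzMap.coeFn_toLp _ 2 volume)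
    refine (this.le.trans (hC _ (hg (ns i)))).trans (mul_le_mul' le_rfl ?_)
    have e5 := WN_add (k : ℝ) hm ((((FSi (hg (ns i)).toS).continuous.aestronglyMeasurable
      (μ := volume))).sub hm)
    refine le_trans (le_of_eq_of_le ?_ e5) (add_le_add le_rfl (le_of_eq_of_le ?_ (hgb (ns i))))
    · congr 1; funext x; simp
    · unfold WN
      rw [← eLpNorm_neg]
      congr 1; funext x; simp; ring
  refine (liminf_le_liminf (Eventually.of_forall e4)).trans (le_of_eq ?_)
  refine Tendsto.liminf_eq ?_
  have e6 : Tendsto (fun i => WN k ⇑f + ENNReal.ofReal (1 / ((ns i : ℝ) + 1))) atTop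
      (𝓝 (WN k ⇑f + 0)) := tendsto_const_nhds.add (hδ.comp hns.tendsto_atTop)
  rw [add_zero] at e6
  exact ENNReal.Tendsto.const_mul e6 (Or.inr (by simp))
open scoped FourierTransform LineDeriv ComplexConjugate

lemma inner_Sop {φ φi : EE n → EE n} (h : HD φ φi) {a : EE n → ℝ} (ha : HF 0 a)
    (ha1 : ∀ ξ, a ξ = 1) (hn : 0 < n) (f g : L2 n) :
    inner ℂ (Sop h ha hn f) g = inner ℂ f (Sop h.symm h.symm.hf_det hn g) := by
  rw [L2.inner_def, L2.inner_def]
  have e1 : ∫ x, inner ℂ (Sop h ha hn f x) (g x) = ∫ x, inner ℂ (f (φ x)) (g x) := by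
    refine integral_congr_ae ?_
    filter_upwards [Sop_coe h ha hn f] with x hx
    rw [hx, ha1]; simp
  have e2 : ∫ x, inner ℂ (f x) (Sop h.symm h.symm.hf_det hn g x) =
      ∫ x, |(fderiv ℝ φi x).det| • inner ℂ (f x) (g (φi x)) := by
    refine integral_congr_ae ?_
    filter_upwards [Sop_coe h.symm h.symm.hf_det hn g] with x hx
    rw [hx]
    simp only [RCLike.inner_apply, Complex.real_smul]
    ring
  rw [e1, e2]
  have := integral_image_eq_integral_abs_det_fderiv_smul (volume : Measure (EE n))
    (measurableSet_singleton (0 : EE n)).compl (f := φi) (f' := fderiv ℝ φi)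
    (fun x hx => ((h.symm.contDiffAt hx).differentiableAt (by simp)).hasFDerivAt.hasFDerivWithinAt)
    h.symm.injOn (fun x => inner ℂ (f (φ x)) (g x))
  rw [h.symm.image, restrict_c hn] at this
  rw [this]
  refine integral_congr_ae ?_
  filter_upwards [ae_ne hn] with x hx
  rw [h.right x hx]

lemma inner_Top {φ φi : EE n → EE n} (h : HD φ φi) {a : EE n → ℝ} (ha : HF 0 a)
    (ha1 : ∀ ξ, a ξ = 1) (hn : 0 < n) (f g : L2 n) :
    inner ℂ (Top h ha hn f) g = inner ℂ f (Top h.symm h.symm.hf_det hn g) := by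
  rw [Top_apply, Top_apply, ← Lp.inner_fourier_eq, ← Lp.inner_fourier_eq f,
    FourierTransform.fourier_fourierInv_eq, FourierTransform.fourier_fourierInv_eq]
  exact inner_Sop h ha ha1 hn _ _

lemma WN_sq (s : ℝ) (f : EE n → ℂ) :
    WN s f ^ 2 = ∫⁻ x, ENNReal.ofReal (jap x ^ (2 * s)) * ‖f x‖ₑ ^ 2 := by
  unfold WN
  rw [e2]
  refine lintegral_congr fun x => ?_
  rw [enorm_mul, mul_pow]
  congr 1
  have := jap_pos x
  rw [← ofReal_norm, Complex.norm_real, Real.norm_eq_abs, abs_of_pos (by positivity),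
    ← ENNReal.ofReal_pow (by positivity), ← Real.rpow_natCast, ← Real.rpow_mul this.le]
  congr 2
  push_cast; ring

/-- Cauchy Schwarz with weights -/
lemma enorm_inner_le (s : ℝ) (f g : L2 n) : ‖inner ℂ f g‖ₑ ≤ WN s ⇑f * WN (-s) ⇑g := by
  rw [L2.inner_def]
  refine (enorm_integral_le_lintegral_enorm _).trans ?_
  have h1 : ∀ x, ‖inner ℂ (f x) (g x)‖ₑ = ‖((jap x ^ s : ℝ) : ℂ) * f x‖ₑ *
      ‖((jap x ^ (-s) : ℝ) : ℂ) * g x‖ₑ := by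
    intro x
    have : ‖((jap x ^ s : ℝ) : ℂ)‖ₑ * ‖((jap x ^ (-s) : ℝ) : ℂ)‖ₑ = 1 := by
      rw [← enorm_mul, ← Complex.ofReal_mul, ← Real.rpow_add (jap_pos x)]; simp
    simp only [RCLike.inner_apply, enorm_mul]
    rw [mul_mul_mul_comm, this, one_mul, mul_comm]
    congr 1
    rw [← ofReal_norm, ← ofReal_norm, RCLike.norm_conj]
  simp_rw [h1]
  have h2 := ENNReal.lintegral_mul_le_Lp_mul_Lq (volume : Measure (EE n))
    (Real.HolderConjugate.two_two)
    (f := fun x => ‖((jap x ^ s : ℝ) : ℂ) * f x‖ₑ) (g := fun x => ‖((jap x ^ (-s) : ℝ) : ℂ) * g x‖ₑ)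
    ((cont_japC s).aestronglyMeasurable.mul (Lp.memLp f).1).enorm
    ((cont_japC (-s)).aestronglyMeasurable.mul (Lp.memLp g).1).enorm
  refine h2.trans (le_of_eq ?_)
  unfold WN
  rw [eLpNorm_eq_lintegral_rpow_enorm_toReal (by norm_num) (by norm_num),
    eLpNorm_eq_lintegral_rpow_enorm_toReal (by norm_num) (by norm_num)]
  simp

/-- multiplication by a bounded real weight -/
lemma exists_mul (b : EE n → ℝ) (hb : Continuous b) (h0 : ∀ x, 0 ≤ b x) (h1 : ∀ x, b x ≤ 1)
    (f : L2 n) : ∃ g : L2 n, g =ᵐ[volume] fun x => (b x : ℂ) * f x := by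
  have : MemLp (fun x => (b x : ℂ) * f x) 2 volume := by
    refine (Lp.memLp f).of_le ?_ (Eventually.of_forall fun x => ?_)
    · exact (Complex.continuous_ofReal.comp hb).aestronglyMeasurable.mul (Lp.memLp f).1
    · rw [norm_mul, Complex.norm_real, Real.norm_eq_abs, abs_of_nonneg (h0 x)]
      exact mul_le_of_le_one_left (norm_nonneg _) (h1 x)
  exact ⟨this.toLp _, MemLp.coeFn_toLp _⟩

/-- duality -/
lemma wb_neg {T T' : L2 n →L[ℂ] L2 n} (hT : ∀ f g, inner ℂ (T f) g = inner ℂ f (T' g))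
    {m : ℝ} (hm : 0 ≤ m) {C : NNReal} (hC : ∀ f, WN m ⇑(T' f) ≤ C * WN m ⇑f) (f : L2 n) :
    WN (-m) ⇑(T f) ≤ C * WN (-m) ⇑f := by
  obtain ⟨h, hh⟩ := exists_mul (fun x : EE n => jap x ^ (2 * (-m))) (japs_cont _)
    (fun x => by have := jap_pos x; positivity)
    (fun x => Real.rpow_le_one_of_one_le_of_nonpos (one_le_jap x) (by linarith)) (T f)
  set A := WN (-m) ⇑(T f) with hA
  have hfin : A ≠ ⊤ := by
    refine ne_top_of_le_ne_top (Lp.memLp (T f)).2.ne ?_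
    refine eLpNorm_mono fun x => ?_
    have := jap_pos x
    rw [norm_mul, Complex.norm_real, Real.norm_eq_abs, abs_of_nonneg (by positivity)]
    exact mul_le_of_le_one_left (norm_nonneg _)
      (Real.rpow_le_one_of_one_le_of_nonpos (one_le_jap x) (by linarith))
  have h1 : A = WN m ⇑h := by
    rw [WN_congr m hh, hA]
    unfold WN
    congr 1
    funext x
    rw [← mul_assoc, ← Complex.ofReal_mul, ← Real.rpow_add (jap_pos x)]
    congr 3; ring
  have h2 : A ^ 2 = ‖inner ℂ (T f) h‖ₑ := by
    have h3 : ∫⁻ x, ENNReal.ofReal (jap x ^ (2 * (-m))) * ‖T f x‖ₑ ^ 2 =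
        ∫⁻ x, ENNReal.ofReal (jap x ^ (2 * (-m)) * ‖T f x‖ ^ 2) := by
      refine lintegral_congr fun x => ?_
      have := jap_pos x
      rw [ENNReal.ofReal_mul (by positivity), ENNReal.ofReal_pow (by positivity), ofReal_norm]
    have h4 : inner ℂ (T f) h = ((∫ x, jap x ^ (2 * (-m)) * ‖T f x‖ ^ 2 : ℝ) : ℂ) := by
      rw [L2.inner_def, ← integral_complex_ofReal]
      refine integral_congr_ae ?_
      filter_upwards [hh] with x hx
      rw [hx]
      simp only [RCLike.inner_apply]
      rw [mul_assoc, Complex.mul_conj, Complex.normSq_eq_norm_sq]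
      push_cast; ring
    have h5 : ∀ x : EE n, 0 ≤ jap x ^ (2 * (-m)) * ‖T f x‖ ^ 2 := fun x => by
      have := jap_pos x; positivity
    rw [h4, hA, WN_sq, h3, ← ofReal_norm, Complex.norm_real, Real.norm_eq_abs,
      abs_of_nonneg (integral_nonneg h5),
      integral_eq_lintegral_of_nonneg_ae (Eventually.of_forall h5)
        ((japs_cont _).aestronglyMeasurable.mul ((Lp.memLp (T f)).1.norm.pow 2)), ENNReal.ofReal_toReal]
    rw [← h3, ← WN_sq, ← hA]
    exact ENNReal.pow_ne_top hfin
  have h3 : A ^ 2 ≤ A * (C * WN (-m) ⇑f) := by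
    rw [h2, hT]
    have h4 : ‖inner ℂ f (T' h)‖ₑ = ‖inner ℂ (T' h) f‖ₑ := by
      rw [← ofReal_norm, ← ofReal_norm, norm_inner_symm]
    rw [h4]
    refine (enorm_inner_le m _ _).trans ?_
    refine (mul_le_mul' (hC h) le_rfl).trans (le_of_eq ?_)
    rw [← h1]; ring
  by_cases h0 : A = 0
  · rw [h0]; exact zero_le
  rw [pow_two] at h3
  exact (ENNReal.mul_le_mul_iff_right h0 hfin).1 h3

/-! interpolation -/

/-- the interpolation kernel integral -/
def Phi (θ w : ℝ) : ℝ≥0∞ :=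
  ∫⁻ t in Ioi (0 : ℝ), ENNReal.ofReal (t ^ (θ - 2) * (t * w / (t + w)))

lemma Phi_scale (θ : ℝ) {w : ℝ} (hw : 0 < w) : Phi θ w = ENNReal.ofReal (w ^ θ) * Phi θ 1 := by
  unfold Phi
  have h := lintegral_image_eq_lintegral_abs_deriv_mul (s := Ioi (0 : ℝ)) (f := fun t => w * t)
    (f' := fun _ => w) measurableSet_Ioi
    (fun x _ => by simpa using ((hasDerivAt_id x).const_mul w).hasDerivWithinAt)
    (fun x _ y _ hxy => by simpa [hw.ne'] using hxy)
    (fun t => ENNReal.ofReal (t ^ (θ - 2) * (t * w / (t + w))))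
  have him : (fun t => w * t) '' Ioi (0 : ℝ) = Ioi 0 := by
    ext y
    constructor
    · rintro ⟨x, hx, rfl⟩; exact mul_pos hw hx
    · intro hy; exact ⟨y / w, div_pos hy hw, by field_simp⟩
  rw [him] at h
  rw [h, ← lintegral_const_mul' _ _ (by simp)]
  refine setLIntegral_congr_fun measurableSet_Ioi fun t ht => ?_
  have ht' : (0 : ℝ) < t := ht
  rw [abs_of_pos hw, ← ENNReal.ofReal_mul hw.le, ← ENNReal.ofReal_mul (by positivity)]
  congr 1
  rw [Real.mul_rpow hw.le ht'.le]
  have : w ^ θ = w ^ (θ - 2) * w ^ 2 := by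
    rw [← Real.rpow_natCast, ← Real.rpow_add hw]; congr 1; push_cast; ring
  rw [this]
  have e : w * t + w = w * (t + 1) := by ring
  rw [e]
  field_simp

lemma Phi_ne_zero (θ : ℝ) : Phi θ 1 ≠ 0 := by
  unfold Phi
  intro h
  rw [setLIntegral_eq_zero_iff measurableSet_Ioi (by fun_prop)] at h
  have h1 : ∀ᵐ t : ℝ, t ∉ Ioi (0 : ℝ) := by
    filter_upwards [h] with t ht hh
    have ht0 : (0 : ℝ) < t := hh
    have := ht hh
    rw [ENNReal.ofReal_eq_zero] at this
    have : 0 < t ^ (θ - 2) * (t * 1 / (t + 1)) := by positivity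
    linarith
  have := measure_eq_zero_iff_ae_notMem.2 h1
  simp at this

lemma Phi_ne_top {θ : ℝ} (h0 : 0 < θ) (h1 : θ < 1) : Phi θ 1 ≠ ⊤ := by
  unfold Phi
  have hsub : Ioi (0 : ℝ) = Ioc 0 1 ∪ Ioi 1 := by rw [Ioc_union_Ioi_eq_Ioi zero_le_one]
  rw [hsub]
  refine ((lintegral_union_le _ _ _).trans_lt (ENNReal.add_lt_top.2 ⟨?_, ?_⟩)).ne
  · have hi : IntegrableOn (fun t : ℝ => t ^ (θ - 1)) (Ioc 0 1) := by
      have := intervalIntegral.intervalIntegrable_rpow' (a := 0) (b := 1) (r := θ - 1) (by linarith)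
      rwa [intervalIntegrable_iff_integrableOn_Ioc_of_le zero_le_one] at this
    refine lt_of_le_of_lt ?_ hi.2
    refine setLIntegral_mono' measurableSet_Ioc fun t ht => ?_
    have ht0 := ht.1
    rw [Real.enorm_eq_ofReal (by positivity)]
    refine ENNReal.ofReal_le_ofReal ?_
    have : t ^ (θ - 1) = t ^ (θ - 2) * t := by
      nth_rewrite 3 [← Real.rpow_one t]
      rw [← Real.rpow_add ht0]; congr 1; ring
    simp only [this]
    gcongr
    rw [mul_one]
    exact div_le_self ht0.le (by linarith)
  · have hi : IntegrableOn (fun t : ℝ => t ^ (θ - 2)) (Ioi 1) :=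
      integrableOn_Ioi_rpow_of_lt (by linarith) one_pos
    refine lt_of_le_of_lt ?_ hi.2
    refine setLIntegral_mono' measurableSet_Ioi fun t ht => ?_
    have ht0 : (0 : ℝ) < t := lt_trans one_pos ht
    rw [Real.enorm_eq_ofReal (by positivity)]
    refine ENNReal.ofReal_le_ofReal ?_
    refine mul_le_of_le_one_right (by positivity) ?_
    rw [mul_one, div_le_one (by positivity)]
    linarith

/-- the K functional -/
def KK (K t : ℝ) (f : EE n → ℂ) : ℝ≥0∞ :=
  ∫⁻ x, ENNReal.ofReal (t * jap x ^ (2 * K) / (t + jap x ^ (2 * K))) * ‖f x‖ₑ ^ 2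

lemma pt_le {t w : ℝ} (ht : 0 < t) (hw : 0 < w) (p q : ℂ) :
    ENNReal.ofReal (t * w / (t + w)) * ‖p + q‖ₑ ^ 2 ≤
      ENNReal.ofReal w * ‖p‖ₑ ^ 2 + ENNReal.ofReal t * ‖q‖ₑ ^ 2 := by
  simp only [← ofReal_norm]
  rw [← ENNReal.ofReal_pow (by positivity), ← ENNReal.ofReal_pow (by positivity),
    ← ENNReal.ofReal_pow (by positivity), ← ENNReal.ofReal_mul (by positivity),
    ← ENNReal.ofReal_mul (by positivity), ← ENNReal.ofReal_mul (by positivity),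
    ← ENNReal.ofReal_add (by positivity) (by positivity)]
  refine ENNReal.ofReal_le_ofReal ?_
  rw [div_mul_eq_mul_div, div_le_iff₀ (by positivity)]
  have h1 : ‖p + q‖ ^ 2 ≤ (‖p‖ + ‖q‖) ^ 2 := by gcongr; exact norm_add_le p q
  have h2 : t * w * ‖p + q‖ ^ 2 ≤ t * w * (‖p‖ + ‖q‖) ^ 2 := by gcongr
  nlinarith [sq_nonneg (w * ‖p‖ - t * ‖q‖)]

lemma pt_eq {t w : ℝ} (ht : 0 < t) (hw : 0 < w) (p : ℂ) :
    ENNReal.ofReal w * ‖((t / (w + t) : ℝ) : ℂ) * p‖ₑ ^ 2 +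
      ENNReal.ofReal t * ‖((w / (w + t) : ℝ) : ℂ) * p‖ₑ ^ 2 =
    ENNReal.ofReal (t * w / (t + w)) * ‖p‖ₑ ^ 2 := by
  simp only [← ofReal_norm, norm_mul, Complex.norm_real, Real.norm_eq_abs]
  rw [abs_of_pos (by positivity), abs_of_pos (by positivity)]
  rw [← ENNReal.ofReal_pow (by positivity), ← ENNReal.ofReal_pow (by positivity),
    ← ENNReal.ofReal_pow (by positivity), ← ENNReal.ofReal_mul (by positivity),
    ← ENNReal.ofReal_mul (by positivity), ← ENNReal.ofReal_mul (by positivity),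
    ← ENNReal.ofReal_add (by positivity) (by positivity)]
  congr 1
  field_simp
  ring

lemma L2_bound (T : L2 n →L[ℂ] L2 n) (f : L2 n) :
    eLpNorm (⇑(T f)) 2 volume ≤ (‖T‖₊ : ℝ≥0∞) * eLpNorm (⇑f) 2 volume := by
  rw [← Lp.enorm_def, ← Lp.enorm_def, ← ofReal_norm, ← ofReal_norm, ← ENNReal.ofReal_coe_nnreal,
    ← ENNReal.ofReal_mul (by positivity)]
  exact ENNReal.ofReal_le_ofReal (T.le_opNorm f)

lemma KK_bound (T : L2 n →L[ℂ] L2 n) (K : ℝ) {C : NNReal}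
    (hC : ∀ f, WN K ⇑(T f) ≤ C * WN K ⇑f) : ∃ D : NNReal, ∀ t : ℝ, 0 < t → ∀ f : L2 n,
      KK K t ⇑(T f) ≤ D * KK K t ⇑f := by
  refine ⟨C ^ 2 + ‖T‖₊ ^ 2, fun t ht f => ?_⟩
  set w : EE n → ℝ := fun x => jap x ^ (2 * K) with hw
  have hw0 : ∀ x, 0 < w x := fun x => by have := jap_pos x; positivity
  have hwc : Continuous w := japs_cont _
  obtain ⟨g, hg⟩ := exists_mul (fun x => t / (w x + t))
    (continuous_const.div (by fun_prop) fun x => by have := hw0 x; positivity)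
    (fun x => by have := hw0 x; positivity)
    (fun x => by have := hw0 x; rw [div_le_one (by positivity)]; linarith) f
  obtain ⟨h, hh⟩ := exists_mul (fun x => w x / (w x + t))
    (hwc.div (by fun_prop) fun x => by have := hw0 x; positivity)
    (fun x => by have := hw0 x; positivity)
    (fun x => by have := hw0 x; rw [div_le_one (by positivity)]; linarith) f
  have hsum : f = g + h := by
    refine Lp.ext ?_
    filter_upwards [hg, hh, Lp.coeFn_add g h] with x h1 h2 h3
    rw [h3, Pi.add_apply, h1, h2, ← add_mul, ← Complex.ofReal_add, ← add_div, add_comm t,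
      div_self (by have := hw0 x; positivity)]
    simp
  have e1 : KK K t ⇑(T f) ≤ WN K ⇑(T g) ^ 2 + ENNReal.ofReal t * eLpNorm (⇑(T h)) 2 volume ^ 2 := by
    rw [WN_sq, e2, ← lintegral_const_mul' _ _ (by simp), ← lintegral_add_left']
    · refine lintegral_mono_ae ?_
      have : T f = T g + T h := by rw [hsum, map_add]
      filter_upwards [Lp.coeFn_add (T g) (T h)] with x hx
      rw [this, hx]
      exact pt_le ht (hw0 x) _ _
    · exact (hwc.measurable.ennreal_ofReal.aemeasurable).mul ((Lp.memLp (T g)).1.enorm.pow_const 2)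
  have e3 : WN K ⇑g ^ 2 + ENNReal.ofReal t * eLpNorm (⇑h) 2 volume ^ 2 = KK K t ⇑f := by
    rw [WN_sq, e2, ← lintegral_const_mul' _ _ (by simp), ← lintegral_add_left']
    · refine lintegral_congr_ae ?_
      filter_upwards [hg, hh] with x h1 h2
      rw [h1, h2]
      exact pt_eq ht (hw0 x) _
    · exact (hwc.measurable.ennreal_ofReal.aemeasurable).mul ((Lp.memLp g).1.enorm.pow_const 2)
  refine e1.trans ?_
  rw [← e3]
  have f1 : WN K ⇑(T g) ^ 2 ≤ (C : ℝ≥0∞) ^ 2 * WN K ⇑g ^ 2 := by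
    rw [← mul_pow]; exact pow_le_pow_left' (hC g) 2
  have f2 : eLpNorm (⇑(T h)) 2 volume ^ 2 ≤ (‖T‖₊ : ℝ≥0∞) ^ 2 * eLpNorm (⇑h) 2 volume ^ 2 := by
    rw [← mul_pow]; exact pow_le_pow_left' (L2_bound T h) 2
  push_cast
  rw [mul_add]
  refine add_le_add (f1.trans (mul_le_mul' le_self_add le_rfl)) ?_
  calc _ ≤ ENNReal.ofReal t * ((‖T‖₊ : ℝ≥0∞) ^ 2 * eLpNorm (⇑h) 2 volume ^ 2) := by gcongr
    _ = (‖T‖₊ : ℝ≥0∞) ^ 2 * (ENNReal.ofReal t * eLpNorm (⇑h) 2 volume ^ 2) := by ring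
    _ ≤ _ := mul_le_mul' le_add_self le_rfl

lemma KK_int {θ : ℝ} (K : ℝ) (f : L2 n) :
    ∫⁻ t in Ioi (0 : ℝ), ENNReal.ofReal (t ^ (θ - 2)) * KK K t ⇑f =
      Phi θ 1 * WN (θ * K) ⇑f ^ 2 := by
  have hwc : Continuous (fun x : EE n => jap x ^ (2 * K)) := japs_cont _
  have hf : Measurable (fun x => ‖f x‖ₑ) := (Lp.stronglyMeasurable f).enorm
  have hw0 : ∀ x : EE n, 0 < jap x ^ (2 * K) := fun x => by have := jap_pos x; positivity
  have hwm := hwc.measurable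
  unfold KK
  simp_rw [← lintegral_const_mul' _ _ ENNReal.ofReal_ne_top]
  rw [lintegral_lintegral_swap]
  · rw [WN_sq, ← lintegral_const_mul]
    · refine lintegral_congr fun x => ?_
      have : ENNReal.ofReal (jap x ^ (2 * (θ * K))) * Phi θ 1 = Phi θ (jap x ^ (2 * K)) := by
        rw [Phi_scale θ (hw0 x), ← Real.rpow_mul (jap_pos x).le]
        congr 3; ring
      rw [← mul_assoc, mul_comm (Phi θ 1), this]
      unfold Phi
      rw [← lintegral_mul_const' _ _ (by simp)]
      refine setLIntegral_congr_fun measurableSet_Ioi fun t ht => ?_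
      have ht' : (0 : ℝ) < t := ht
      rw [← mul_assoc, ENNReal.ofReal_mul (by positivity)]
    · exact ((japs_cont _).measurable.ennreal_ofReal).mul (hf.pow_const 2)
  · refine Measurable.aemeasurable ?_
    simp only [Function.uncurry_def]
    have hf' : Measurable (fun p : ℝ × EE n => ‖f p.2‖ₑ) := hf.comp measurable_snd
    have hw' : Measurable (fun p : ℝ × EE n => jap p.2 ^ (2 * K)) := hwm.comp measurable_snd
    refine Measurable.mul (by fun_prop) (Measurable.mul ?_ (hf'.pow_const 2))
    exact ((measurable_fst.mul hw').div (measurable_fst.add hw')).ennreal_ofReal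

lemma interp (T : L2 n →L[ℂ] L2 n) {K m : ℝ} (hm0 : 0 ≤ m) (hmK : m ≤ K) {C : NNReal}
    (hC : ∀ f, WN K ⇑(T f) ≤ C * WN K ⇑f) : ∃ C' : NNReal, ∀ f : L2 n,
      WN m ⇑(T f) ≤ C' * WN m ⇑f := by
  rcases hmK.eq_or_lt with rfl | hmK
  · exact ⟨C, hC⟩
  rcases hm0.eq_or_lt with rfl | hm0
  · exact ⟨‖T‖₊, fun f => by simpa [WN] using L2_bound T f⟩
  obtain ⟨D, hD⟩ := KK_bound T K hC
  have hK : 0 < K := hm0.trans hmK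
  set θ := m / K
  have hθ0 : 0 < θ := div_pos hm0 hK
  have hθ1 : θ < 1 := (div_lt_one hK).2 hmK
  have hθK : θ * K = m := div_mul_cancel₀ _ hK.ne'
  refine ⟨NNReal.sqrt D, fun f => le_of_sq_le ?_⟩
  rw [mul_pow, ← ENNReal.coe_pow, NNReal.sq_sqrt]
  have h : Phi θ 1 * WN (θ * K) ⇑(T f) ^ 2 ≤ Phi θ 1 * (D * WN (θ * K) ⇑f ^ 2) := by
    rw [mul_left_comm, ← KK_int, ← KK_int, ← lintegral_const_mul' _ _ (by simp)]
    refine setLIntegral_mono' measurableSet_Ioi fun t ht => ?_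
    rw [mul_left_comm]
    exact mul_le_mul' le_rfl (hD t ht f)
  rw [hθK] at h
  exact (ENNReal.mul_le_mul_iff_right (Phi_ne_zero θ) (Phi_ne_top hθ0 hθ1)).1 h

/-- all weights -/
lemma wb_all {φ φi : EE n → EE n} (h : HD φ φi) {a : EE n → ℝ} (ha : HF 0 a)
    (ha1 : ∀ ξ, a ξ = 1) (hn : 0 < n) (k : ℕ) (hk : 2 * k < n) {m : ℝ} (hm : |m| ≤ k) :
    ∃ C : NNReal, ∀ f : L2 n, WN m ⇑(Top h ha hn f) ≤ C * WN m ⇑f := by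
  rcases le_total 0 m with h0 | h0
  · rw [abs_of_nonneg h0] at hm
    obtain ⟨C, hC⟩ := wb_int h ha hn k hk
    exact interp _ h0 hm hC
  · rw [abs_of_nonpos h0] at hm
    obtain ⟨C, hC⟩ := wb_int h.symm h.symm.hf_det hn k hk
    obtain ⟨C', hC'⟩ := interp _ (by linarith : 0 ≤ -m) hm hC
    refine ⟨C', fun f => ?_⟩
    have := wb_neg (inner_Top h ha ha1 hn) (by linarith : 0 ≤ -m) hC' f
    rwa [neg_neg] at this
open scoped FourierTransform

lemma FTint_eq (u : EE n → ℂ) (ξ : EE n) : FTint u ξ = 𝓕 u ((2 * Real.pi)⁻¹ • ξ) := by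
  rw [Real.fourier_eq', FTint]
  congr 1
  funext x
  rw [smul_eq_mul, inner_smul_right]
  congr 2
  have : (-2 * Real.pi * ((2 * Real.pi)⁻¹ * ⟪x, ξ⟫)) = -⟪x, ξ⟫ := by
    have := Real.pi_ne_zero
    field_simp
  rw [this]
  push_cast
  ring

lemma FTinvInt_eq (v : EE n → ℂ) (x : EE n) :
    FTinvInt v x = 𝓕⁻ (fun η => v ((2 * Real.pi) • η)) x := by
  rw [Real.fourierInv_eq', FTinvInt]
  have h := Measure.integral_comp_smul (volume : Measure (EE n))
    (fun ξ => Complex.exp (Complex.I * (⟪x, ξ⟫ : ℝ)) * v ξ) (2 * Real.pi)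
  have e : (fun w : EE n => Complex.exp (((2 * Real.pi * ⟪w, x⟫ : ℝ) : ℂ) * Complex.I) •
      v ((2 * Real.pi) • w)) = fun w => Complex.exp (Complex.I *
        (⟪x, (2 * Real.pi) • w⟫ : ℝ)) * v ((2 * Real.pi) • w) := by
    funext w
    rw [inner_smul_right, real_inner_comm, smul_eq_mul, mul_comm Complex.I]
  rw [e, h, finrank_euclideanSpace_fin, abs_of_nonneg (by positivity), Complex.real_smul]
  push_cast
  rfl

lemma FTcomp {φ φi : EE n → EE n} (h : HD φ φi) (hn : 0 < n) {ψ : EE n → EE n}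
    (hψ : ∀ ξ, ξ ≠ 0 → ψ ξ = φ ξ) (u : 𝓢(EE n, ℂ)) (x : EE n) :
    FTinvInt (fun ξ => FTint (⇑u) (ψ ξ)) x = 𝓕⁻ (fun η => FS u (φ η)) x := by
  rw [FTinvInt_eq]
  apply Real.fourierInv_congr_ae
  filter_upwards [ae_ne hn] with η hη
  have hp : (2 * Real.pi) ≠ 0 := by positivity
  rw [FTint_eq, hψ _ (smul_ne_zero hp hη), h.hom _ (by positivity) _ hη, smul_smul,
    inv_mul_cancel₀ hp, one_smul]
  rfl

lemma HD.integrable_comp {φ φi : EE n → EE n} (h : HD φ φi) (hn : 0 < n) (g : 𝓢(EE n, ℂ)) :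
    Integrable (fun η => g (φ η)) := by
  refine ⟨(g.continuous.comp h.continuous).aestronglyMeasurable, ?_⟩
  obtain ⟨C, hC0, hC⟩ := h.symm.hf_det.bound
  have hg : HasFiniteIntegral g volume := g.integrable.2
  rw [hasFiniteIntegral_iff_enorm] at hg ⊢
  rw [h.cov hn (fun ξ => ‖g ξ‖ₑ)]
  calc _ ≤ ∫⁻ ξ, ENNReal.ofReal C * ‖g ξ‖ₑ := by
        apply lintegral_mono_ae
        filter_upwards [ae_ne hn] with ξ hξ
        gcongr
        have := hC ξ hξ
        simpa using this
    _ = ENNReal.ofReal C * ∫⁻ ξ, ‖g ξ‖ₑ := lintegral_const_mul' _ _ ENNReal.ofReal_ne_top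
    _ < (⊤ : ℝ≥0∞) := ENNReal.mul_lt_top ENNReal.ofReal_lt_top hg

lemma fourierInv_L1L2 {v : EE n → ℂ} (h1 : Integrable v) (h2 : MemLp v 2 volume) :
    ((𝓕⁻ (h2.toLp v : L2 n) : L2 n) : EE n → ℂ) =ᵐ[volume] 𝓕⁻ v := by
  have hL : Continuous fun p : EE n × EE n => (-innerₗ (EE n)) p.1 p.2 := by
    simp only [LinearMap.neg_apply, innerₗ_apply_apply]
    fun_prop
  refine ae_eq_of_integral_contDiff_smul_eq ?_ ?_ ?_
  · exact (Lp.memLp _).locallyIntegrable (by norm_num)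
  · have : Continuous (𝓕⁻ v) :=
      VectorFourier.fourierIntegral_continuous Real.continuous_fourierChar hL h1
    exact this.locallyIntegrable
  · intro g hg hgc
    have hgc' : HasCompactSupport (fun x => (g x : ℂ)) := hgc.comp_left Complex.ofReal_zero
    have hg' : ContDiff ℝ ∞ (fun x => (g x : ℂ)) := Complex.ofRealCLM.contDiff.comp hg
    set G : 𝓢(EE n, ℂ) := hgc'.toSchwartzMap hg' with hG
    have hGx : ∀ x, G x = (g x : ℂ) := fun x => rfl
    have A := congrArg (fun T => T G) (Lp.fourierInv_toTemperedDistribution_eq (h2.toLp v : L2 n))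
    simp only [TemperedDistribution.fourierInv_apply, Lp.toTemperedDistribution_apply] at A
    have B := VectorFourier.integral_bilin_fourierIntegral_eq_flip (ContinuousLinearMap.mul ℂ ℂ)
      (L := -innerₗ (EE n)) (μ := volume) (ν := volume)
      Real.continuous_fourierChar hL (G.integrable (μ := volume)) h1
    have e1 : ∫ x, (𝓕⁻ G : 𝓢(EE n, ℂ)) x • (h2.toLp v : L2 n) x =
        ∫ x, (𝓕⁻ G : 𝓢(EE n, ℂ)) x * v x := by
      apply integral_congr_ae
      filter_upwards [h2.coeFn_toLp] with x hx
      rw [hx, smul_eq_mul]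
    have e2 : ∫ x, (𝓕⁻ G : 𝓢(EE n, ℂ)) x * v x = ∫ x, G x * 𝓕⁻ v x := by
      have fl : (-innerₗ (EE n)).flip = -innerₗ (EE n) := by
        ext x y
        simp [real_inner_comm]
      rw [fl] at B
      rw [SchwartzMap.fourierInv_coe]
      exact B
    rw [e1, e2] at A
    calc _ = ∫ x, G x • (𝓕⁻ (h2.toLp v : L2 n) : L2 n) x := by
          congr 1
      _ = ∫ x, G x * 𝓕⁻ v x := A.symm
      _ = _ := by congr 1

lemma hf_one : HF 0 (fun _ : EE n => (1 : ℝ)) where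
  smooth := contDiffOn_const
  hom := by intros; simp

lemma final_one {φ φi : EE n → EE n} (h : HD φ φi) (hn : 0 < n) (k : ℕ) (hk : 2 * k < n) {m : ℝ}
    (hm : |m| ≤ k) {ψ : EE n → EE n} (hψ : ∀ ξ, ξ ≠ 0 → ψ ξ = φ ξ) :
    ∃ C : NNReal, ∀ u : 𝓢(EE n, ℂ),
      eLpNorm (fun x => ((jap x ^ m : ℝ) : ℂ) *
            FTinvInt (fun ξ => FTint (⇑u) (ψ ξ)) x) 2 volume
          ≤ C * eLpNorm (fun x => ((jap x ^ m : ℝ) : ℂ) * u x) 2 volume := by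
  obtain ⟨C, hC⟩ := wb_all h hf_one (fun _ => rfl) hn k hk hm
  refine ⟨C, fun u => ?_⟩
  have h1 := h.integrable_comp hn (FS u)
  have h2 : MemLp (fun η => FS u (φ η)) 2 volume := by
    have := S_memLp h hf_one hn ((FS u).memLp 2 volume)
    simpa using this
  have hS : Sop h hf_one hn (𝓕 (u.toLp 2 : L2 n)) = h2.toLp _ := by
    apply Lp.ext
    rw [SchwartzMap.toLp_fourier_eq]
    have c := h.qmp hn |>.ae_eq_comp (SchwartzMap.coeFn_toLp (FS u) 2 volume)
    filter_upwards [Sop_coe h hf_one hn ((FS u).toLp 2 : L2 n), h2.coeFn_toLp, c] with ξ x1 x2 x3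
    rw [x2]
    refine x1.trans ?_
    simpa using x3
  have key : (fun x => FTinvInt (fun ξ => FTint (⇑u) (ψ ξ)) x) =ᵐ[volume]
      ⇑(Top h hf_one hn (u.toLp 2 : L2 n)) := by
    rw [Top_apply, hS]
    filter_upwards [fourierInv_L1L2 h1 h2] with x hx
    rw [hx, FTcomp h hn hψ u x]
  have a1 := WN_congr m key
  have a2 := WN_congr m (SchwartzMap.coeFn_toLp u 2 volume)
  have a3 := hC (u.toLp 2 : L2 n)
  rw [← a1, a2] at a3
  exact a3

lemma mkHD (ψ ψinv : EE n → EE n)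
    (hψ : ContDiffOn ℝ (⊤ : ℕ∞) ψ {0}ᶜ) (hψinv : ContDiffOn ℝ (⊤ : ℕ∞) ψinv {0}ᶜ)
    (hψ0 : ∀ ξ, ξ ≠ 0 → ψ ξ ≠ 0) (hψinv0 : ∀ ξ, ξ ≠ 0 → ψinv ξ ≠ 0)
    (hleft : ∀ ξ, ξ ≠ 0 → ψinv (ψ ξ) = ξ) (hright : ∀ ξ, ξ ≠ 0 → ψ (ψinv ξ) = ξ)
    (hhom : ∀ lam : ℝ, 0 < lam → ∀ ξ, ξ ≠ 0 → ψ (lam • ξ) = lam • ψ ξ)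
    (hhominv : ∀ lam : ℝ, 0 < lam → ∀ ξ, ξ ≠ 0 → ψinv (lam • ξ) = lam • ψinv ξ) :
    HD (Function.update ψ 0 0) (Function.update ψinv 0 0) := by
  have e1 : ∀ ξ, ξ ≠ 0 → Function.update ψ 0 0 ξ = ψ ξ := fun ξ h => Function.update_of_ne h _ _
  have e2 : ∀ ξ, ξ ≠ 0 → Function.update ψinv 0 0 ξ = ψinv ξ :=
    fun ξ h => Function.update_of_ne h _ _
  refine ⟨hψ.congr fun ξ h => e1 ξ h, hψinv.congr fun ξ h => e2 ξ h, ?_, ?_, ?_, ?_, ?_, ?_,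
    by simp, by simp⟩
  · intro ξ h; rw [e1 ξ h]; exact hψ0 ξ h
  · intro ξ h; rw [e2 ξ h]; exact hψinv0 ξ h
  · intro ξ h; rw [e1 ξ h, e2 _ (hψ0 ξ h)]; exact hleft ξ h
  · intro ξ h; rw [e2 ξ h, e1 _ (hψinv0 ξ h)]; exact hright ξ h
  · intro l hl ξ h; rw [e1 ξ h, e1 _ (smul_ne_zero hl.ne' h)]; exact hhom l hl ξ h
  · intro l hl ξ h; rw [e2 ξ h, e2 _ (smul_ne_zero hl.ne' h)]; exact hhominv l hl ξ h

lemma final_all (ψ ψinv : EE n → EE n)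
    (hψ : ContDiffOn ℝ (⊤ : ℕ∞) ψ {0}ᶜ) (hψinv : ContDiffOn ℝ (⊤ : ℕ∞) ψinv {0}ᶜ)
    (hψ0 : ∀ ξ, ξ ≠ 0 → ψ ξ ≠ 0) (hψinv0 : ∀ ξ, ξ ≠ 0 → ψinv ξ ≠ 0)
    (hleft : ∀ ξ, ξ ≠ 0 → ψinv (ψ ξ) = ξ) (hright : ∀ ξ, ξ ≠ 0 → ψ (ψinv ξ) = ξ)
    (hhom : ∀ lam : ℝ, 0 < lam → ∀ ξ, ξ ≠ 0 → ψ (lam • ξ) = lam • ψ ξ)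
    (hhominv : ∀ lam : ℝ, 0 < lam → ∀ ξ, ξ ≠ 0 → ψinv (lam • ξ) = lam • ψinv ξ)
    (m : ℝ) (hm : |m| ≤ ((⌈(n : ℝ) / 2⌉ - 1 : ℤ) : ℝ)) :
    ∃ C : ℝ,
      ∀ u : 𝓢(EE n, ℂ),
        eLpNorm (fun x => ((jap x ^ m : ℝ) : ℂ) *
            FTinvInt (fun ξ => FTint (⇑u) (ψ ξ)) x) 2 volume
          ≤ ENNReal.ofReal C *
            eLpNorm (fun x => ((jap x ^ m : ℝ) : ℂ) * u x) 2 volume ∧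
        eLpNorm (fun x => ((jap x ^ m : ℝ) : ℂ) *
            FTinvInt (fun ξ => FTint (⇑u) (ψinv ξ)) x) 2 volume
          ≤ ENNReal.ofReal C *
            eLpNorm (fun x => ((jap x ^ m : ℝ) : ℂ) * u x) 2 volume := by
  have hz : (0 : ℤ) ≤ ⌈(n : ℝ) / 2⌉ - 1 := by
    have : (0 : ℝ) ≤ ((⌈(n : ℝ) / 2⌉ - 1 : ℤ) : ℝ) := (abs_nonneg m).trans hm
    exact_mod_cast this
  obtain ⟨k, hk⟩ := Int.eq_ofNat_of_zero_le hz
  rw [hk] at hm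
  have hkn : 2 * k < n := by
    have := Int.ceil_lt_add_one ((n : ℝ) / 2)
    have h2 : ((⌈(n : ℝ) / 2⌉ - 1 : ℤ) : ℝ) = k := by rw [hk]; simp
    push_cast at h2
    have : (2 * k : ℝ) < n := by linarith
    exact_mod_cast this
  have hn : 0 < n := by omega
  have H := mkHD ψ ψinv hψ hψinv hψ0 hψinv0 hleft hright hhom hhominv
  obtain ⟨C1, h1⟩ := final_one H hn k hkn (m := m) (by simpa using hm) (ψ := ψ)
    (fun ξ h => (Function.update_of_ne h _ _).symm)
  obtain ⟨C2, h2⟩ := final_one H.symm hn k hkn (m := m) (by simpa using hm) (ψ := ψinv)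
    (fun ξ h => (Function.update_of_ne h _ _).symm)
  refine ⟨(max C1 C2 : NNReal), fun u => ⟨(h1 u).trans ?_, (h2 u).trans ?_⟩⟩
  · rw [ENNReal.ofReal_coe_nnreal]
    gcongr
    exact le_max_left _ _
  · rw [ENNReal.ofReal_coe_nnreal]
    gcongr
    exact le_max_right _ _

end TPsi

/-- (Remark 4.1.) For a smooth positively homogeneous (of degree 1)
bijection `ψ` of `ℝ^n∖{0}` with smooth inverse and `|det Dψ| ≥ C₀ > 0`, the operators
`T_ψ u = F⁻¹[(Fu)∘ψ]` and `T_ψ⁻¹ u = F⁻¹[(Fu)∘ψ⁻¹]` are bounded on `L²_m(ℝ^n)` for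
every real `m` with `|m| ≤ [n/2]₋`, the greatest integer strictly less than `n/2`. -/
theorem statement16 (n : ℕ)
    (ψ ψinv : EuclideanSpace ℝ (Fin n) → EuclideanSpace ℝ (Fin n))
    (hψ : ContDiffOn ℝ (⊤ : ℕ∞) ψ {0}ᶜ) (hψinv : ContDiffOn ℝ (⊤ : ℕ∞) ψinv {0}ᶜ)
    (hψ0 : ∀ ξ, ξ ≠ 0 → ψ ξ ≠ 0) (hψinv0 : ∀ ξ, ξ ≠ 0 → ψinv ξ ≠ 0)
    (hleft : ∀ ξ, ξ ≠ 0 → ψinv (ψ ξ) = ξ) (hright : ∀ ξ, ξ ≠ 0 → ψ (ψinv ξ) = ξ)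
    (hhom : ∀ lam : ℝ, 0 < lam → ∀ ξ, ξ ≠ 0 → ψ (lam • ξ) = lam • ψ ξ)
    (hhominv : ∀ lam : ℝ, 0 < lam → ∀ ξ, ξ ≠ 0 → ψinv (lam • ξ) = lam • ψinv ξ)
    (C₀ : ℝ) (hC₀ : 0 < C₀) (hdet : ∀ ξ, ξ ≠ 0 → C₀ ≤ |Matrix.det (jacMat ψ ξ)|)
    (m : ℝ) (hm : |m| ≤ ((⌈(n : ℝ) / 2⌉ - 1 : ℤ) : ℝ)) :
    ∃ C : ℝ,
      ∀ u : 𝓢(EuclideanSpace ℝ (Fin n), ℂ),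
        eLpNorm (fun x => ((jap x ^ m : ℝ) : ℂ) *
            FTinvInt (fun ξ => FTint (⇑u) (ψ ξ)) x) 2 volume
          ≤ ENNReal.ofReal C *
            eLpNorm (fun x => ((jap x ^ m : ℝ) : ℂ) * u x) 2 volume ∧
        eLpNorm (fun x => ((jap x ^ m : ℝ) : ℂ) *
            FTinvInt (fun ξ => FTint (⇑u) (ψinv ξ)) x) 2 volume
          ≤ ENNReal.ofReal C *
            eLpNorm (fun x => ((jap x ^ m : ℝ) : ℂ) * u x) 2 volume := by
  exact TPsi.final_all ψ ψinv hψ hψinv hψ0 hψinv0 hleft hright hhom hhominv m hm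
end
end

section
/- Let n ≥ 3 and let p ∈ C^∞(ℝ^n∖{0}) be positive and positively homogeneous of degree 1. Assume the hypersurface Σ = {ξ : p(ξ) = 1} has non-vanishing Gaussian curvature, expressed concretely as: the map ψ(ξ) := p(ξ)∇p(ξ)/|∇p(ξ)| is a bijection of ℝ^n∖{0} onto itself with smooth inverse and |det Dψ(ξ)| ≥ C₀ > 0 for all ξ ≠ 0. For a Schwartz function f on ℝ^n let u(t,·) := F^{-1}[e^{it p(ξ)²} (Ff)(ξ)] be the solution of the generalized Schrödinger equation i∂_t u + p(D)² u = 0, u(0,·) = f. Then there is a constant C, independent of f, such that ∫_ℝ ∫_{ℝ^n} ⟨x⟩^{-2} |(⟨D⟩^{1/2} u)(t,x)|² dx dt ≤ C ‖f‖²_{L²(ℝ^n)}, i.e. ‖⟨x⟩^{-1} ⟨D⟩^{1/2} u‖_{L²(ℝ_t × ℝ^n_x)} ≤ C‖f‖_{L²(ℝ^n_x)}. -/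
open MeasureTheory Complex SchwartzMap
open scoped BigOperators ENNReal Real RealInnerProductSpace

noncomputable section

/-- Fourier transform on a general inner product space. -/
def FTV {V : Type*} [NormedAddCommGroup V] [InnerProductSpace ℝ V] [MeasurableSpace V]
    [BorelSpace V] [FiniteDimensional ℝ V] (g : V → ℂ) (ξ : V) : ℂ :=
  ∫ x, Complex.exp (-(Complex.I * (⟪x, ξ⟫ : ℝ))) * g x

section Planch
variable {V : Type*} [NormedAddCommGroup V] [InnerProductSpace ℝ V] [MeasurableSpace V]
    [BorelSpace V] [FiniteDimensional ℝ V]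

open FourierTransform in
lemma FTV_eq (g : V → ℂ) (ξ : V) : FTV g ξ = 𝓕 g ((2 * Real.pi)⁻¹ • ξ) := by
  rw [Real.fourier_eq', FTV]
  congr 1
  ext x
  rw [smul_eq_mul, inner_smul_right]
  congr 2
  push_cast
  field_simp

open FourierTransform in
lemma continuous_fourier' {g : V → ℂ} (hg : Integrable g) : Continuous (𝓕 g) := 
  VectorFourier.fourierIntegral_continuous Real.continuous_fourierChar
    (by exact continuous_inner) hg

open FourierTransform in
lemma planch_aux {g : V → ℂ} (hg : Integrable g) (hg2 : MemLp g 2 volume) :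
    eLpNorm (𝓕 g) 2 volume = eLpNorm g 2 volume := by
  set G : Lp (α := V) ℂ 2 volume := hg2.toLp g with hG
  have hloc : LocallyIntegrable (𝓕 g) (volume : Measure V) :=
    (continuous_fourier' hg).locallyIntegrable
  have hloc' : LocallyIntegrable (⇑(𝓕 G : Lp (α := V) ℂ 2 volume)) (volume : Measure V) :=
    (Lp.memLp (𝓕 G)).locallyIntegrable (by norm_num)
  have key : ∀ᵐ x, (𝓕 g) x = (𝓕 G : Lp (α := V) ℂ 2 volume) x := by
    refine ae_eq_of_integral_contDiff_smul_eq hloc hloc' ?_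
    intro φ hφ hφc
    have hφ' : ContDiff ℝ (⊤ : ℕ∞) (fun x => (φ x : ℂ)) := 
      Complex.ofRealCLM.contDiff.comp hφ
    have hφc' : HasCompactSupport (fun x => (φ x : ℂ)) := hφc.comp_left (g := fun x : ℝ => (x:ℂ)) (by simp)
    set Φ : 𝓢(V, ℂ) := hφc'.toSchwartzMap hφ' with hΦ
    have hΦa : ∀ x, Φ x = (φ x : ℂ) := fun x => by rw [hΦ]; rfl
    have e1 := congrArg (fun T : 𝓢'(V, ℂ) => T Φ) (Lp.fourier_toTemperedDistribution_eq G)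
    simp only [TemperedDistribution.fourier_apply, Lp.toTemperedDistribution_apply] at e1
    have e2 := VectorFourier.integral_fourierIntegral_smul_eq_flip (μ := (volume : Measure V)) (ν := (volume : Measure V)) (e := Real.fourierChar) (L := innerₗ V) 
      (f := g) (g := ⇑Φ) Real.continuous_fourierChar (by exact continuous_inner) hg Φ.integrable
    simp only [hΦa, smul_eq_mul] at e1 e2
    have e3 : ∫ x, φ x • (𝓕 g) x = ∫ x, (𝓕 g) x * (φ x : ℂ) := by
      congr 1; ext x; rw [Complex.real_smul, mul_comm]
    rw [e3]
    refine Eq.trans e2 ?_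
    refine Eq.trans ?_ e1
    rw [flip_innerₗ]
    refine integral_congr_ae ?_
    filter_upwards [hg2.coeFn_toLp] with x hx
    rw [hG, hx, mul_comm]
    rfl
  rw [eLpNorm_congr_ae key]
  have h1 := Lp.norm_fourier_eq G
  rw [← eLpNorm_congr_ae hg2.coeFn_toLp]
  rw [Lp.norm_def, Lp.norm_def] at h1
  exact (ENNReal.toReal_eq_toReal_iff' (Lp.eLpNorm_ne_top _) (Lp.eLpNorm_ne_top _)).1 h1

lemma eLpNorm_two_sq {α : Type*} [MeasurableSpace α] (μ : Measure α) (g : α → ℂ) :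
    eLpNorm g 2 μ ^ 2 = ∫⁻ x, ‖g x‖ₑ ^ 2 ∂μ := by
  have := eLpNorm_nnreal_pow_eq_lintegral (f := g) (μ := μ) (p := 2) (by norm_num)
  simpa using this

open FourierTransform in
lemma planch {g : V → ℂ} (hg : Integrable g) :
    ∫⁻ ξ, ‖FTV g ξ‖ₑ ^ 2 ≤
      ENNReal.ofReal ((2 * Real.pi) ^ (Module.finrank ℝ V)) * ∫⁻ x, ‖g x‖ₑ ^ 2 := by
  by_cases hfin : ∫⁻ x, ‖g x‖ₑ ^ 2 = ⊤
  · rw [hfin, ENNReal.mul_top]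
    · exact le_top
    · simp; positivity
  have hg2 : MemLp g 2 volume := by
    refine ⟨hg.aestronglyMeasurable, ?_⟩
    rw [← eLpNorm_two_sq] at hfin
    exact lt_top_iff_ne_top.2 (fun h => hfin (by rw [h]; simp))
  have h1 := planch_aux hg hg2
  have h2 : ∫⁻ ξ, ‖(𝓕 g) ξ‖ₑ ^ 2 = ∫⁻ x, ‖g x‖ₑ ^ 2 := by
    rw [← eLpNorm_two_sq, ← eLpNorm_two_sq, h1]
  have hm : Measurable fun ξ => ‖(𝓕 g) ξ‖ₑ ^ 2 :=
    ((continuous_fourier' hg).measurable.enorm).pow_const 2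
  simp_rw [FTV_eq]
  have hr : ((2 * Real.pi)⁻¹ : ℝ) ≠ 0 := by positivity
  have h3 := Measure.map_addHaar_smul (volume : Measure V) hr
  have h4 : ∫⁻ ξ, ‖(𝓕 g) ((2 * Real.pi)⁻¹ • ξ)‖ₑ ^ 2 
      = ∫⁻ ξ, ‖(𝓕 g) ξ‖ₑ ^ 2 ∂(Measure.map (fun x : V => (2 * Real.pi)⁻¹ • x) volume) := by
    rw [lintegral_map hm (measurable_const_smul _)]
  rw [h4, h3, lintegral_smul_measure, h2]
  rw [smul_eq_mul, abs_of_pos (by positivity), inv_pow, inv_inv]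
end Planch

lemma cv_aux (c : ℝ) (hc : 0 < c) (Q : ℝ → ℝ≥0∞) :
    ∫⁻ r in Set.Ioi (0:ℝ), ENNReal.ofReal r * Q (r ^ 2 * c) ≤
      ENNReal.ofReal (1 / (2 * c)) * ∫⁻ τ, Q τ := by
  have h := lintegral_image_eq_lintegral_abs_deriv_mul (s := Set.Ioi (0:ℝ))
    (f := fun r => r ^ 2 * c) (f' := fun r => 2 * r * c) measurableSet_Ioi
    (fun x _ => by
      have := ((hasDerivAt_pow 2 x).mul_const c).hasDerivWithinAt (s := Set.Ioi 0)
      simpa using this)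
    (fun x hx y hy hxy => by
      have h1 : x ^ 2 = y ^ 2 := mul_right_cancel₀ hc.ne' hxy
      exact (pow_left_inj₀ (le_of_lt hx) (le_of_lt hy) two_ne_zero).1 h1) Q
  have h2 : ∫⁻ r in Set.Ioi (0:ℝ), ENNReal.ofReal r * Q (r ^ 2 * c)
      = ENNReal.ofReal (1 / (2 * c)) *
        ∫⁻ x in Set.Ioi (0:ℝ), ENNReal.ofReal |2 * x * c| * Q (x ^ 2 * c) := by
    rw [← lintegral_const_mul' _ _ ENNReal.ofReal_ne_top]
    refine setLIntegral_congr_fun measurableSet_Ioi (fun x hx => ?_)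
    have hx : 0 < x := hx
    rw [← mul_assoc, ← ENNReal.ofReal_mul (by positivity), abs_of_pos (by positivity)]
    congr 2
    field_simp
  rw [h2, ← h]
  gcongr
  exact Measure.restrict_le_self

lemma polar {E : Type*} [NormedAddCommGroup E] [InnerProductSpace ℝ E] [MeasurableSpace E]
    [BorelSpace E] [FiniteDimensional ℝ E] [Nontrivial E] {f : E → ℝ≥0∞} (hf : Measurable f) :
    ∫⁻ x, f x = ∫⁻ ω : Metric.sphere (0 : E) 1, (∫⁻ r : ℝ in Set.Ioi (0:ℝ),
      ENNReal.ofReal (r ^ (Module.finrank ℝ E - 1)) * f (r • (ω : E)))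
        ∂((volume : Measure E).toSphere) := by
  have h1 : ∫⁻ x, f x = ∫⁻ x : ({0}ᶜ : Set E), f x ∂((volume : Measure E).comap Subtype.val) := by
    rw [lintegral_subtype_comap (measurableSet_singleton _).compl, restrict_compl_singleton]
  have h2 := (volume : Measure E).measurePreserving_homeomorphUnitSphereProd.symm
    (homeomorphUnitSphereProd E).toMeasurableEquiv
  have hm : Measurable (fun x : ({0}ᶜ : Set E) => f x) := hf.comp measurable_subtype_coe
  rw [h1, ← h2.lintegral_comp hm]
  rw [lintegral_prod]
  swap
  · exact (hm.comp h2.measurable).aemeasurable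
  refine lintegral_congr fun ω => ?_
  rw [Measure.volumeIoiPow, lintegral_withDensity_eq_lintegral_mul₀]
  · rw [← lintegral_subtype_comap measurableSet_Ioi]
    refine lintegral_congr fun r => ?_
    simp [Homeomorph.toMeasurableEquiv]
  · exact (ENNReal.measurable_ofReal.comp (by fun_prop)).aemeasurable
  · exact (hm.comp (h2.measurable.comp measurable_prodMk_left)).aemeasurable

lemma inv_sq_int (r : ℝ) (hr : 0 < r) :
    ∫⁻ s in Set.Icc r (r+2), ENNReal.ofReal ((s ^ 2)⁻¹) = ENNReal.ofReal (2 / (r * (r+2))) := by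
  have hle : r ≤ r + 2 := by linarith
  have hcont : ContinuousOn (fun s : ℝ => (s ^ 2)⁻¹) (Set.uIcc r (r+2)) := by
    rw [Set.uIcc_of_le hle]
    refine ContinuousOn.inv₀ (by fun_prop) (fun x hx => ?_)
    have : 0 < x := lt_of_lt_of_le hr hx.1
    positivity
  rw [← ofReal_integral_eq_lintegral_ofReal]
  · rw [integral_Icc_eq_integral_Ioc, ← intervalIntegral.integral_of_le hle]
    rw [intervalIntegral.integral_eq_sub_of_hasDerivAt (f := fun s => - s⁻¹)]
    · congr 1
      field_simp
      ring
    · intro x hx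
      rw [Set.uIcc_of_le hle] at hx
      have : x ≠ 0 := (lt_of_lt_of_le hr hx.1).ne'
      have := (hasDerivAt_inv this).neg
      rw [neg_neg] at this
      exact this
    · exact hcont.intervalIntegrable
  · rw [Set.uIcc_of_le hle] at hcont
    exact hcont.integrableOn_Icc
  · exact Filter.Eventually.of_forall fun x => by positivity

lemma cs_aux {α : Type*} [MeasurableSpace α] (μ : Measure α) {f g : α → ℝ≥0∞}
    (hf : AEMeasurable f μ) (hg : AEMeasurable g μ) :
    (∫⁻ a, f a * g a ∂μ) ^ 2 ≤ (∫⁻ a, f a ^ 2 ∂μ) * ∫⁻ a, g a ^ 2 ∂μ := by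
  have h := ENNReal.lintegral_mul_le_Lp_mul_Lq μ Real.HolderConjugate.two_two hf hg
  simp only [Pi.mul_apply, ENNReal.rpow_two] at h
  refine (pow_le_pow_left' h 2).trans (le_of_eq ?_)
  rw [mul_pow, ← ENNReal.rpow_natCast, ← ENNReal.rpow_natCast, ← ENNReal.rpow_mul,
    ← ENNReal.rpow_mul]
  norm_num

lemma radial (k : ℕ) {h h' : ℝ → ℂ} (hd : ∀ r, HasDerivAt h (h' r) r) (hc : Continuous h')
    (r : ℝ) (hr : 0 < r) :
    ENNReal.ofReal ((1 + r) * r ^ (k+1)) * ‖h r‖ₑ ^ 2 ≤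
      ∫⁻ s in Set.Ioi (0:ℝ), ENNReal.ofReal (s ^ (k+2)) * (2 * ‖h s‖ₑ ^ 2 + 4 * ‖h' s‖ₑ ^ 2) := by
  have hch : Continuous h := continuous_iff_continuousAt.2 fun x => (hd x).continuousAt
  set W := ENNReal.ofReal ((1 + r) * r ^ (k+1)) with hW
  set J := ∫⁻ s in Set.Icc r (r+2), ‖h' s‖ₑ with hJ
  set I' := ∫⁻ s in Set.Icc r (r+2), ENNReal.ofReal (s ^ (k+2)) * ‖h' s‖ₑ ^ 2 with hI'
  have hm' : Measurable fun s => ‖h' s‖ₑ := hc.measurable.enorm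
  have hmh : Measurable fun s => ‖h s‖ₑ := hch.measurable.enorm
  have hWJ : W * J ^ 2 ≤ 2 * I' := by
    have h1 : J = ∫⁻ s in Set.Icc r (r+2), ENNReal.ofReal (Real.sqrt ((s ^ (k+2))⁻¹)) *
        (ENNReal.ofReal (Real.sqrt (s ^ (k+2))) * ‖h' s‖ₑ) := by
      refine setLIntegral_congr_fun measurableSet_Icc (fun s hs => ?_)
      have : 0 < s := lt_of_lt_of_le hr hs.1
      rw [← mul_assoc, ← ENNReal.ofReal_mul (by positivity), ← Real.sqrt_mul (by positivity),
        inv_mul_cancel₀ (by positivity)]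
      simp
    have h2 : J ^ 2 ≤ (∫⁻ s in Set.Icc r (r+2), ENNReal.ofReal ((s ^ (k+2))⁻¹)) * I' := by
      rw [h1]
      refine (cs_aux _ (by fun_prop) (by fun_prop)).trans (le_of_eq ?_)
      congr 1
      · refine setLIntegral_congr_fun measurableSet_Icc (fun s hs => ?_)
        have : 0 < s := lt_of_lt_of_le hr hs.1
        rw [← ENNReal.ofReal_pow (by positivity), Real.sq_sqrt (by positivity)]
      · refine setLIntegral_congr_fun measurableSet_Icc (fun s hs => ?_)
        have : 0 < s := lt_of_lt_of_le hr hs.1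
        rw [mul_pow, ← ENNReal.ofReal_pow (by positivity), Real.sq_sqrt (by positivity)]
    have h3 : W * (∫⁻ s in Set.Icc r (r+2), ENNReal.ofReal ((s ^ (k+2))⁻¹)) ≤ 2 := by
      calc W * (∫⁻ s in Set.Icc r (r+2), ENNReal.ofReal ((s ^ (k+2))⁻¹))
          = ∫⁻ s in Set.Icc r (r+2), W * ENNReal.ofReal ((s ^ (k+2))⁻¹) :=
            (lintegral_const_mul' _ _ ENNReal.ofReal_ne_top).symm
        _ ≤ ∫⁻ s in Set.Icc r (r+2), ENNReal.ofReal ((1 + r) * r) * ENNReal.ofReal ((s ^ 2)⁻¹) := by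
            refine setLIntegral_mono' measurableSet_Icc (fun s hs => ?_)
            have hs0 : 0 < s := lt_of_lt_of_le hr hs.1
            rw [hW, ← ENNReal.ofReal_mul (by positivity), ← ENNReal.ofReal_mul (by positivity)]
            refine ENNReal.ofReal_le_ofReal ?_
            have hk : r ^ k ≤ s ^ k := pow_le_pow_left₀ hr.le hs.1 k
            rw [← div_eq_mul_inv, ← div_eq_mul_inv, div_le_div_iff₀ (by positivity) (by positivity)]
            have : (1 + r) * r * s ^ 2 * r ^ k ≤ (1 + r) * r * s ^ 2 * s ^ k := by gcongr
            calc _ = (1 + r) * r * s ^ 2 * r ^ k := by ring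
              _ ≤ _ := this
              _ = _ := by ring
        _ = ENNReal.ofReal ((1 + r) * r) * ENNReal.ofReal (2 / (r * (r+2))) := by
            rw [lintegral_const_mul' _ _ ENNReal.ofReal_ne_top, inv_sq_int r hr]
        _ ≤ 2 := by
            rw [← ENNReal.ofReal_mul (by positivity)]
            refine ENNReal.ofReal_le_of_le_toReal ?_
            rw [mul_div_assoc', div_le_iff₀ (by positivity)]
            simp
            nlinarith
    calc W * J ^ 2 ≤ W * ((∫⁻ s in Set.Icc r (r+2), ENNReal.ofReal ((s ^ (k+2))⁻¹)) * I') := by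
          gcongr
      _ = (W * (∫⁻ s in Set.Icc r (r+2), ENNReal.ofReal ((s ^ (k+2))⁻¹))) * I' := by ring
      _ ≤ 2 * I' := by gcongr
  have hpt : ∀ s ∈ Set.Icc (r+1) (r+2), W * ‖h r‖ₑ ^ 2 ≤
      2 * (ENNReal.ofReal (s ^ (k+2)) * ‖h s‖ₑ ^ 2) + 4 * I' := by
    intro s hs
    have hrs : r ≤ s := by linarith [hs.1]
    have h1 : ‖h r‖ₑ ≤ ‖h s‖ₑ + J := by
      have e : h r = h s - ∫ x in r..s, h' x := by
        rw [intervalIntegral.integral_eq_sub_of_hasDerivAt (fun x _ => hd x)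
          (hc.intervalIntegrable _ _)]
        ring
      rw [e]
      refine (enorm_sub_le).trans ?_
      gcongr
      rw [intervalIntegral.integral_of_le hrs]
      refine (enorm_integral_le_lintegral_enorm _).trans ?_
      exact lintegral_mono_set (fun x hx => ⟨hx.1.le, hx.2.trans hs.2⟩)
    have h2 : ‖h r‖ₑ ^ 2 ≤ 2 * ‖h s‖ₑ ^ 2 + 2 * J ^ 2 := by
      refine (pow_le_pow_left' h1 2).trans ?_
      have := ENNReal.rpow_add_le_mul_rpow_add_rpow ‖h s‖ₑ J (p := 2) (by norm_num)
      norm_num at this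
      rw [← mul_add]
      exact this
    have hWs : W ≤ ENNReal.ofReal (s ^ (k+2)) := by
      refine ENNReal.ofReal_le_ofReal ?_
      calc (1 + r) * r ^ (k+1) ≤ s * s ^ (k+1) := by
            have : 1 + r ≤ s := by linarith [hs.1]
            have : 0 ≤ s := by linarith
            gcongr
        _ = _ := by ring
    calc W * ‖h r‖ₑ ^ 2 ≤ W * (2 * ‖h s‖ₑ ^ 2 + 2 * J ^ 2) := by gcongr
      _ = 2 * (W * ‖h s‖ₑ ^ 2) + 2 * (W * J ^ 2) := by ring
      _ ≤ 2 * (ENNReal.ofReal (s ^ (k+2)) * ‖h s‖ₑ ^ 2) + 2 * (2 * I') := by gcongr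
      _ = _ := by ring
  have hmA : Measurable fun s : ℝ => ENNReal.ofReal (s ^ (k+2)) * ‖h s‖ₑ ^ 2 := by fun_prop
  have hmB : Measurable fun s : ℝ => ENNReal.ofReal (s ^ (k+2)) * ‖h' s‖ₑ ^ 2 := by fun_prop
  have hbound_int : W * ‖h r‖ₑ ^ 2 ≤
      2 * (∫⁻ s in Set.Icc (r+1) (r+2), ENNReal.ofReal (s ^ (k+2)) * ‖h s‖ₑ ^ 2) + 4 * I' := by
    have h1 := setLIntegral_mono' (μ := volume) measurableSet_Icc hpt
    rw [lintegral_add_right _ measurable_const, lintegral_const_mul _ hmA] at h1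
    simpa [show r + 2 - (r + 1) = 1 by ring] using h1
  refine hbound_int.trans ?_
  have e1 : (∫⁻ s in Set.Icc (r+1) (r+2), ENNReal.ofReal (s ^ (k+2)) * ‖h s‖ₑ ^ 2) ≤
      ∫⁻ s in Set.Ioi (0:ℝ), ENNReal.ofReal (s ^ (k+2)) * ‖h s‖ₑ ^ 2 :=
    lintegral_mono_set fun x hx => by have := hx.1; simp; linarith
  have e2 : I' ≤ ∫⁻ s in Set.Ioi (0:ℝ), ENNReal.ofReal (s ^ (k+2)) * ‖h' s‖ₑ ^ 2 :=
    lintegral_mono_set fun x hx => by have := hx.1; simp; linarith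
  have e3 : ∫⁻ s in Set.Ioi (0:ℝ), ENNReal.ofReal (s ^ (k+2)) * (2 * ‖h s‖ₑ ^ 2 + 4 * ‖h' s‖ₑ ^ 2)
      = 2 * (∫⁻ s in Set.Ioi (0:ℝ), ENNReal.ofReal (s ^ (k+2)) * ‖h s‖ₑ ^ 2) +
        4 * ∫⁻ s in Set.Ioi (0:ℝ), ENNReal.ofReal (s ^ (k+2)) * ‖h' s‖ₑ ^ 2 := by
    rw [← lintegral_const_mul _ hmA, ← lintegral_const_mul _ hmB, ← lintegral_add_left (by fun_prop)]
    refine lintegral_congr fun s => ?_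
    ring
  rw [e3]
  gcongr

/-- Space-time Fourier transform. -/
def HH {n : ℕ} (g : ℝ × EuclideanSpace ℝ (Fin n) → ℂ) (τ : ℝ) (ξ : EuclideanSpace ℝ (Fin n)) : ℂ :=
  ∫ z : ℝ × EuclideanSpace ℝ (Fin n), Complex.exp (-(Complex.I * ((z.1 * τ + ⟪z.2, ξ⟫ : ℝ) : ℂ))) * g z

lemma norm_exp_negI (a : ℝ) : ‖Complex.exp (-(Complex.I * (a : ℂ)))‖ = 1 := by
  rw [Complex.norm_exp]; simp

lemma norm_exp_posI (a : ℝ) : ‖Complex.exp (Complex.I * (a : ℂ))‖ = 1 := by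
  rw [Complex.norm_exp]; simp

section HHsec
variable {n : ℕ}

lemma HH_integrand {g : ℝ × EuclideanSpace ℝ (Fin n) → ℂ} (hg : Integrable g) (τ : ℝ)
    (ξ : EuclideanSpace ℝ (Fin n)) :
    Integrable fun z : ℝ × EuclideanSpace ℝ (Fin n) =>
      Complex.exp (-(Complex.I * ((z.1 * τ + ⟪z.2, ξ⟫ : ℝ) : ℂ))) * g z := by
  refine hg.bdd_mul (c := 1) (Continuous.aestronglyMeasurable (by fun_prop)) ?_
  exact Filter.Eventually.of_forall fun z => (norm_exp_negI _).le

lemma HH_cont {g : ℝ × EuclideanSpace ℝ (Fin n) → ℂ} (hg : Integrable g) :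
    Continuous fun q : ℝ × EuclideanSpace ℝ (Fin n) => HH g q.1 q.2 := by
  refine continuous_of_dominated (bound := fun z => ‖g z‖) ?_ ?_ hg.norm ?_
  · intro q; exact (HH_integrand hg _ _).aestronglyMeasurable
  · intro q
    exact Filter.Eventually.of_forall fun z => by rw [norm_mul, norm_exp_negI, one_mul]
  · exact Filter.Eventually.of_forall fun z => by fun_prop

lemma HH_planch {g : ℝ × EuclideanSpace ℝ (Fin n) → ℂ} (hg : Integrable g) (hgm : StronglyMeasurable g) :
    ∫⁻ τ, ∫⁻ ξ, ‖HH g τ ξ‖ₑ ^ 2 ≤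
      ENNReal.ofReal ((2 * Real.pi) ^ (n + 1)) * ∫⁻ z, ‖g z‖ₑ ^ 2 := by
  have hH : Measurable fun q : ℝ × EuclideanSpace ℝ (Fin n) => ‖HH g q.1 q.2‖ₑ ^ 2 :=
    ((HH_cont hg).measurable.enorm).pow_const 2
  set a : ℝ → EuclideanSpace ℝ (Fin n) → ℂ := fun t ξ => FTV (fun x => g (t, x)) ξ with ha
  have ham : StronglyMeasurable fun q : ℝ × EuclideanSpace ℝ (Fin n) => a q.1 q.2 := by
    have : StronglyMeasurable fun q : (ℝ × EuclideanSpace ℝ (Fin n)) × EuclideanSpace ℝ (Fin n) =>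
        Complex.exp (-(Complex.I * (⟪q.2, q.1.2⟫ : ℝ))) * g (q.1.1, q.2) := by
      refine StronglyMeasurable.mul ?_ ?_
      · exact Continuous.stronglyMeasurable (by fun_prop)
      · exact hgm.comp_measurable (by fun_prop)
    exact this.integral_prod_right
  have hI : ∀ ξ : EuclideanSpace ℝ (Fin n), Integrable fun z : ℝ × EuclideanSpace ℝ (Fin n) =>
      Complex.exp (-(Complex.I * (⟪z.2, ξ⟫ : ℝ))) * g z := fun ξ => by
    refine hg.bdd_mul (c := 1) (Continuous.aestronglyMeasurable (by fun_prop)) ?_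
    exact Filter.Eventually.of_forall fun z => (norm_exp_negI _).le
  have hta : ∀ ξ, Integrable fun t => a t ξ := fun ξ => (hI ξ).integral_prod_left
  have hHa : ∀ τ ξ, HH g τ ξ = FTV (fun t => a t ξ) τ := by
    intro τ ξ
    rw [HH, FTV]
    have := integral_prod _ (HH_integrand hg τ ξ)
    rw [Measure.volume_eq_prod, this]
    refine integral_congr_ae (Filter.Eventually.of_forall fun t => ?_)
    simp only [ha, FTV]
    rw [← integral_const_mul]
    refine integral_congr_ae (Filter.Eventually.of_forall fun x => ?_)
    dsimp only
    rw [← mul_assoc, ← Complex.exp_add]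
    congr 2
    simp
    ring
  have hm2 : Measurable fun q : EuclideanSpace ℝ (Fin n) × ℝ => ‖a q.2 q.1‖ₑ ^ 2 :=
    ((ham.comp_measurable measurable_swap).measurable.enorm).pow_const 2
  rw [lintegral_lintegral_swap hH.aemeasurable]
  calc ∫⁻ ξ, ∫⁻ τ, ‖HH g τ ξ‖ₑ ^ 2
      ≤ ∫⁻ ξ, ENNReal.ofReal ((2 * Real.pi) ^ 1) * ∫⁻ t, ‖a t ξ‖ₑ ^ 2 := by
        refine lintegral_mono fun ξ => ?_
        simp_rw [hHa]
        have := planch (hta ξ)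
        simpa using this
    _ = ENNReal.ofReal ((2 * Real.pi) ^ 1) * ∫⁻ ξ, ∫⁻ t, ‖a t ξ‖ₑ ^ 2 :=
        lintegral_const_mul' _ _ ENNReal.ofReal_ne_top
    _ = ENNReal.ofReal ((2 * Real.pi) ^ 1) * ∫⁻ t, ∫⁻ ξ, ‖a t ξ‖ₑ ^ 2 := by
        rw [lintegral_lintegral_swap hm2.aemeasurable]
    _ ≤ ENNReal.ofReal ((2 * Real.pi) ^ 1) * ∫⁻ t, ENNReal.ofReal ((2 * Real.pi) ^ n) *
          ∫⁻ x, ‖g (t, x)‖ₑ ^ 2 := by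
        refine mul_le_mul_right (lintegral_mono_ae ?_) _
        have hg' : Integrable g (volume.prod volume) := hg
        filter_upwards [hg'.prod_right_ae] with t ht
        have := planch ht
        simpa using this
    _ = _ := by
        rw [lintegral_const_mul' _ _ ENNReal.ofReal_ne_top, ← mul_assoc,
          ← ENNReal.ofReal_mul (by positivity), Measure.volume_eq_prod,
          lintegral_prod _ (hgm.measurable.enorm.pow_const 2).aemeasurable]
        congr 2
        ring

lemma HH_deriv {g : ℝ × EuclideanSpace ℝ (Fin n) → ℂ} (hg : Integrable g)
    (hg1 : Integrable fun z => (‖z.2‖ : ℂ) * g z)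
    (τ : ℝ) (ω : EuclideanSpace ℝ (Fin n)) (r : ℝ) :
    HasDerivAt (fun r : ℝ => HH g τ (r • ω))
      (HH (fun z => -Complex.I * (⟪z.2, ω⟫ : ℝ) * g z) τ (r • ω)) r := by
  have h := hasDerivAt_integral_of_dominated_loc_of_deriv_le (μ := volume) (𝕜 := ℝ)
    (F := fun (r : ℝ) (z : ℝ × EuclideanSpace ℝ (Fin n)) =>
      Complex.exp (-(Complex.I * ((z.1 * τ + ⟪z.2, r • ω⟫ : ℝ) : ℂ))) * g z)
    (F' := fun (r : ℝ) (z : ℝ × EuclideanSpace ℝ (Fin n)) =>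
      Complex.exp (-(Complex.I * ((z.1 * τ + ⟪z.2, r • ω⟫ : ℝ) : ℂ))) *
        (-Complex.I * (⟪z.2, ω⟫ : ℝ) * g z))
    (x₀ := r) (s := Set.univ) (bound := fun z => ‖ω‖ * ‖(‖z.2‖ : ℂ) * g z‖)
    Filter.univ_mem ?_ (HH_integrand hg _ _) ?_ ?_ (hg1.norm.const_mul _) ?_
  · exact h.2
  · exact Filter.Eventually.of_forall fun r => (HH_integrand hg _ _).aestronglyMeasurable
  · refine AEStronglyMeasurable.mul (Continuous.aestronglyMeasurable (by fun_prop)) ?_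
    exact AEStronglyMeasurable.mul (Continuous.aestronglyMeasurable (by fun_prop))
      hg.aestronglyMeasurable
  · refine Filter.Eventually.of_forall fun z x _ => ?_
    rw [norm_mul, norm_exp_negI, one_mul, norm_mul, norm_mul, norm_mul, ← mul_assoc]
    refine mul_le_mul_of_nonneg_right ?_ (norm_nonneg _)
    rw [norm_neg, Complex.norm_I, one_mul, Complex.norm_real, Complex.norm_real, norm_norm, mul_comm]
    exact norm_inner_le_norm _ _
  · refine Filter.Eventually.of_forall fun z x _ => ?_
    have h1 : HasDerivAt (fun x : ℝ => ((z.1 * τ + ⟪z.2, x • ω⟫ : ℝ) : ℂ)) ((⟪z.2, ω⟫ : ℝ) : ℂ) x := by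
      refine HasDerivAt.ofReal_comp ?_
      simp_rw [inner_smul_right]
      have := ((hasDerivAt_id x).mul_const (⟪z.2, ω⟫ : ℝ)).const_add (z.1 * τ)
      simpa using this
    have h2 := (((h1.const_mul Complex.I).neg).cexp).mul_const (g z)
    refine h2.congr_deriv ?_
    simp only [Pi.neg_apply]
    ring

lemma HH_deriv_bound {g : ℝ × EuclideanSpace ℝ (Fin n) → ℂ} 
    (hgj : ∀ j, Integrable fun z => ((z.2 j : ℝ) : ℂ) * g z)
    (τ : ℝ) (ω ξ : EuclideanSpace ℝ (Fin n)) (hω : ‖ω‖ = 1) :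
    ‖HH (fun z => -Complex.I * (⟪z.2, ω⟫ : ℝ) * g z) τ ξ‖ₑ ^ 2 ≤
      n * ∑ j, ‖HH (fun z => ((z.2 j : ℝ) : ℂ) * g z) τ ξ‖ₑ ^ 2 := by
  have e : HH (fun z => -Complex.I * (⟪z.2, ω⟫ : ℝ) * g z) τ ξ =
      ∑ j, (-Complex.I * (ω j : ℝ)) * HH (fun z => ((z.2 j : ℝ) : ℂ) * g z) τ ξ := by
    simp only [HH]
    simp_rw [← integral_const_mul]
    rw [← integral_finsetSum]
    · refine integral_congr_ae (Filter.Eventually.of_forall fun z => ?_)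
      dsimp only
      rw [PiLp.inner_apply z.2 ω, Complex.ofReal_sum]
      rw [Finset.mul_sum, Finset.sum_mul, Finset.mul_sum]
      refine Finset.sum_congr rfl fun j _ => ?_
      simp
      ring
    · intro j _
      exact (HH_integrand (hgj j) τ ξ).const_mul _
  have e2 : ‖HH (fun z => -Complex.I * (⟪z.2, ω⟫ : ℝ) * g z) τ ξ‖ₑ ≤
      ∑ j, ‖HH (fun z => ((z.2 j : ℝ) : ℂ) * g z) τ ξ‖ₑ := by
    rw [e]
    refine (enorm_sum_le _ _).trans (Finset.sum_le_sum fun j _ => ?_)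
    rw [enorm_mul]
    refine mul_le_of_le_one_left' ?_
    rw [← ofReal_norm, ENNReal.ofReal_le_one, norm_mul, norm_neg, Complex.norm_I, one_mul,
      Complex.norm_real]
    exact (PiLp.norm_apply_le ω j).trans hω.le
  refine (pow_le_pow_left' e2 2).trans ?_
  have h3 := ENNReal.rpow_sum_le_const_mul_sum_rpow Finset.univ
    (fun j : Fin n => ‖HH (fun z => ((z.2 j : ℝ) : ℂ) * g z) τ ξ‖ₑ) (p := 2) (by norm_num)
  norm_num at h3
  exact h3
end HHsec
/-- The majorant density. -/
def DD {n : ℕ} (g : ℝ × EuclideanSpace ℝ (Fin n) → ℂ) (τ : ℝ) (ξ : EuclideanSpace ℝ (Fin n)) : ℝ≥0∞ :=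
  2 * ‖HH g τ ξ‖ₑ ^ 2 + 4 * (n * ∑ j, ‖HH (fun z => ((z.2 j : ℝ) : ℂ) * g z) τ ξ‖ₑ ^ 2)

lemma DD_meas {n : ℕ} {g : ℝ × EuclideanSpace ℝ (Fin n) → ℂ} (hg : Integrable g)
    (hgj : ∀ j, Integrable fun z => ((z.2 j : ℝ) : ℂ) * g z) :
    Measurable fun q : ℝ × EuclideanSpace ℝ (Fin n) => DD g q.1 q.2 := by
  have h1 := (HH_cont hg).measurable
  have h2 := fun j => (HH_cont (hgj j)).measurable
  unfold DD
  fun_prop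

set_option maxHeartbeats 800000 in
lemma main_est (k : ℕ) {p : EuclideanSpace ℝ (Fin (k+3)) → ℝ} (hpm : Measurable p)
    (hp_hom : ∀ lam : ℝ, 0 < lam → ∀ ξ, ξ ≠ 0 → p (lam • ξ) = lam * p ξ)
    (c₀ : ℝ) (hc₀ : 0 < c₀) (hpc : ∀ ξ, ‖ξ‖ = 1 → c₀ ≤ p ξ)
    {g : ℝ × EuclideanSpace ℝ (Fin (k+3)) → ℂ} (hg : Integrable g)
    (hg1 : Integrable fun z => (‖z.2‖ : ℂ) * g z)
    (hgj : ∀ j, Integrable fun z => ((z.2 j : ℝ) : ℂ) * g z) :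
    ∫⁻ ξ, ENNReal.ofReal (1 + ‖ξ‖) * ‖HH g (p ξ ^ 2) ξ‖ₑ ^ 2 ≤
      ENNReal.ofReal (1 / (2 * c₀ ^ 2)) * ∫⁻ τ, ∫⁻ ξ, DD g τ ξ := by
  have hDm := DD_meas hg hgj
  have hHm := (HH_cont hg).measurable
  have hm : Measurable fun ξ => ENNReal.ofReal (1 + ‖ξ‖) * ‖HH g (p ξ ^ 2) ξ‖ₑ ^ 2 := by
    have : Measurable fun ξ => HH g (p ξ ^ 2) ξ :=
      hHm.comp (f := fun ξ : EuclideanSpace ℝ (Fin (k+3)) => (p ξ ^ 2, ξ)) (Measurable.prodMk (hpm.pow_const 2) measurable_id)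
    fun_prop
  set Q : ℝ → Metric.sphere (0 : EuclideanSpace ℝ (Fin (k+3))) 1 → ℝ≥0∞ := fun τ ω =>
    ∫⁻ s in Set.Ioi (0:ℝ), ENNReal.ofReal (s ^ (k+2)) * DD g τ (s • (ω : EuclideanSpace ℝ (Fin (k+3))))
    with hQ
  have hQm : Measurable fun q : Metric.sphere (0 : EuclideanSpace ℝ (Fin (k+3))) 1 × ℝ =>
      Q q.2 q.1 := by
    refine Measurable.lintegral_prod_right' (f := fun q : (Metric.sphere (0 : EuclideanSpace ℝ (Fin (k+3))) 1 × ℝ) × ℝ =>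
      ENNReal.ofReal (q.2 ^ (k+2)) * DD g q.1.2 (q.2 • (q.1.1 : EuclideanSpace ℝ (Fin (k+3))))) ?_
    refine Measurable.mul (by fun_prop) (hDm.comp (f := fun q : (Metric.sphere (0 : EuclideanSpace ℝ (Fin (k+3))) 1 × ℝ) × ℝ =>
      (q.1.2, q.2 • (q.1.1 : EuclideanSpace ℝ (Fin (k+3))))) (Measurable.prodMk (by fun_prop) ?_))
    refine Measurable.smul measurable_snd ?_
    exact measurable_subtype_coe.comp (measurable_fst.comp measurable_fst)
  have hfr : Module.finrank ℝ (EuclideanSpace ℝ (Fin (k+3))) - 1 = k + 2 := by simp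
  rw [polar hm, hfr]
  calc _ ≤ ∫⁻ ω, (ENNReal.ofReal (1 / (2 * c₀ ^ 2)) * ∫⁻ τ, Q τ ω) ∂((volume : Measure (EuclideanSpace ℝ (Fin (k+3)))).toSphere) := by
        refine lintegral_mono fun ω => ?_
        have hω : ‖(ω : EuclideanSpace ℝ (Fin (k+3)))‖ = 1 := by simpa using ω.2
        have hω0 : (ω : EuclideanSpace ℝ (Fin (k+3))) ≠ 0 := by
          intro h; rw [h] at hω; simp at hω
        have hpω : c₀ ≤ p ω := hpc _ hω
        have hpω0 : 0 < p ω := lt_of_lt_of_le hc₀ hpω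
        calc _ ≤ ∫⁻ r in Set.Ioi (0:ℝ), ENNReal.ofReal r * Q (r ^ 2 * p ω ^ 2) ω := by
              refine setLIntegral_mono' measurableSet_Ioi fun r hr => ?_
              have hr : 0 < r := hr
              rw [hp_hom r hr _ hω0, norm_smul, hω, mul_one, Real.norm_of_nonneg hr.le, mul_pow]
              set τ := r ^ 2 * p ω ^ 2 with hτ
              have hrad := radial k (h := fun r : ℝ => HH g τ (r • (ω : EuclideanSpace ℝ (Fin (k+3)))))
                (fun r => HH_deriv hg hg1 τ ω r)
                (by
                  have hgi : Integrable (fun z : ℝ × EuclideanSpace ℝ (Fin (k+3)) =>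
                      -Complex.I * (⟪z.2, (ω : EuclideanSpace ℝ (Fin (k+3)))⟫ : ℝ) * g z) := by
                    refine hg1.mono ?_ (Filter.Eventually.of_forall fun z => ?_)
                    · exact AEStronglyMeasurable.mul
                        (Continuous.aestronglyMeasurable (by fun_prop)) hg.aestronglyMeasurable
                    · rw [norm_mul, norm_mul, norm_mul, norm_neg, Complex.norm_I, one_mul,
                        Complex.norm_real, Complex.norm_real, norm_norm]
                      gcongr
                      have := norm_inner_le_norm (𝕜 := ℝ) z.2 (ω : EuclideanSpace ℝ (Fin (k+3)))
                      rwa [hω, mul_one] at this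
                  exact (HH_cont hgi).comp (f := fun r : ℝ => (τ, r • (ω : EuclideanSpace ℝ (Fin (k+3)))))
                    (by fun_prop)) r hr
              calc _ = ENNReal.ofReal r * (ENNReal.ofReal ((1 + r) * r ^ (k+1)) *
                    ‖HH g τ (r • (ω : EuclideanSpace ℝ (Fin (k+3))))‖ₑ ^ 2) := by
                    rw [← mul_assoc, ← mul_assoc, ← ENNReal.ofReal_mul (by positivity),
                      ← ENNReal.ofReal_mul (by positivity)]
                    congr 2
                    ring
                _ ≤ _ := by
                    refine mul_le_mul_right (hrad.trans ?_) _
                    refine lintegral_mono fun s => ?_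
                    refine mul_le_mul_right ?_ _
                    unfold DD
                    refine add_le_add_right (mul_le_mul_right ?_ _) _
                    exact HH_deriv_bound hgj τ ω _ hω
          _ ≤ ENNReal.ofReal (1 / (2 * p ω ^ 2)) * ∫⁻ τ, Q τ ω :=
              cv_aux (p ω ^ 2) (by positivity) (fun τ => Q τ ω)
          _ ≤ _ := by
              gcongr
    _ = ENNReal.ofReal (1 / (2 * c₀ ^ 2)) * ∫⁻ ω, (∫⁻ τ, Q τ ω) ∂((volume : Measure (EuclideanSpace ℝ (Fin (k+3)))).toSphere) :=
        lintegral_const_mul' _ _ ENNReal.ofReal_ne_top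
    _ = ENNReal.ofReal (1 / (2 * c₀ ^ 2)) * ∫⁻ τ, (∫⁻ ω, Q τ ω ∂((volume : Measure (EuclideanSpace ℝ (Fin (k+3)))).toSphere)) := by
        rw [lintegral_lintegral_swap hQm.aemeasurable]
    _ = _ := by
        congr 1
        refine lintegral_congr fun τ => ?_
        have hDτ : Measurable fun ξ => DD g τ ξ :=
          hDm.comp (f := fun ξ : EuclideanSpace ℝ (Fin (k+3)) => (τ, ξ)) measurable_prodMk_left
        rw [polar hDτ, hfr]

lemma main_est2 (k : ℕ) {p : EuclideanSpace ℝ (Fin (k+3)) → ℝ} (hpm : Measurable p)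
    (hp_hom : ∀ lam : ℝ, 0 < lam → ∀ ξ, ξ ≠ 0 → p (lam • ξ) = lam * p ξ)
    (c₀ : ℝ) (hc₀ : 0 < c₀) (hpc : ∀ ξ, ‖ξ‖ = 1 → c₀ ≤ p ξ) :
    ∃ A : ℝ≥0∞, A ≠ ⊤ ∧ ∀ (G : ℝ × EuclideanSpace ℝ (Fin (k+3)) → ℂ), StronglyMeasurable G →
      Integrable G →
      ∫⁻ ξ, ENNReal.ofReal (1 + ‖ξ‖) * ‖HH (fun z => (((jap z.2)⁻¹ : ℝ) : ℂ) * G z) (p ξ ^ 2) ξ‖ₑ ^ 2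
        ≤ A * ∫⁻ z, ‖G z‖ₑ ^ 2 := by
  set c := ENNReal.ofReal ((2 * Real.pi) ^ (k + 3 + 1)) with hc
  set B := ENNReal.ofReal (1 / (2 * c₀ ^ 2)) with hB
  refine ⟨B * (2 * c + 4 * ((k + 3 : ℕ) * ((k + 3 : ℕ) * c))), ?_, ?_⟩
  · finiteness
  intro G hGm hGi
  have hjc : Continuous fun x : EuclideanSpace ℝ (Fin (k+3)) => (jap x)⁻¹ := by
    unfold jap
    refine Continuous.inv₀ (by fun_prop) fun x => ?_
    positivity
  have hj0 : ∀ x : EuclideanSpace ℝ (Fin (k+3)), 0 < jap x := fun x => by unfold jap; positivity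
  have hj1 : ∀ x : EuclideanSpace ℝ (Fin (k+3)), (jap x)⁻¹ ≤ 1 := fun x => by
    refine inv_le_one_of_one_le₀ ?_
    unfold jap
    rw [Real.one_le_sqrt]
    nlinarith [sq_nonneg ‖x‖]
  have hj2 : ∀ x : EuclideanSpace ℝ (Fin (k+3)), ‖x‖ * (jap x)⁻¹ ≤ 1 := fun x => by
    rw [← div_eq_mul_inv, div_le_one (hj0 x)]
    unfold jap
    refine Real.le_sqrt_of_sq_le ?_
    linarith
  have bd : ∀ (a : EuclideanSpace ℝ (Fin (k+3)) → ℝ), Continuous a → (∀ x, |a x| ≤ 1) →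
      (Integrable (fun z : ℝ × EuclideanSpace ℝ (Fin (k+3)) => ((a z.2 : ℝ) : ℂ) * G z) ∧
      StronglyMeasurable (fun z : ℝ × EuclideanSpace ℝ (Fin (k+3)) => ((a z.2 : ℝ) : ℂ) * G z) ∧
      ∫⁻ z : ℝ × EuclideanSpace ℝ (Fin (k+3)), ‖((a z.2 : ℝ) : ℂ) * G z‖ₑ ^ 2 ≤ ∫⁻ z, ‖G z‖ₑ ^ 2) := by
    intro a ha ha1
    have hca : Continuous fun z : ℝ × EuclideanSpace ℝ (Fin (k+3)) => ((a z.2 : ℝ) : ℂ) := by fun_prop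
    refine ⟨?_, hca.stronglyMeasurable.mul hGm, ?_⟩
    · refine hGi.bdd_mul (c := 1) hca.aestronglyMeasurable ?_
      exact Filter.Eventually.of_forall fun z => by rw [Complex.norm_real]; exact ha1 _
    · refine lintegral_mono fun z => ?_
      refine pow_le_pow_left' ?_ 2
      rw [enorm_mul]
      refine mul_le_of_le_one_left' ?_
      rw [← ofReal_norm, ENNReal.ofReal_le_one, Complex.norm_real]
      exact ha1 _
  set g : ℝ × EuclideanSpace ℝ (Fin (k+3)) → ℂ := fun z => (((jap z.2)⁻¹ : ℝ) : ℂ) * G z with hgdef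
  obtain ⟨i0, m0, l0⟩ := bd (fun x => (jap x)⁻¹) hjc
    (fun x => by rw [abs_of_pos (inv_pos.2 (hj0 x))]; exact hj1 x)
  obtain ⟨i1, m1, l1⟩ := bd (fun x => ‖x‖ * (jap x)⁻¹) (by fun_prop)
    (fun x => by rw [abs_of_nonneg (mul_nonneg (norm_nonneg _) (inv_pos.2 (hj0 x)).le)]; exact hj2 x)
  have hj := fun j => bd (fun x => x j * (jap x)⁻¹) (by fun_prop)
    (fun x => by
      rw [abs_mul, abs_of_pos (inv_pos.2 (hj0 x))]
      refine le_trans ?_ (hj2 x)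
      refine mul_le_mul_of_nonneg_right ?_ (inv_pos.2 (hj0 x)).le
      exact PiLp.norm_apply_le x j)
  have ej : ∀ j, (fun z : ℝ × EuclideanSpace ℝ (Fin (k+3)) => ((z.2 j * (jap z.2)⁻¹ : ℝ) : ℂ) * G z)
      = fun z => ((z.2 j : ℝ) : ℂ) * g z := fun j => by
    funext z; rw [hgdef]; push_cast; ring
  have e1 : (fun z : ℝ × EuclideanSpace ℝ (Fin (k+3)) => ((‖z.2‖ * (jap z.2)⁻¹ : ℝ) : ℂ) * G z)
      = fun z => ((‖z.2‖ : ℝ) : ℂ) * g z := by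
    funext z; rw [hgdef]; push_cast; ring
  have ij : ∀ j, Integrable (fun z => ((z.2 j : ℝ) : ℂ) * g z) := fun j => by
    rw [← ej]; exact (hj j).1
  have mj : ∀ j, StronglyMeasurable (fun z => ((z.2 j : ℝ) : ℂ) * g z) := fun j => by
    rw [← ej]; exact (hj j).2.1
  have lj : ∀ j, ∫⁻ z, ‖((z.2 j : ℝ) : ℂ) * g z‖ₑ ^ 2 ≤ ∫⁻ z, ‖G z‖ₑ ^ 2 := fun j => by
    have := (hj j).2.2
    refine le_trans (le_of_eq (lintegral_congr fun z => ?_)) this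
    rw [← congrFun (ej j) z]
  refine (main_est k hpm hp_hom c₀ hc₀ hpc i0 (by rw [← e1]; exact i1) ij).trans ?_
  rw [mul_assoc]
  refine mul_le_mul_right ?_ _
  set S := ∫⁻ z, ‖G z‖ₑ ^ 2 with hS
  have P0 : ∫⁻ τ, ∫⁻ ξ, ‖HH g τ ξ‖ₑ ^ 2 ≤ c * S :=
    (HH_planch i0 m0).trans (mul_le_mul_right l0 _)
  have Pj : ∀ j, ∫⁻ τ, ∫⁻ ξ, ‖HH (fun z => ((z.2 j : ℝ) : ℂ) * g z) τ ξ‖ₑ ^ 2 ≤ c * S := fun j =>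
    (HH_planch (ij j) (mj j)).trans (mul_le_mul_right (lj j) _)
  have hm0 : Measurable fun q : ℝ × EuclideanSpace ℝ (Fin (k+3)) => ‖HH g q.1 q.2‖ₑ ^ 2 :=
    (HH_cont i0).measurable.enorm.pow_const 2
  have hmj : ∀ j, Measurable fun q : ℝ × EuclideanSpace ℝ (Fin (k+3)) =>
      ‖HH (fun z => ((z.2 j : ℝ) : ℂ) * g z) q.1 q.2‖ₑ ^ 2 := fun j =>
    (HH_cont (ij j)).measurable.enorm.pow_const 2
  have hDm := DD_meas i0 ij
  have conv : ∀ F : ℝ × EuclideanSpace ℝ (Fin (k+3)) → ℝ≥0∞, Measurable F →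
      ∫⁻ τ, ∫⁻ ξ, F (τ, ξ) = ∫⁻ q, F q := fun F hF => by
    rw [Measure.volume_eq_prod, lintegral_prod _ hF.aemeasurable]
  rw [conv _ hDm]
  rw [conv _ hm0] at P0
  have Pj' := fun j => (conv _ (hmj j)) ▸ (Pj j)
  unfold DD
  rw [lintegral_add_left (hm0.const_mul _), lintegral_const_mul _ hm0, lintegral_const_mul',
    lintegral_const_mul', lintegral_finsetSum _ (fun j _ => hmj j)]
  · have hsum : ∑ j, ∫⁻ q : ℝ × EuclideanSpace ℝ (Fin (k+3)),
        ‖HH (fun z => ((z.2 j : ℝ) : ℂ) * g z) q.1 q.2‖ₑ ^ 2 ≤ (k + 3 : ℕ) * (c * S) := by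
      refine (Finset.sum_le_sum fun j _ => Pj' j).trans ?_
      simp
    calc _ ≤ 2 * (c * S) + 4 * ((k + 3 : ℕ) * ((k + 3 : ℕ) * (c * S))) := by gcongr
      _ = _ := by ring
  · finiteness
  · finiteness

lemma dual_est {n : ℕ} {p : EuclideanSpace ℝ (Fin n) → ℝ} (hpm : Measurable p)
    {A : ℝ≥0∞}
    (hA : ∀ (G : ℝ × EuclideanSpace ℝ (Fin n) → ℂ), StronglyMeasurable G → Integrable G →
      ∫⁻ ξ, ENNReal.ofReal (1 + ‖ξ‖) * ‖HH (fun z => (((jap z.2)⁻¹ : ℝ) : ℂ) * G z) (p ξ ^ 2) ξ‖ₑ ^ 2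
        ≤ A * ∫⁻ z, ‖G z‖ₑ ^ 2)
    (m : EuclideanSpace ℝ (Fin n) → ℝ) (hm : Measurable m) 
    (hm2 : ∀ ξ, m ξ ^ 2 ≤ 1 + ‖ξ‖) (v : EuclideanSpace ℝ (Fin n) → ℂ) (hv : Measurable v)
    (hmv : Integrable fun ξ => (m ξ : ℂ) * v ξ) (κ : ℂ)
    (F : ℝ × EuclideanSpace ℝ (Fin n) → ℂ)
    (hF : ∀ z, F z = (((jap z.2)⁻¹ : ℝ) : ℂ) * (κ * ∫ ξ, Complex.exp (Complex.I * (⟪z.2, ξ⟫ : ℝ)) *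
      ((m ξ : ℂ) * Complex.exp (Complex.I * ((z.1 * p ξ ^ 2 : ℝ) : ℂ)) * v ξ))) :
    ∫⁻ z, ‖F z‖ₑ ^ 2 ≤ ‖κ‖ₑ ^ 2 * (A * ∫⁻ ξ, ‖v ξ‖ₑ ^ 2) := by
  have hjc : Continuous fun x : EuclideanSpace ℝ (Fin n) => (jap x)⁻¹ := by
    unfold jap
    refine Continuous.inv₀ (by fun_prop) fun x => ?_
    positivity
  have hj1 : ∀ x : EuclideanSpace ℝ (Fin n), ‖(((jap x)⁻¹ : ℝ) : ℂ)‖ ≤ 1 := fun x => by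
    have h0 : 1 ≤ jap x := by
      unfold jap
      rw [Real.one_le_sqrt]
      nlinarith [sq_nonneg ‖x‖]
    rw [Complex.norm_real, Real.norm_of_nonneg (by positivity)]
    exact inv_le_one_of_one_le₀ h0
  have hinm : StronglyMeasurable fun q : (ℝ × EuclideanSpace ℝ (Fin n)) × EuclideanSpace ℝ (Fin n) =>
      Complex.exp (Complex.I * (⟪q.1.2, q.2⟫ : ℝ)) *
      ((m q.2 : ℂ) * Complex.exp (Complex.I * ((q.1.1 * p q.2 ^ 2 : ℝ) : ℂ)) * v q.2) := by
    refine Measurable.stronglyMeasurable ?_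
    refine Measurable.mul (Continuous.measurable (by fun_prop)) ?_
    fun_prop
  have hinn : ∀ (z : ℝ × EuclideanSpace ℝ (Fin n)) ξ, ‖Complex.exp (Complex.I * (⟪z.2, ξ⟫ : ℝ)) *
      ((m ξ : ℂ) * Complex.exp (Complex.I * ((z.1 * p ξ ^ 2 : ℝ) : ℂ)) * v ξ)‖ = ‖(m ξ : ℂ) * v ξ‖ := by
    intro z ξ
    rw [norm_mul, norm_exp_posI, one_mul, norm_mul, norm_mul, norm_exp_posI, mul_one, norm_mul]
  have hFm : StronglyMeasurable F := by
    have h1 : StronglyMeasurable fun z : ℝ × EuclideanSpace ℝ (Fin n) => (((jap z.2)⁻¹ : ℝ) : ℂ) :=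
      (Complex.continuous_ofReal.comp (hjc.comp continuous_snd)).stronglyMeasurable
    rw [funext hF]
    exact h1.mul (hinm.integral_prod_right.const_mul κ)
  have hFb : ∀ z, ‖F z‖ ≤ ‖κ‖ * ∫ ξ, ‖(m ξ : ℂ) * v ξ‖ := by
    intro z
    rw [hF, norm_mul, norm_mul]
    have h1 := norm_integral_le_integral_norm (μ := volume) (fun ξ => Complex.exp (Complex.I * (⟪z.2, ξ⟫ : ℝ)) *
      ((m ξ : ℂ) * Complex.exp (Complex.I * ((z.1 * p ξ ^ 2 : ℝ) : ℂ)) * v ξ))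
    simp_rw [hinn z] at h1
    have h2 := hj1 z.2
    calc _ ≤ 1 * (‖κ‖ * ∫ ξ, ‖(m ξ : ℂ) * v ξ‖) := by gcongr
      _ = _ := one_mul _
  refine lintegral_le_of_forall_fin_meas_le _ ?_
  intro B hB hBfin
  set G := B.indicator F with hG
  have hGm : StronglyMeasurable G := hFm.indicator hB
  have hGb : ∀ z, ‖G z‖ ≤ ‖κ‖ * ∫ ξ, ‖(m ξ : ℂ) * v ξ‖ := fun z =>
    (norm_indicator_le_norm_self _ _).trans (hFb z)
  have hGi : Integrable G := by
    rw [hG, integrable_indicator_iff hB]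
    exact Measure.integrableOn_of_bounded hBfin hFm.aestronglyMeasurable
      (Filter.Eventually.of_forall hFb)
  have hSeq : ∫⁻ z in B, ‖F z‖ₑ ^ 2 = ∫⁻ z, ‖G z‖ₑ ^ 2 := by
    rw [← lintegral_indicator hB]
    refine lintegral_congr fun z => ?_
    by_cases hz : z ∈ B <;> simp [hG, hz]
  rw [hSeq]
  set S := ∫⁻ z, ‖G z‖ₑ ^ 2 with hS
  have hG2i : Integrable fun z => ‖G z‖ ^ 2 := by
    have := hGi.norm.bdd_mul (f := fun z => ‖G z‖) hGm.norm.aestronglyMeasurable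
      (Filter.Eventually.of_forall fun z => (by rw [norm_norm]; exact hGb z))
    simpa [sq] using this
  have hS1 : S = ENNReal.ofReal (∫ z, ‖G z‖ ^ 2) := by
    rw [ofReal_integral_eq_lintegral_ofReal hG2i (Filter.Eventually.of_forall fun z => by positivity)]
    refine lintegral_congr fun z => ?_
    rw [ENNReal.ofReal_pow (norm_nonneg _), ofReal_norm]
  have hStop : S ≠ ⊤ := by rw [hS1]; exact ENNReal.ofReal_ne_top
  have hS2 : S = ‖∫ z, (starRingEnd ℂ) (G z) * F z‖ₑ := by
    have e1 : ∀ z, (starRingEnd ℂ) (G z) * F z = ((‖G z‖ ^ 2 : ℝ) : ℂ) := by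
      intro z
      by_cases hz : z ∈ B
      · simp only [hG, Set.indicator_of_mem hz]
        rw [mul_comm, Complex.mul_conj']; push_cast; rfl
      · simp [hG, hz]
    simp_rw [e1]
    rw [integral_complex_ofReal, ← ofReal_norm, Complex.norm_real, hS1,
      Real.norm_of_nonneg (integral_nonneg fun z => by positivity)]
  set g : ℝ × EuclideanSpace ℝ (Fin n) → ℂ := fun z => (((jap z.2)⁻¹ : ℝ) : ℂ) * G z with hgdef
  have hgi : Integrable g := by
    refine hGi.bdd_mul (c := 1) (Complex.continuous_ofReal.comp (hjc.comp continuous_snd)).aestronglyMeasurable ?_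
    exact Filter.Eventually.of_forall fun z => hj1 _
  -- Fubini
  set Φ : (ℝ × EuclideanSpace ℝ (Fin n)) → EuclideanSpace ℝ (Fin n) → ℂ := fun z ξ =>
    (starRingEnd ℂ) (g z) * (κ * (Complex.exp (Complex.I * (⟪z.2, ξ⟫ : ℝ)) *
      ((m ξ : ℂ) * Complex.exp (Complex.I * ((z.1 * p ξ ^ 2 : ℝ) : ℂ)) * v ξ))) with hΦ
  have hΦi : Integrable (Function.uncurry Φ) (volume.prod volume) := by
    have h1 := (hgi.mul_prod hmv).const_mul κ
    refine h1.mono ?_ (Filter.Eventually.of_forall fun q => ?_)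
    · refine AEStronglyMeasurable.mul ?_ (hinm.const_mul κ).aestronglyMeasurable
      have : AEStronglyMeasurable (fun q : (ℝ × EuclideanSpace ℝ (Fin n)) × EuclideanSpace ℝ (Fin n) => g q.1)
          (volume.prod volume) := hgi.aestronglyMeasurable.comp_fst
      exact Complex.continuous_conj.comp_aestronglyMeasurable this
    · simp only [Function.uncurry, hΦ]
      rw [norm_mul, norm_mul κ, hinn, norm_mul κ, norm_mul (g q.1), RCLike.norm_conj]
      exact le_of_eq (by ring)
  have hfub : ∫ z, (starRingEnd ℂ) (G z) * F z =
      ∫ ξ, κ * (((m ξ : ℂ) * v ξ) * (starRingEnd ℂ) (HH g (p ξ ^ 2) ξ)) := by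
    calc _ = ∫ z, ∫ ξ, Φ z ξ := by
          refine integral_congr_ae (Filter.Eventually.of_forall fun z => ?_)
          simp only [hΦ]
          rw [integral_const_mul, integral_const_mul, hF, hgdef]
          simp only [map_mul, Complex.conj_ofReal]
          ring
      _ = ∫ ξ, ∫ z, Φ z ξ := integral_integral_swap hΦi
      _ = _ := by
          refine integral_congr_ae (Filter.Eventually.of_forall fun ξ => ?_)
          simp only [HH]
          rw [← integral_conj, ← integral_const_mul, ← integral_const_mul]
          refine integral_congr_ae (Filter.Eventually.of_forall fun z => ?_)
          simp only [hΦ, map_mul, ← Complex.exp_conj, map_neg, Complex.conj_I, Complex.conj_ofReal]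
          have : Complex.exp (-(-Complex.I * ((z.1 * p ξ ^ 2 + ⟪z.2, ξ⟫ : ℝ) : ℂ))) =
              Complex.exp (Complex.I * (⟪z.2, ξ⟫ : ℝ)) *
                Complex.exp (Complex.I * ((z.1 * p ξ ^ 2 : ℝ) : ℂ)) := by
            rw [← Complex.exp_add]
            congr 1
            push_cast
            ring
          rw [this]
          ring
  have hHm : Measurable fun ξ => HH g (p ξ ^ 2) ξ :=
    (HH_cont hgi).measurable.comp (f := fun ξ : EuclideanSpace ℝ (Fin n) => (p ξ ^ 2, ξ))
      (Measurable.prodMk (hpm.pow_const 2) measurable_id)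
  have hS3 : S ^ 2 ≤ ‖κ‖ₑ ^ 2 * ((∫⁻ ξ, ‖v ξ‖ₑ ^ 2) * (A * S)) := by
    have h1 : S ≤ ‖κ‖ₑ * ∫⁻ ξ, ‖v ξ‖ₑ * (‖m ξ‖ₑ * ‖HH g (p ξ ^ 2) ξ‖ₑ) := by
      rw [hS2, hfub, integral_const_mul, enorm_mul]
      refine mul_le_mul_right ((enorm_integral_le_lintegral_enorm _).trans (le_of_eq ?_)) _
      refine lintegral_congr fun ξ => ?_
      rw [enorm_mul, enorm_mul, RCLike.enorm_conj]
      have : ‖(m ξ : ℂ)‖ₑ = ‖m ξ‖ₑ := by rw [← ofReal_norm, ← ofReal_norm, Complex.norm_real]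
      rw [this]
      ring
    have h2 := cs_aux volume (f := fun ξ => ‖v ξ‖ₑ) (g := fun ξ => ‖m ξ‖ₑ * ‖HH g (p ξ ^ 2) ξ‖ₑ)
      hv.enorm.aemeasurable (hm.enorm.mul hHm.enorm).aemeasurable
    have h3 : ∫⁻ ξ, (‖m ξ‖ₑ * ‖HH g (p ξ ^ 2) ξ‖ₑ) ^ 2 ≤ A * S := by
      refine le_trans (lintegral_mono fun ξ => ?_) (hA G hGm hGi)
      rw [mul_pow]
      refine mul_le_mul_left ?_ _
      rw [← ofReal_norm, ← ENNReal.ofReal_pow (norm_nonneg _)]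
      refine ENNReal.ofReal_le_ofReal ?_
      rw [Real.norm_eq_abs, sq_abs]
      exact hm2 ξ
    refine (pow_le_pow_left' h1 2).trans ?_
    rw [mul_pow]
    refine mul_le_mul_right (h2.trans (mul_le_mul_right h3 _)) _
  by_cases hS0 : S = 0
  · rw [hS0]; exact zero_le
  · have : S * S ≤ (‖κ‖ₑ ^ 2 * (A * ∫⁻ ξ, ‖v ξ‖ₑ ^ 2)) * S := by
      calc S * S = S ^ 2 := by ring
        _ ≤ _ := hS3
        _ = _ := by ring
    exact (ENNReal.mul_le_mul_iff_left hS0 hStop).1 this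

open FourierTransform in
lemma FTint_schwartz {n : ℕ} (f : 𝓢(EuclideanSpace ℝ (Fin n), ℂ)) :
    ∃ Ψ : 𝓢(EuclideanSpace ℝ (Fin n), ℂ), ∀ ξ, FTint (⇑f) ξ = Ψ ((2 * Real.pi)⁻¹ • ξ) := by
  refine ⟨𝓕 f, fun ξ => ?_⟩
  rw [SchwartzMap.fourier_coe]
  exact FTV_eq (⇑f) ξ

/-- (Theorem 4.2.) Global smoothing for the generalized Schrödinger
equation `i∂_t u + p(D)² u = 0`, `u(0) = f`: if `n ≥ 3` and the level set `{p = 1}` has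
non-vanishing Gaussian curvature (expressed via the normal map
`ψ = p ∇p/|∇p|` being a bijection of `ℝ^n∖{0}` with smooth inverse and
`|det Dψ| ≥ C₀ > 0`), then `‖⟨x⟩⁻¹ ⟨D⟩^{1/2} u‖_{L²(ℝ_t × ℝ^n_x)} ≤ C ‖f‖_{L²}`. -/
theorem statement19 (n : ℕ) (hn : 3 ≤ n)
    (p : EuclideanSpace ℝ (Fin n) → ℝ)
    (hp_smooth : ContDiffOn ℝ (⊤ : ℕ∞) p {0}ᶜ)
    (hp_pos : ∀ ξ, ξ ≠ 0 → 0 < p ξ)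
    (hp_hom : ∀ lam : ℝ, 0 < lam → ∀ ξ, ξ ≠ 0 → p (lam • ξ) = lam * p ξ)
    (ψ ψinv : EuclideanSpace ℝ (Fin n) → EuclideanSpace ℝ (Fin n))
    -- `ψ(ξ) = p(ξ) ∇p(ξ)/|∇p(ξ)|`:
    (hψdef : ∀ ξ, ξ ≠ 0 → ψ ξ = p ξ • (‖gradient p ξ‖)⁻¹ • gradient p ξ)
    (hψinv : ContDiffOn ℝ (⊤ : ℕ∞) ψinv {0}ᶜ)
    (hψ0 : ∀ ξ, ξ ≠ 0 → ψ ξ ≠ 0) (hψinv0 : ∀ ξ, ξ ≠ 0 → ψinv ξ ≠ 0)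
    (hleft : ∀ ξ, ξ ≠ 0 → ψinv (ψ ξ) = ξ) (hright : ∀ ξ, ξ ≠ 0 → ψ (ψinv ξ) = ξ)
    (C₀ : ℝ) (hC₀ : 0 < C₀) (hdet : ∀ ξ, ξ ≠ 0 → C₀ ≤ |Matrix.det (jacMat ψ ξ)|) :
    ∃ C : ℝ,
      ∀ f : 𝓢(EuclideanSpace ℝ (Fin n), ℂ),
        eLpNorm (fun z : ℝ × EuclideanSpace ℝ (Fin n) =>
            (((jap z.2)⁻¹ : ℝ) : ℂ) *
              -- `⟨D⟩^{1/2} u(t, x)`, where `u(t) = e^{it p(D)²} f`: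
              FTinvInt (fun ξ => (((1 + ‖ξ‖ ^ 2) ^ ((1 : ℝ) / 4) : ℝ) : ℂ) *
                Complex.exp (Complex.I * ((z.1 * p ξ ^ 2 : ℝ) : ℂ)) * FTint (⇑f) ξ) z.2)
          2 volume
          ≤ ENNReal.ofReal C * eLpNorm (⇑f) 2 volume := by
  obtain ⟨k, rfl⟩ : ∃ k, n = k + 3 := ⟨n - 3, by omega⟩
  have hpc : ContinuousOn p {0}ᶜ := hp_smooth.continuousOn
  have hpm : Measurable p := measurable_of_continuousOn_compl_singleton 0 hpc
  obtain ⟨c₀, hc₀, hpc₀⟩ : ∃ c₀ : ℝ, 0 < c₀ ∧ ∀ ξ, ‖ξ‖ = 1 → c₀ ≤ p ξ := by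
    have hne : ∀ ξ ∈ Metric.sphere (0 : EuclideanSpace ℝ (Fin (k+3))) 1, ξ ≠ 0 := by
      intro ξ hξ h
      rw [h] at hξ
      simp at hξ
    obtain ⟨ξ₀, h1, h2⟩ := (isCompact_sphere (0 : EuclideanSpace ℝ (Fin (k+3))) 1).exists_isMinOn
      (NormedSpace.sphere_nonempty.2 zero_le_one) (hpc.mono fun ξ hξ => hne ξ hξ)
    exact ⟨p ξ₀, hp_pos _ (hne _ h1), fun ξ hξ => h2 (by simpa using hξ)⟩
  obtain ⟨A, hAtop, hA⟩ := main_est2 k hpm hp_hom c₀ hc₀ hpc₀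
  set κ : ℂ := (((2 * Real.pi) ^ (k + 3) : ℝ) : ℂ)⁻¹ with hκ
  set A' : ℝ≥0∞ := ‖κ‖ₑ ^ 2 * (A * ENNReal.ofReal ((2 * Real.pi) ^ (k + 3))) with hA'
  have hA'top : A' ≠ ⊤ := by
    rw [hA']
    finiteness
  refine ⟨Real.sqrt A'.toReal, fun f => ?_⟩
  obtain ⟨Ψ, hΨ⟩ := FTint_schwartz f
  have hvc : Continuous fun ξ => FTint (⇑f) ξ := by
    simp_rw [hΨ]
    exact Ψ.continuous.comp (by fun_prop)
  have hmle : ∀ ξ : EuclideanSpace ℝ (Fin (k+3)), ((1 + ‖ξ‖ ^ 2) ^ ((1 : ℝ) / 4)) ^ 2 ≤ 1 + ‖ξ‖ := by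
    intro ξ
    rw [← Real.rpow_natCast, ← Real.rpow_mul (by positivity)]
    norm_num
    rw [← Real.sqrt_eq_rpow]
    refine Real.sqrt_le_iff.2 ⟨by positivity, ?_⟩
    nlinarith [norm_nonneg ξ]
  have hmle' : ∀ ξ : EuclideanSpace ℝ (Fin (k+3)), (1 + ‖ξ‖ ^ 2) ^ ((1 : ℝ) / 4) ≤ 1 + ‖ξ‖ := by
    intro ξ
    refine le_of_sq_le_sq ((hmle ξ).trans ?_) (by positivity)
    nlinarith [norm_nonneg ξ]
  have hmc : Continuous fun ξ : EuclideanSpace ℝ (Fin (k+3)) => (1 + ‖ξ‖ ^ 2) ^ ((1 : ℝ) / 4) :=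
    Continuous.rpow_const (by fun_prop) (fun ξ => Or.inr (by norm_num))
  have hmv : Integrable fun ξ : EuclideanSpace ℝ (Fin (k+3)) =>
      (((1 + ‖ξ‖ ^ 2) ^ ((1 : ℝ) / 4) : ℝ) : ℂ) * FTint (⇑f) ξ := by
    have hr : ((2 * Real.pi)⁻¹ : ℝ) ≠ 0 := by positivity
    have i0 := ((Ψ.integrable (μ := volume)).norm).comp_smul hr
    have i1 := ((Ψ.integrable_pow_mul volume 1).comp_smul hr).const_mul (2 * Real.pi)
    refine (i0.add i1).mono' (Continuous.aestronglyMeasurable (by fun_prop)) ?_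
    refine Filter.Eventually.of_forall fun ξ => ?_
    rw [norm_mul, Complex.norm_real, Real.norm_of_nonneg (by positivity), hΨ]
    simp only [Pi.add_apply, pow_one]
    rw [norm_smul (2 * Real.pi)⁻¹ ξ, Real.norm_of_nonneg (by positivity)]
    calc _ ≤ (1 + ‖ξ‖) * ‖Ψ ((2 * Real.pi)⁻¹ • ξ)‖ := by gcongr; exact hmle' ξ
      _ = _ := by field_simp
  have hest := dual_est hpm hA _ hmc.measurable hmle _ hvc.measurable hmv κ
    (fun z : ℝ × EuclideanSpace ℝ (Fin (k+3)) =>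
            (((jap z.2)⁻¹ : ℝ) : ℂ) *
              FTinvInt (fun ξ => (((1 + ‖ξ‖ ^ 2) ^ ((1 : ℝ) / 4) : ℝ) : ℂ) *
                Complex.exp (Complex.I * ((z.1 * p ξ ^ 2 : ℝ) : ℂ)) * FTint (⇑f) ξ) z.2)
    (fun z => by simp only [FTinvInt, hκ])
  have hpl := planch (f.integrable (μ := volume))
  rw [← eLpNorm_two_sq] at hest
  have hfin : Module.finrank ℝ (EuclideanSpace ℝ (Fin (k+3))) = k + 3 := by simp
  rw [hfin] at hpl
  have hle := hest.trans (mul_le_mul_right (mul_le_mul_right hpl A) _)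
  rw [← eLpNorm_two_sq volume (⇑f)] at hle
  have hC : ENNReal.ofReal (Real.sqrt A'.toReal) ^ 2 = A' := by
    rw [← ENNReal.ofReal_pow (by positivity), Real.sq_sqrt (by positivity),
      ENNReal.ofReal_toReal hA'top]
  refine (ENNReal.pow_le_pow_left_iff two_ne_zero).1 ?_
  rw [mul_pow, hC, hA']
  refine hle.trans (le_of_eq ?_)
  ring
end
end
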